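/- Existence of minimizers of the main energy: Let n ≥ 2, R > 0, 0 < v < v_max < |B_R(0)|. There exist η₀ > 0 and, for each η ≤ η₀, a constant 𝔗₀ > 0, and for each 𝔗 < 𝔗₀ a constant τ₀ > 0 (depending on n, R, v, v_max, η, 𝔗), such that for every admissible nonlinearity 𝔥 and every τ < τ₀, there exists an open set Ω ∈ 𝓗 with ℱ_τ(Ω) ≤ ℱ_τ(Ω′) for all Ω′ ∈ 𝓗, i.e. ℱ_τ attains its infimum over 𝓗. -/

import Mathlib

open MeasureTheory Metric Set Filter Bornology
open scoped ENNReal NNReal Topology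

noncomputable section

abbrev Euc (n : ℕ) := EuclideanSpace ℝ (Fin n)

/-- A smooth test function compactly supported in `Ω`. -/
def IsTestFun {n : ℕ} (Ω : Set (Euc n)) (φ : Euc n → ℝ) : Prop :=
  ContDiff ℝ (⊤ : ℕ∞) φ ∧ HasCompactSupport φ ∧ tsupport φ ⊆ Ω

/-- `u` belongs to `H¹₀(Ω)` with weak gradient `Du`: it is an `L²` limit of smooth
functions compactly supported in `Ω` whose gradients converge to `Du` in `L²`. -/
def MemH10 {n : ℕ} (Ω : Set (Euc n)) (u : Euc n → ℝ) (Du : Euc n → Euc n) : Prop :=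
  MemLp u 2 volume ∧ MemLp Du 2 volume ∧
  ∃ φ : ℕ → Euc n → ℝ, (∀ k, IsTestFun Ω (φ k)) ∧
    Tendsto (fun k => ∫ x, (φ k x - u x) ^ 2) atTop (𝓝 0) ∧
    Tendsto (fun k => ∫ x, ‖gradient (φ k) x - Du x‖ ^ 2) atTop (𝓝 0)

/-- First Dirichlet eigenvalue: infimum of the Rayleigh quotient over `H¹₀(Ω)`. -/
def lam1 {n : ℕ} (Ω : Set (Euc n)) : ℝ :=
  sInf {r | ∃ u Du, MemH10 Ω u Du ∧ (∫ x, u x ^ 2) ≠ 0 ∧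
    r = (∫ x, ‖Du x‖ ^ 2) / (∫ x, u x ^ 2)}

/-- Torsional rigidity: `tor Ω = inf { ∫ (½|∇w|² − w) : w ∈ H¹₀(Ω) }`. -/
def tor {n : ℕ} (Ω : Set (Euc n)) : ℝ :=
  sInf {r | ∃ w Dw, MemH10 Ω w Dw ∧ r = ∫ x, ((1 / 2) * ‖Dw x‖ ^ 2 - w x)}

/-- Normalized first eigenfunction of `Ω`, extended by zero outside `Ω`. -/
def IsEigenfun {n : ℕ} (Ω : Set (Euc n)) (u : Euc n → ℝ) : Prop :=
  (∀ᵐ x ∂volume, 0 ≤ u x) ∧ (∀ x ∉ Ω, u x = 0) ∧ (∫ x, u x ^ 2) = 1 ∧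
  ∃ Du, MemH10 Ω u Du ∧ (∫ x, ‖Du x‖ ^ 2) = lam1 Ω

/-- The torsion function of `Ω` (the minimizer of the torsion energy),
extended by zero outside `Ω`. -/
def IsTorsionFun {n : ℕ} (Ω : Set (Euc n)) (w : Euc n → ℝ) : Prop :=
  (∀ x ∉ Ω, w x = 0) ∧
  ∃ Dw, MemH10 Ω w Dw ∧ (∫ x, ((1 / 2) * ‖Dw x‖ ^ 2 - w x)) = tor Ω

/-- The volume penalization `f_{v,η}`. -/
def fpen (v η t : ℝ) : ℝ := if t ≤ v then η * (t - v) else (t - v) / η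

/-- The base energy `ℰ(Ω) = λ₁(Ω) + 𝔗·tor(Ω) + f_{v,η}(|Ω|)`. -/
def baseE {n : ℕ} (v η 𝔗 : ℝ) (Ω : Set (Euc n)) : ℝ :=
  lam1 Ω + 𝔗 * tor Ω + fpen v η (volume Ω).toReal

/-- The admissible class `𝓗 = { Ω ⊆ B_R(0) open nonempty : |Ω| ≤ v_max }`. -/
def Hclass (n : ℕ) (R vmax : ℝ) : Set (Set (Euc n)) :=
  {Ω | IsOpen Ω ∧ Ω.Nonempty ∧ Ω ⊆ ball (0 : Euc n) R ∧ (volume Ω).toReal ≤ vmax}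

/-- `ℰ_min = inf { ℰ(Ω) : Ω ∈ 𝓗 }`. -/
def Emin (n : ℕ) (R vmax v η 𝔗 : ℝ) : ℝ :=
  sInf (baseE v η 𝔗 '' Hclass n R vmax)

/-- `u` is the (a.e.-) unique normalized first eigenfunction of `Ω`. -/
def UniqueEigen {n : ℕ} (Ω : Set (Euc n)) (u : Euc n → ℝ) : Prop :=
  IsEigenfun Ω u ∧ ∀ u' : Euc n → ℝ, IsEigenfun Ω u' → u' =ᵐ[volume] u

/-- An admissible nonlinearity with threshold `τ₀`: `𝔥 : 𝓗 → [0,1]` which is Lipschitz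
with respect to the symmetric difference plus the `L¹` eigenfunction distance, on sets
of nearly minimal base energy possessing a unique normalized first eigenfunction. -/
def Admissible (n : ℕ) (R vmax v η 𝔗 τ₀ : ℝ) (h : Set (Euc n) → ℝ) : Prop :=
  (∀ Ω ∈ Hclass n R vmax, h Ω ∈ Icc (0 : ℝ) 1) ∧
  ∀ Ω ∈ Hclass n R vmax, ∀ Ω' ∈ Hclass n R vmax,
    baseE v η 𝔗 Ω ≤ Emin n R vmax v η 𝔗 + τ₀ →
    baseE v η 𝔗 Ω' ≤ Emin n R vmax v η 𝔗 + τ₀ →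
    ∀ u u' : Euc n → ℝ, UniqueEigen Ω u → UniqueEigen Ω' u' →
      |h Ω - h Ω'| ≤ (volume (symmDiff Ω Ω')).toReal + ∫ x, |u x - u' x|

/-- The main energy `ℱ_τ(Ω) = ℰ(Ω) + τ·𝔥(Ω)`. -/
def mainE {n : ℕ} (v η 𝔗 τ : ℝ) (h : Set (Euc n) → ℝ) (Ω : Set (Euc n)) : ℝ :=
  baseE v η 𝔗 Ω + τ * h Ω

section
variable {n : ℕ} {φ ψ u u' f g f' b z a w w' F y p m L : Euc n → ℝ} {D D' A B Z W W' U Y P : Euc n → Euc n} {Ω Ω' K S O V : Set (Euc n)} {M δ c ε R r κ C l s Λ v η t vmax 𝔗 c₀ ρ : ℝ}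

lemma mlL {a b c : ℝ} (h : b ≤ c) (h' : 0 ≤ a) : a * b ≤ a * c := mul_le_mul_of_nonneg_left h h'

lemma mlR {a b c : ℝ} (h : b ≤ c) (h' : 0 ≤ a) : b * a ≤ c * a := mul_le_mul_of_nonneg_right h h'

lemma eof {α : Type*} {l : Filter α} {p : α → Prop} (h : ∀ x, p x) : ∀ᶠ x in l, p x := Eventually.of_forall h


lemma weak_seq_compact {E : Type*} [NormedAddCommGroup E] [InnerProductSpace ℝ E] [CompleteSpace E]
    [TopologicalSpace.SeparableSpace E] (z : ℕ → E) (M : ℝ) (hz : ∀ k, ‖z k‖ ≤ M) :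
    ∃ z0 : E, ∃ σ : ℕ → ℕ, StrictMono σ ∧
      ∀ y : E, Tendsto (fun k => inner ℝ (z (σ k)) y) atTop (𝓝 (inner ℝ z0 y)) := by
  have hc := WeakDual.isSeqCompact_closedBall ℝ E (0 : StrongDual ℝ E) M
  have hmem : ∀ k, StrongDual.toWeakDual (InnerProductSpace.toDual ℝ E (z k)) ∈
      (WeakDual.toStrongDual ⁻¹' closedBall (0 : StrongDual ℝ E) M) := by
    intro k
    have : ‖InnerProductSpace.toDual ℝ E (z k)‖ ≤ M := by
      rw [LinearIsometryEquiv.norm_map]; exact hz k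
    simpa [mem_closedBall, dist_zero_right] using this
  obtain ⟨a, -, σ, hσ, hlim⟩ := hc hmem
  refine ⟨(InnerProductSpace.toDual ℝ E).symm (WeakDual.toStrongDual a), σ, hσ, fun y => ?_⟩
  have := ((WeakDual.eval_continuous (𝕜 := ℝ) (E := E) y).tendsto a).comp hlim
  rw [InnerProductSpace.toDual_symm_apply]
  refine this.congr fun k => ?_
  simp

abbrev XH (n : ℕ) := WithLp 2 (Lp ℝ 2 (volume : Measure (Euc n)) × Lp (Euc n) 2 (volume : Measure (Euc n)))

instance factTwo : Fact ((2 : ℝ≥0∞) ≠ ∞) := ⟨by simp⟩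

lemma separable_XH (n : ℕ) : TopologicalSpace.SeparableSpace (XH n) := by
  have h1 : SecondCountableTopology (Lp ℝ 2 (volume : Measure (Euc n))) := inferInstance
  have h2 : SecondCountableTopology (Lp (Euc n) 2 (volume : Measure (Euc n))) := inferInstance
  have h3 : TopologicalSpace.SeparableSpace
    (Lp ℝ 2 (volume : Measure (Euc n)) × Lp (Euc n) 2 (volume : Measure (Euc n))) := inferInstance
  exact (WithLp.homeomorphProd 2 (Lp ℝ 2 (volume : Measure (Euc n)))
    (Lp (Euc n) 2 (volume : Measure (Euc n)))).symm.surjective.denseRange.separableSpace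
    (WithLp.homeomorphProd 2 _ _).symm.continuous




lemma IsTestFun.differentiable (h : IsTestFun Ω φ) :
    Differentiable ℝ φ := h.1.differentiable (by simp)

lemma IsTestFun.continuous_gradient (h : IsTestFun Ω φ) :
    Continuous (gradient φ) :=
  (InnerProductSpace.toDual ℝ (Euc n)).symm.continuous.comp (h.1.continuous_fderiv (by simp))

lemma IsTestFun.tsupport_gradient (_h : IsTestFun Ω φ) :
    tsupport (gradient φ) ⊆ tsupport φ := by
  refine closure_minimal ?_ (isClosed_tsupport _)
  refine Subset.trans ?_ (support_fderiv_subset ℝ (f := φ))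
  intro x hx hx'
  apply hx
  simp [gradient, Function.notMem_support.1 (fun h => h hx')]

lemma IsTestFun.hasCompactSupport_gradient (h : IsTestFun Ω φ) :
    HasCompactSupport (gradient φ) :=
  h.2.1.of_isClosed_subset (isClosed_tsupport _) h.tsupport_gradient

lemma IsTestFun.memLp (h : IsTestFun Ω φ) (p : ℝ≥0∞) :
    MemLp φ p volume := h.1.continuous.memLp_of_hasCompactSupport h.2.1

lemma IsTestFun.memLp_gradient (h : IsTestFun Ω φ) (p : ℝ≥0∞) :
    MemLp (gradient φ) p volume :=
  h.continuous_gradient.memLp_of_hasCompactSupport h.hasCompactSupport_gradient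

lemma IsTestFun.mono (h : IsTestFun Ω φ) (hs : Ω ⊆ Ω') :
    IsTestFun Ω' φ := ⟨h.1, h.2.1, h.2.2.trans hs⟩

lemma gradient_add' (hφ : Differentiable ℝ φ) (hψ : Differentiable ℝ ψ) :
    gradient (fun x => φ x + ψ x) = fun x => gradient φ x + gradient ψ x := by
  ext1 x
  simp only [gradient]
  rw [fderiv_fun_add (hφ x) (hψ x), map_add]

lemma gradient_const_mul' (c : ℝ) :
    gradient (fun x => c * φ x) = fun x => c • gradient φ x := by
  ext1 x
  simp only [gradient]
  rw [show (fun x => c * φ x) = c • φ from rfl, fderiv_const_smul_field]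
  simp

lemma gradient_mul' (hφ : Differentiable ℝ φ) (hψ : Differentiable ℝ ψ) :
    gradient (fun x => φ x * ψ x) = fun x => ψ x • gradient φ x + φ x • gradient ψ x := by
  ext1 x
  simp only [gradient]
  rw [fderiv_fun_mul (hφ x) (hψ x), map_add]
  simp [add_comm]

lemma IsTestFun.add (h : IsTestFun Ω φ) (h' : IsTestFun Ω ψ) :
    IsTestFun Ω (fun x => φ x + ψ x) :=
  ⟨h.1.add h'.1, h.2.1.add h'.2.1,
    (tsupport_add φ ψ).trans (union_subset h.2.2 h'.2.2)⟩

lemma IsTestFun.const_mul (h : IsTestFun Ω φ) (c : ℝ) :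
    IsTestFun Ω (fun x => c * φ x) :=
  ⟨contDiff_const.mul h.1, h.2.1.mul_left, (tsupport_mul_subset_right).trans h.2.2⟩

lemma IsTestFun.zero (Ω : Set (Euc n)) : IsTestFun Ω (fun _ => (0:ℝ)) :=
  ⟨contDiff_const, HasCompactSupport.zero, by simp [tsupport, Function.support]⟩


def mkX (u : Euc n → ℝ) (D : Euc n → Euc n) (hu : MemLp u 2 volume) (hD : MemLp D 2 volume) : XH n :=
  WithLp.toLp 2 (hu.toLp u, hD.toLp D)

def testX (Ω : Set (Euc n)) : Submodule ℝ (XH n) where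
  carrier := {p | ∃ φ, ∃ h : IsTestFun Ω φ, p = mkX φ (gradient φ) (h.memLp 2) (h.memLp_gradient 2)}
  add_mem' := by
    rintro _ _ ⟨φ, h, rfl⟩ ⟨ψ, h', rfl⟩
    refine ⟨_, h.add h', ?_⟩
    simp only [mkX, ← WithLp.toLp_add, Prod.mk_add_mk, ← MemLp.toLp_add]
    congr 2
    simp [gradient_add' h.differentiable h'.differentiable, Pi.add_def]
  zero_mem' := by
    refine ⟨_, IsTestFun.zero Ω, ?_⟩
    have : gradient (fun _ : Euc n => (0:ℝ)) = 0 := by ext1 x; simp [gradient]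
    simp only [mkX, this]
    rfl
  smul_mem' := by
    rintro c _ ⟨φ, h, rfl⟩
    refine ⟨_, h.const_mul c, ?_⟩
    simp only [mkX, ← WithLp.toLp_smul, Prod.smul_mk, ← MemLp.toLp_const_smul]
    congr 2
    simp [gradient_const_mul', Pi.smul_def]

def HS (Ω : Set (Euc n)) : Submodule ℝ (XH n) := (testX Ω).topologicalClosure

lemma isClosed_HS (Ω : Set (Euc n)) : IsClosed (HS Ω : Set (XH n)) :=
  Submodule.isClosed_topologicalClosure _

lemma norm_toLp_sq {E : Type*} [NormedAddCommGroup E] [InnerProductSpace ℝ E]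
    {f : Euc n → E} (hf : MemLp f 2 volume) : ‖hf.toLp f‖ ^ 2 = ∫ x, ‖f x‖ ^ 2 := by
  rw [← real_inner_self_eq_norm_sq, L2.inner_def]
  apply integral_congr_ae
  filter_upwards [hf.coeFn_toLp] with x hx
  rw [hx, real_inner_self_eq_norm_sq]

lemma inner_toLp {E : Type*} [NormedAddCommGroup E] [InnerProductSpace ℝ E]
    {f g : Euc n → E} (hf : MemLp f 2 volume) (hg : MemLp g 2 volume) :
    inner ℝ (hf.toLp f) (hg.toLp g) = ∫ x, inner ℝ (f x) (g x) := by
  rw [L2.inner_def]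
  apply integral_congr_ae
  filter_upwards [hf.coeFn_toLp, hg.coeFn_toLp] with x hx hy
  rw [hx, hy]

lemma dist_mkX_sq (hu : MemLp u 2 volume)
    (hD : MemLp D 2 volume) (hu' : MemLp u' 2 volume) (hD' : MemLp D' 2 volume) :
    ‖mkX u D hu hD - mkX u' D' hu' hD'‖ ^ 2 =
      (∫ x, (u x - u' x) ^ 2) + ∫ x, ‖D x - D' x‖ ^ 2 := by
  rw [WithLp.prod_norm_sq_eq_of_L2]
  simp only [mkX, ← WithLp.toLp_sub, Prod.mk_sub_mk, ← MemLp.toLp_sub]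
  change ‖(hu.sub hu').toLp _‖ ^ 2 + ‖(hD.sub hD').toLp _‖ ^ 2 = _
  rw [norm_toLp_sq, norm_toLp_sq]
  simp only [Pi.sub_apply, Real.norm_eq_abs, sq_abs]

lemma tendsto_mkX {u : ℕ → Euc n → ℝ} {D : ℕ → Euc n → Euc n}
    (hu : ∀ k, MemLp (u k) 2 volume)
    (hD : ∀ k, MemLp (D k) 2 volume) (hu' : MemLp u' 2 volume) (hD' : MemLp D' 2 volume) :
    Tendsto (fun k => mkX (u k) (D k) (hu k) (hD k)) atTop (𝓝 (mkX u' D' hu' hD')) ↔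
     Tendsto (fun k => ∫ x, (u k x - u' x) ^ 2) atTop (𝓝 0) ∧
    Tendsto (fun k => ∫ x, ‖D k x - D' x‖ ^ 2) atTop (𝓝 0) := by
  rw [tendsto_iff_norm_sub_tendsto_zero]
  have key : ∀ k, ‖mkX (u k) (D k) (hu k) (hD k) - mkX u' D' hu' hD'‖ ^ 2 = _ :=
    fun k => dist_mkX_sq (hu k) (hD k) hu' hD'
  have nn1 : ∀ k, 0 ≤ ∫ x, (u k x - u' x) ^ 2 := fun k => integral_nonneg fun x => sq_nonneg _
  have nn2 : ∀ k, 0 ≤ ∫ x, ‖D k x - D' x‖ ^ 2 := fun k => integral_nonneg fun x => sq_nonneg _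
  constructor
  · intro h
    have h2 := h.pow 2
    simp only [key] at h2
    norm_num at h2
    exact ⟨squeeze_zero nn1 (fun k => le_add_of_nonneg_right (nn2 k)) h2,
      squeeze_zero nn2 (fun k => le_add_of_nonneg_left (nn1 k)) h2⟩
  · rintro ⟨h1, h2⟩
    have h3 := (h1.add h2).sqrt
    simp only [add_zero, Real.sqrt_zero] at h3
    refine h3.congr fun k => ?_
    rw [← key, Real.sqrt_sq (norm_nonneg _)]

lemma memH10_iff :
    MemH10 Ω u D ↔ ∃ (hu : MemLp u 2 volume) (hD : MemLp D 2 volume), mkX u D hu hD ∈ HS Ω := by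
  constructor
  · rintro ⟨hu, hD, φ, hφ, h1, h2⟩
    refine ⟨hu, hD, ?_⟩
    exact mem_closure_of_tendsto ((tendsto_mkX (fun k => (hφ k).memLp 2)
      (fun k => (hφ k).memLp_gradient 2) hu hD).2 ⟨h1, h2⟩)
      (eof fun k => ⟨φ k, hφ k, rfl⟩)
  · rintro ⟨hu, hD, h⟩
    refine ⟨hu, hD, ?_⟩
    obtain ⟨p, hp, hlim⟩ := mem_closure_iff_seq_limit.1 h
    choose φ hφ hpe using hp
    refine ⟨φ, hφ, ?_⟩
    refine (tendsto_mkX (fun k => (hφ k).memLp 2) (fun k => (hφ k).memLp_gradient 2) hu hD).1 ?_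
    exact hlim.congr hpe

lemma mkX_coe (p : XH n) : mkX (p.fst) (p.snd) (Lp.memLp _) (Lp.memLp _) = p := by
  simp only [mkX, Lp.toLp_coeFn]
  rfl

lemma memH10_of_mem {p : XH n} (h : p ∈ HS Ω) : MemH10 Ω p.fst p.snd :=
  memH10_iff.2 ⟨Lp.memLp _, Lp.memLp _, by rw [mkX_coe]; exact h⟩

lemma MemH10.congr
    (h : MemH10 Ω u D) (hu : u =ᵐ[volume] u') (hD : D =ᵐ[volume] D') : MemH10 Ω u' D' := by
  obtain ⟨h1, h2, h3⟩ := memH10_iff.1 h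
  refine memH10_iff.2 ⟨(memLp_congr_ae hu).1 h1, (memLp_congr_ae hD).1 h2, ?_⟩
  convert h3 using 1
  simp only [mkX]
  congr 2
  · exact (MemLp.toLp_eq_toLp_iff _ _).2 hu.symm
  · exact (MemLp.toLp_eq_toLp_iff _ _).2 hD.symm

lemma MemH10.lin
    (h : MemH10 Ω u D) (h' : MemH10 Ω u' D') (c : ℝ) :
    MemH10 Ω (fun x => u x + c * u' x) (fun x => D x + c • D' x) := by
  obtain ⟨h1, h2, h3⟩ := memH10_iff.1 h
  obtain ⟨h1', h2', h3'⟩ := memH10_iff.1 h'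
  refine memH10_iff.2 ⟨h1.add (h1'.const_mul c), h2.add (h2'.const_smul c), ?_⟩
  exact (HS Ω).add_mem h3 ((HS Ω).smul_mem c h3')

lemma MemH10.add
    (h : MemH10 Ω u D) (h' : MemH10 Ω u' D') :
    MemH10 Ω (fun x => u x + u' x) (fun x => D x + D' x) := by
  simpa using h.lin h' 1

lemma MemH10.sub
    (h : MemH10 Ω u D) (h' : MemH10 Ω u' D') :
    MemH10 Ω (fun x => u x - u' x) (fun x => D x - D' x) := by
  simpa [sub_eq_add_neg] using h.lin h' (-1)

lemma IsTestFun.memH10 (h : IsTestFun Ω φ) :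
    MemH10 Ω φ (gradient φ) :=
  ⟨h.memLp 2, h.memLp_gradient 2, fun _ => φ, fun _ => h, by simp, by simp⟩

lemma MemH10.zero (Ω : Set (Euc n)) : MemH10 Ω (fun _ => (0:ℝ)) (fun _ => 0) := by
  have := (IsTestFun.zero Ω).memH10
  convert this using 1
  ext1 x; simp [gradient]

lemma MemH10.smul
    (h : MemH10 Ω u D) (c : ℝ) : MemH10 Ω (fun x => c * u x) (fun x => c • D x) := by
  simpa using (MemH10.zero Ω).lin h c

lemma MemH10.mono
    (h : MemH10 Ω u D) (hs : Ω ⊆ Ω') : MemH10 Ω' u D := by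
  obtain ⟨h1, h2, φ, h3, h4⟩ := h
  exact ⟨h1, h2, φ, fun k => (h3 k).mono hs, h4⟩

lemma MemH10.of_tendsto {u : ℕ → Euc n → ℝ} {D : ℕ → Euc n → Euc n}
    (h : ∀ k, MemH10 Ω (u k) (D k))
    (hu' : MemLp u' 2 volume) (hD' : MemLp D' 2 volume)
    (h1 : Tendsto (fun k => ∫ x, (u k x - u' x) ^ 2) atTop (𝓝 0))
    (h2 : Tendsto (fun k => ∫ x, ‖D k x - D' x‖ ^ 2) atTop (𝓝 0)) : MemH10 Ω u' D' := by
  choose a b c using fun k => memH10_iff.1 (h k)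
  refine memH10_iff.2 ⟨hu', hD', ?_⟩
  exact (isClosed_HS Ω).mem_of_tendsto ((tendsto_mkX a b hu' hD').2 ⟨h1, h2⟩)
    (eof c)

/-- Weak compactness in `H¹₀(Ω)`. -/
lemma weak_H10 {u : ℕ → Euc n → ℝ} {D : ℕ → Euc n → Euc n}
    (h : ∀ k, MemH10 Ω (u k) (D k)) (h1 : ∀ k, ∫ x, (u k x) ^ 2 ≤ M)
    (h2 : ∀ k, ∫ x, ‖D k x‖ ^ 2 ≤ M) :
    ∃ u' D', ∃ σ : ℕ → ℕ, StrictMono σ ∧ MemH10 Ω u' D' ∧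
      (∀ g : Euc n → ℝ, MemLp g 2 volume →
        Tendsto (fun k => ∫ x, u (σ k) x * g x) atTop (𝓝 (∫ x, u' x * g x))) ∧
      (∀ G : Euc n → Euc n, MemLp G 2 volume →
        Tendsto (fun k => ∫ x, inner ℝ (D (σ k) x) (G x)) atTop (𝓝 (∫ x, inner ℝ (D' x) (G x)))) := by
  choose a b c using fun k => memH10_iff.1 (h k)
  haveI := separable_XH n
  obtain ⟨z, σ, hσ, hz⟩ := weak_seq_compact (fun k => mkX (u k) (D k) (a k) (b k)) (Real.sqrt (M + M))
    (fun k => by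
      apply Real.le_sqrt_of_sq_le
      have := dist_mkX_sq (a k) (b k) (MemLp.zero (ε := ℝ)) (MemLp.zero (ε := Euc n))
      have h0 : mkX (0 : Euc n → ℝ) (0 : Euc n → Euc n) MemLp.zero MemLp.zero = 0 := rfl
      rw [h0, sub_zero] at this
      rw [this]
      simpa using add_le_add (h1 k) (h2 k))
  have hzm : z ∈ HS Ω := by
    have hcl : HS Ω = (HS Ω)ᗮᗮ := by
      haveI : CompleteSpace (HS Ω) := (isClosed_HS Ω).completeSpace_coe
      rw [Submodule.orthogonal_orthogonal]
    rw [hcl, Submodule.mem_orthogonal']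
    intro y hy
    refine tendsto_nhds_unique (hz y) ?_
    refine tendsto_const_nhds.congr fun k => ?_
    exact ((Submodule.mem_orthogonal _ _).1 hy _ (c (σ k))).symm
  refine ⟨z.fst, z.snd, σ, hσ, memH10_of_mem hzm, fun g hg => ?_, fun G hG => ?_⟩
  · have := hz (mkX g 0 hg MemLp.zero)
    rw [← mkX_coe z] at this
    simp only [WithLp.prod_inner_apply, mkX, inner_toLp] at this
    simpa [mul_comm] using this
  · have := hz (mkX 0 G MemLp.zero hG)
    rw [← mkX_coe z] at this
    simp only [WithLp.prod_inner_apply, mkX, inner_toLp] at this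
    simpa [mul_comm] using this


section L2tool
variable {E : Type*} [NormedAddCommGroup E] [InnerProductSpace ℝ E]

lemma lii {f g : Euc n → E} (hf : MemLp f 2 volume) (hg : MemLp g 2 volume) :
    Integrable (fun x => inner ℝ (f x) (g x)) volume := by
  have := L2.integrable_inner (𝕜 := ℝ) (hf.toLp f) (hg.toLp g)
  refine this.congr ?_
  filter_upwards [hf.coeFn_toLp, hg.coeFn_toLp] with x hx hy
  rw [hx, hy]

lemma lsi {f : Euc n → E} (hf : MemLp f 2 volume) :
    Integrable (fun x => ‖f x‖ ^ 2) volume := by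
  refine (lii hf hf).congr (eof fun x => ?_)
  simp [real_inner_self_eq_norm_sq]

lemma lmi (hf : MemLp f 2 volume) (hg : MemLp g 2 volume) :
    Integrable (fun x => f x * g x) volume := by
  refine (lii hf hg).congr (eof fun x => ?_)
  simp [mul_comm]

lemma lri (hf : MemLp f 2 volume) :
    Integrable (fun x => f x ^ 2) volume := by
  refine (lmi hf hf).congr (eof fun x => ?_)
  simp [sq]

lemma l2_cs {f g : Euc n → E} (hf : MemLp f 2 volume) (hg : MemLp g 2 volume) :
    (∫ x, inner ℝ (f x) (g x)) ^ 2 ≤ (∫ x, ‖f x‖ ^ 2) * ∫ x, ‖g x‖ ^ 2 := by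
  rw [← inner_toLp hf hg, ← norm_toLp_sq hf, ← norm_toLp_sq hg, ← mul_pow, ← sq_abs]
  exact pow_le_pow_left₀ (abs_nonneg _) (abs_real_inner_le_norm _ _) 2

lemma l2_cs' (hf : MemLp f 2 volume) (hg : MemLp g 2 volume) :
    (∫ x, f x * g x) ^ 2 ≤ (∫ x, f x ^ 2) * ∫ x, g x ^ 2 := by
  have := l2_cs hf hg
  simpa [mul_comm] using this

lemma l2_expand {f g : Euc n → E} (hf : MemLp f 2 volume) (hg : MemLp g 2 volume) (c : ℝ) :
    ∫ x, ‖f x + c • g x‖ ^ 2 = (∫ x, ‖f x‖ ^ 2) + 2 * c * (∫ x, inner ℝ (f x) (g x))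
      + c ^ 2 * ∫ x, ‖g x‖ ^ 2 := by
  rw [← inner_toLp hf hg, ← norm_toLp_sq hf, ← norm_toLp_sq hg]
  have : ∫ x, ‖f x + c • g x‖ ^ 2 = ‖(hf.add (hg.const_smul c)).toLp _‖ ^ 2 := by
    rw [norm_toLp_sq]; rfl
  rw [this, MemLp.toLp_add hf (hg.const_smul c), MemLp.toLp_const_smul c hg, norm_add_sq_real, real_inner_smul_right,
    norm_smul, mul_pow, Real.norm_eq_abs, sq_abs]
  ring

lemma l2_expand' (hf : MemLp f 2 volume) (hg : MemLp g 2 volume) (c : ℝ) :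
    ∫ x, (f x + c * g x) ^ 2 = (∫ x, f x ^ 2) + 2 * c * (∫ x, f x * g x)
      + c ^ 2 * ∫ x, g x ^ 2 := by
  have := l2_expand hf hg c
  simpa [mul_comm] using this

lemma l2_inner_tendsto {f : ℕ → Euc n → E} {f' g : Euc n → E} (hf : ∀ k, MemLp (f k) 2 volume)
    (hf' : MemLp f' 2 volume) (hg : MemLp g 2 volume)
    (h : Tendsto (fun k => ∫ x, ‖f k x - f' x‖ ^ 2) atTop (𝓝 0)) :
    Tendsto (fun k => ∫ x, inner ℝ (f k x) (g x)) atTop (𝓝 (∫ x, inner ℝ (f' x) (g x))) := by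
  rw [tendsto_iff_norm_sub_tendsto_zero]
  have h2 : Tendsto (fun k => Real.sqrt ((∫ x, ‖f k x - f' x‖ ^ 2) * ∫ x, ‖g x‖ ^ 2)) atTop (𝓝 0) := by
    have := (h.mul_const (∫ x, ‖g x‖ ^ 2)).sqrt
    simpa using this
  refine squeeze_zero (fun k => norm_nonneg _) (fun k => ?_) h2
  apply Real.le_sqrt_of_sq_le
  rw [← integral_sub (lii (hf k) hg) (lii hf' hg), Real.norm_eq_abs, sq_abs]
  have := l2_cs ((hf k).sub hf') hg
  simpa [inner_sub_left] using this

lemma l2_mul_tendsto {f : ℕ → Euc n → ℝ} (hf : ∀ k, MemLp (f k) 2 volume)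
    (hf' : MemLp f' 2 volume) (hg : MemLp g 2 volume)
    (h : Tendsto (fun k => ∫ x, (f k x - f' x) ^ 2) atTop (𝓝 0)) :
    Tendsto (fun k => ∫ x, f k x * g x) atTop (𝓝 (∫ x, f' x * g x)) := by
  have := l2_inner_tendsto hf hf' hg (by simpa using h)
  simpa [mul_comm] using this

lemma l2_sq_tendsto {f : ℕ → Euc n → E} {f' : Euc n → E} (hf : ∀ k, MemLp (f k) 2 volume)
    (hf' : MemLp f' 2 volume)
    (h : Tendsto (fun k => ∫ x, ‖f k x - f' x‖ ^ 2) atTop (𝓝 0)) :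
    Tendsto (fun k => ∫ x, ‖f k x‖ ^ 2) atTop (𝓝 (∫ x, ‖f' x‖ ^ 2)) := by
  have h1 := l2_inner_tendsto hf hf' hf' h
  have h2 := (h.add (h1.const_mul 2)).sub_const (∫ x, ‖f' x‖ ^ 2)
  have e : ∀ k, (∫ x, ‖f k x - f' x‖ ^ 2) + 2 * (∫ x, inner ℝ (f k x) (f' x)) - ∫ x, ‖f' x‖ ^ 2
      = ∫ x, ‖f k x‖ ^ 2 := by
    intro k
    have := l2_expand (hf k) hf' (-1)
    simp only [neg_smul, one_smul, ← sub_eq_add_neg] at this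
    rw [this]; ring
  simp only [e] at h2
  refine h2.trans_eq ?_
  congr 1
  simp only [real_inner_self_eq_norm_sq]; ring

lemma l2_rsq_tendsto {f : ℕ → Euc n → ℝ} (hf : ∀ k, MemLp (f k) 2 volume)
    (hf' : MemLp f' 2 volume)
    (h : Tendsto (fun k => ∫ x, (f k x - f' x) ^ 2) atTop (𝓝 0)) :
    Tendsto (fun k => ∫ x, f k x ^ 2) atTop (𝓝 (∫ x, f' x ^ 2)) := by
  have := l2_sq_tendsto hf hf' (by simpa using h)
  simpa using this

lemma l2_ae_zero {f : Euc n → E} (hf : MemLp f 2 volume) (h : ∫ x, ‖f x‖ ^ 2 = 0) :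
    f =ᵐ[volume] 0 := by
  rw [integral_eq_zero_iff_of_nonneg (fun x => sq_nonneg _) (lsi hf)] at h
  filter_upwards [h] with x hx
  simpa using hx

lemma l2_rae_zero (hf : MemLp f 2 volume) (h : ∫ x, f x ^ 2 = 0) :
    f =ᵐ[volume] 0 := l2_ae_zero hf (by simpa using h)

lemma l2_triangle {f g : Euc n → E} (hf : MemLp f 2 volume) (hg : MemLp g 2 volume) :
    ∫ x, ‖f x + g x‖ ^ 2 ≤ 2 * (∫ x, ‖f x‖ ^ 2) + 2 * ∫ x, ‖g x‖ ^ 2 := by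
  rw [← integral_const_mul, ← integral_const_mul, ← integral_add ((lsi hf).const_mul 2) ((lsi hg).const_mul 2)]
  refine integral_mono (lsi (hf.add hg)) (((lsi hf).const_mul 2).add ((lsi hg).const_mul 2)) fun x => ?_
  have := norm_add_le (f x) (g x)
  have h0 := norm_nonneg (f x + g x)
  simp only [Pi.add_apply]
  nlinarith [sq_nonneg (‖f x‖ - ‖g x‖)]

/-- From `L²` convergence extract an a.e. convergent subsequence. -/
lemma l2_ae_subseq {f : ℕ → Euc n → E} {f' : Euc n → E} (hf : ∀ k, MemLp (f k) 2 volume)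
    (hf' : MemLp f' 2 volume)
    (h : Tendsto (fun k => ∫ x, ‖f k x - f' x‖ ^ 2) atTop (𝓝 0)) :
    ∃ σ : ℕ → ℕ, StrictMono σ ∧ ∀ᵐ x ∂volume, Tendsto (fun k => f (σ k) x) atTop (𝓝 (f' x)) := by
  have h1 : Tendsto (fun k => (hf k).toLp (f k)) atTop (𝓝 (hf'.toLp f')) := by
    rw [tendsto_iff_norm_sub_tendsto_zero]
    have := h.sqrt
    simp only [Real.sqrt_zero] at this
    refine this.congr fun k => ?_
    rw [← MemLp.toLp_sub, ← Real.sqrt_sq (norm_nonneg (((hf k).sub hf').toLp _)), norm_toLp_sq]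
    rfl
  have h2 := (Lp.tendsto_Lp_iff_tendsto_eLpNorm'' f hf f' hf').1 h1
  obtain ⟨σ, hσ, h3⟩ := (tendstoInMeasure_of_tendsto_eLpNorm (by norm_num) (fun k => (hf k).1) hf'.1 h2).exists_seq_tendsto_ae
  exact ⟨σ, hσ, h3⟩

end L2tool


lemma ibp_test (hφ : IsTestFun univ φ) (hψ : IsTestFun univ ψ) (e : Euc n) :
    ∫ x, inner ℝ (gradient φ x) e * ψ x = - ∫ x, φ x * inner ℝ (gradient ψ x) e := by
  have hcφ : Continuous fun x => inner ℝ (gradient φ x) e := hφ.continuous_gradient.inner continuous_const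
  have hcψ : Continuous fun x => inner ℝ (gradient ψ x) e := hψ.continuous_gradient.inner continuous_const
  have i1 : Integrable (fun x => fderiv ℝ φ x e * ψ x) volume := by
    simp only [← inner_gradient_left (𝕜 := ℝ)]
    exact (hcφ.mul hψ.1.continuous).integrable_of_hasCompactSupport hψ.2.1.mul_left
  have i2 : Integrable (fun x => φ x * fderiv ℝ ψ x e) volume := by
    simp only [← inner_gradient_left (𝕜 := ℝ)]
    exact (hφ.1.continuous.mul hcψ).integrable_of_hasCompactSupport hφ.2.1.mul_right
  have i3 : Integrable (fun x => φ x * ψ x) volume :=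
    (hφ.1.continuous.mul hψ.1.continuous).integrable_of_hasCompactSupport hφ.2.1.mul_right
  have := integral_mul_fderiv_eq_neg_fderiv_mul_of_integrable i1 i2 i3 (fun x _ => hφ.differentiable x) (fun x _ => hψ.differentiable x)
  simp only [inner_gradient_left (𝕜 := ℝ)]
  linarith

lemma ibp (hu : MemH10 univ u D) (hψ : IsTestFun univ ψ) (e : Euc n) :
    ∫ x, inner ℝ (D x) (ψ x • e) = - ∫ x, u x * inner ℝ (gradient ψ x) e := by
  obtain ⟨h1, h2, φ, hφ, l1, l2⟩ := hu
  have hψe : MemLp (fun x => ψ x • e) 2 volume := by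
    refine (hψ.1.continuous.smul continuous_const).memLp_of_hasCompactSupport hψ.2.1.smul_right
  have hge : MemLp (fun x => inner ℝ (gradient ψ x) e) 2 volume := by
    refine (hψ.continuous_gradient.inner continuous_const).memLp_of_hasCompactSupport ?_
    exact hψ.hasCompactSupport_gradient.comp_left (g := fun y => inner ℝ y e) (by simp)
  have t1 := l2_inner_tendsto (fun k => (hφ k).memLp_gradient 2) h2 hψe l2
  have t2 := (l2_mul_tendsto (fun k => (hφ k).memLp 2) h1 hge l1).neg
  refine tendsto_nhds_unique t1 (t2.congr fun k => ?_)
  rw [← ibp_test (hφ k) hψ e]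
  simp [inner_smul_right, mul_comm]

lemma grad_unique (hu : MemH10 univ u D)
    (hu' : MemH10 univ u D') : D =ᵐ[volume] D' := by
  have hd := hu.sub hu'
  have := ae_eq_zero_of_integral_contDiff_smul_eq_zero (f := fun x => D x - D' x) (μ := volume)
    (hd.2.1.locallyIntegrable (by norm_num)) (fun g hg hgc => by
      have hgt : IsTestFun univ g := ⟨hg, hgc, subset_univ _⟩
      apply ext_inner_left ℝ
      intro e
      rw [← integral_inner]
      · have := ibp hd hgt e
        simp only [sub_self, zero_mul, integral_zero, neg_zero] at this
        rw [inner_zero_right, ← this]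
        congr 1; ext x; rw [inner_smul_right, inner_smul_right, real_inner_comm]
      · exact (hd.2.1.locallyIntegrable (by norm_num)).integrable_smul_left_of_hasCompactSupport hg.continuous hgc
      )
  filter_upwards [this] with x hx
  exact sub_eq_zero.1 hx

lemma MemH10.ae_zero
    (hu : MemH10 Ω u D) : ∀ᵐ x ∂volume, x ∉ Ω → u x = 0 := by
  obtain ⟨h1, h2, φ, hφ, l1, l2⟩ := hu
  obtain ⟨σ, -, h⟩ := l2_ae_subseq (fun k => (hφ k).memLp 2) h1 (by simpa using l1)
  filter_upwards [h] with x hx hxΩ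
  refine tendsto_nhds_unique hx (tendsto_const_nhds.congr fun k => ?_)
  exact (image_eq_zero_of_notMem_tsupport fun h => hxΩ ((hφ _).2.2 h)).symm



lemma l2_dct {E : Type*} [NormedAddCommGroup E] [InnerProductSpace ℝ E] {f : ℕ → Euc n → E} {f' : Euc n → E}
    (hf : ∀ k, AEStronglyMeasurable (f k) volume) (hb : MemLp b 2 volume)
    (hfb : ∀ k, ∀ᵐ x ∂volume, ‖f k x‖ ≤ b x)
    (hl : ∀ᵐ x ∂volume, Tendsto (fun k => f k x) atTop (𝓝 (f' x))) :
    MemLp f' 2 volume ∧ Tendsto (fun k => ∫ x, ‖f k x - f' x‖ ^ 2) atTop (𝓝 0) := by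
  have hf'm : AEStronglyMeasurable f' volume := aestronglyMeasurable_of_tendsto_ae atTop hf hl
  have hfb' := ae_all_iff.2 hfb
  have hfb'' : ∀ᵐ x ∂volume, ‖f' x‖ ≤ b x := by
    filter_upwards [hl, hfb'] with x h1 h2
    exact le_of_tendsto h1.norm (eof h2)
  have hm : MemLp f' 2 volume := hb.mono hf'm (by
    filter_upwards [hfb''] with x hx
    exact hx.trans (le_abs_self _))
  refine ⟨hm, ?_⟩
  have := tendsto_integral_of_dominated_convergence (F := fun k x => ‖f k x - f' x‖ ^ 2)
    (f := fun _ => (0:ℝ)) (μ := volume) (fun x => 4 * b x ^ 2)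
    (fun k => (((hf k).sub hf'm).norm.pow 2)) ((lri hb).const_mul 4) (fun k => by
      filter_upwards [hfb k, hfb''] with x h1 h2
      rw [Real.norm_eq_abs, abs_of_nonneg (sq_nonneg _)]
      have := norm_sub_le (f k x) (f' x)
      have h0 := norm_nonneg (f k x - f' x)
      nlinarith) (by
      filter_upwards [hl] with x hx
      have := ((hx.sub_const (f' x)).norm).pow 2
      simpa using this)
  simpa using this

lemma chain_smooth (hz : MemH10 Ω z D)
    {F : ℝ → ℝ} (hF : ContDiff ℝ (⊤ : ℕ∞) F) (h0 : F 0 = 0) (hM : ∀ t, |deriv F t| ≤ M) :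
    MemH10 Ω (fun x => F (z x)) (fun x => deriv F (z x) • D x) := by
  obtain ⟨h1, h2, φ, hφ, l1, l2⟩ := hz
  obtain ⟨σ, hσ, hae⟩ := l2_ae_subseq (fun k => (hφ k).memLp 2) h1 (by simpa using l1)
  have hFd : Differentiable ℝ F := hF.differentiable (by simp)
  have hM0 : 0 ≤ M := (abs_nonneg _).trans (hM 0)
  have hF'c : Continuous (deriv F) := hF.continuous_deriv (by simp)
  have hlip : ∀ s t, |F s - F t| ≤ M * |s - t| := fun s t => by
    have := Convex.norm_image_sub_le_of_norm_deriv_le (f := F) (C := M) (s := univ)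
      (fun x _ => hFd x) (fun x _ => hM x) convex_univ (mem_univ t) (mem_univ s)
    simpa using this
  have hzm : MemLp (fun x => F (z x)) 2 volume := by
    refine (h1.norm.const_mul M).mono (hF.continuous.comp_aestronglyMeasurable h1.1) (eof fun x => ?_)
    have := hlip (z x) 0
    simp only [h0, sub_zero] at this
    simpa [abs_mul, abs_of_nonneg hM0] using this
  have hDm : MemLp (fun x => deriv F (z x) • D x) 2 volume := by
    refine (h2.norm.const_mul M).mono ((hF'c.comp_aestronglyMeasurable h1.1).smul h2.1) (eof fun x => ?_)
    simp only [norm_smul, Real.norm_eq_abs, abs_mul, abs_norm, abs_of_nonneg hM0]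
    exact mlR (hM _) (norm_nonneg _)
  have hgr : ∀ k x, gradient (fun x => F (φ k x)) x = deriv F (φ k x) • gradient (φ k) x := by
    intro k x
    apply ext_inner_right ℝ
    intro e
    rw [inner_gradient_left, inner_smul_left, inner_gradient_left]
    have : HasFDerivAt (fun x => F (φ k x)) (deriv F (φ k x) • fderiv ℝ (φ k) x) x :=
      (hFd _).hasDerivAt.comp_hasFDerivAt x ((hφ k).differentiable x).hasFDerivAt
    rw [this.fderiv]; simp
  refine ⟨hzm, hDm, fun k x => F (φ (σ k) x), fun k => ⟨hF.comp (hφ _).1, ?_, ?_⟩, ?_, ?_⟩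
  · exact (hφ _).2.1.comp_left (g := F) h0
  · refine (closure_mono ?_).trans (hφ (σ k)).2.2
    exact Function.support_comp_subset h0 _
  · have := (l1.comp hσ.tendsto_atTop).const_mul (M ^ 2)
    rw [mul_zero] at this
    refine squeeze_zero (fun k => integral_nonneg fun x => sq_nonneg _) (fun k => ?_) this
    simp only [Function.comp]
    rw [← integral_const_mul]
    have hs := ((hφ (σ k)).memLp 2).sub h1
    refine integral_mono_of_nonneg (eof fun x => sq_nonneg _) ((lri hs).const_mul _) (eof fun x => ?_)
    have := hlip (φ (σ k) x) (z x)
    have h3 := pow_le_pow_left₀ (abs_nonneg _) this 2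
    simpa [mul_pow] using h3
  · have hd := l2_dct (f := fun k x => deriv F (φ (σ k) x) • D x) (f' := fun x => deriv F (z x) • D x)
      (b := fun x => M * ‖D x‖) (fun k => (hF'c.comp_aestronglyMeasurable ((hφ _).memLp 2).1).smul h2.1)
      (h2.norm.const_mul M) (fun k => eof fun x => by
        simp only [norm_smul]; exact mlR (hM _) (norm_nonneg _))
      (by
        filter_upwards [hae] with x hx
        exact ((hF'c.tendsto _).comp hx).smul_const _)
    have hlim := ((l2.comp hσ.tendsto_atTop).const_mul (2 * M ^ 2)).add (hd.2.const_mul 2)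
    simp only [mul_zero, add_zero] at hlim
    refine squeeze_zero (fun k => integral_nonneg fun x => sq_nonneg _) (fun k => ?_) hlim
    have hsub := ((hφ (σ k)).memLp_gradient 2).sub h2
    have m1 : MemLp (fun x => deriv F (φ (σ k) x) • (gradient (φ (σ k)) x - D x)) 2 volume := by
      refine (hsub.norm.const_mul M).mono ((hF'c.comp_aestronglyMeasurable ((hφ _).memLp 2).1).smul hsub.1) (eof fun x => ?_)
      simp only [norm_smul, Real.norm_eq_abs, abs_mul, abs_norm, abs_of_nonneg hM0]
      exact mlR (hM _) (norm_nonneg _)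
    have m2 : MemLp (fun x => deriv F (φ (σ k) x) • D x - deriv F (z x) • D x) 2 volume := by
      refine MemLp.sub ?_ hDm
      refine (h2.norm.const_mul M).mono ((hF'c.comp_aestronglyMeasurable ((hφ _).memLp 2).1).smul h2.1) (eof fun x => ?_)
      simp only [norm_smul, Real.norm_eq_abs, abs_mul, abs_norm, abs_of_nonneg hM0]
      exact mlR (hM _) (norm_nonneg _)
    have t := l2_triangle m1 m2
    have e : ∀ x, gradient (fun x => F (φ (σ k) x)) x - deriv F (z x) • D x =
        deriv F (φ (σ k) x) • (gradient (φ (σ k)) x - D x) + (deriv F (φ (σ k) x) • D x - deriv F (z x) • D x) := by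
      intro x; rw [hgr, smul_sub]; abel
    simp only [e]
    refine t.trans (add_le_add ?_ le_rfl)
    rw [mul_assoc]
    refine mlL ?_ (by norm_num)
    simp only [Function.comp]
    rw [← integral_const_mul]
    refine integral_mono (lsi m1) ((lsi hsub).const_mul _) fun x => ?_
    simp only [norm_smul, mul_pow, Pi.sub_apply]
    refine mlR ?_ (sq_nonneg _)
    exact pow_le_pow_left₀ (norm_nonneg _) (hM _) 2

lemma chain_lim (hz : MemH10 Ω z D)
    {F : ℕ → ℝ → ℝ} (hF : ∀ j, ContDiff ℝ (⊤ : ℕ∞) (F j)) (h0 : ∀ j, F j 0 = 0)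
    (hM : ∀ j t, |deriv (F j) t| ≤ M) {F' G : ℝ → ℝ} (hl : ∀ t, Tendsto (fun j => F j t) atTop (𝓝 (F' t)))
    (hG : ∀ t, Tendsto (fun j => deriv (F j) t) atTop (𝓝 (G t))) :
    MemH10 Ω (fun x => F' (z x)) (fun x => G (z x) • D x) := by
  have hj := fun j => chain_smooth hz (hF j) (h0 j) (hM j)
  have hM0 : 0 ≤ M := (abs_nonneg _).trans (hM 0 0)
  have a := l2_dct (b := fun x => M * ‖z x‖) (fun j => (hj j).1.1) (hz.1.norm.const_mul M)
    (fun j => eof fun x => by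
      have := Convex.norm_image_sub_le_of_norm_deriv_le (f := F j) (C := M) (s := univ)
        (fun x _ => (hF j).differentiable (by simp) x) (fun x _ => hM j x) convex_univ (mem_univ 0) (mem_univ (z x))
      simpa [h0] using this) (eof fun x => hl (z x))
  have b := l2_dct (b := fun x => M * ‖D x‖) (fun j => (hj j).2.1.1) (hz.2.1.norm.const_mul M)
    (fun j => eof fun x => by
      simp only [norm_smul]; exact mlR (hM _ _) (norm_nonneg _))
      (eof fun x => (hG (z x)).smul_const (D x))
  exact MemH10.of_tendsto hj a.1 b.1 (by simpa using a.2) b.2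

/-- smooth approximation of `t ↦ max (t - c) 0` -/
def Fap (c δ t : ℝ) : ℝ := (Real.sqrt ((t - c - δ) ^ 2 + δ ^ 4) + (t - c - δ)) / 2
  - (Real.sqrt ((0 - c - δ) ^ 2 + δ ^ 4) + (0 - c - δ)) / 2

lemma Fap_contDiff (c : ℝ) (hδ : 0 < δ) : ContDiff ℝ (⊤ : ℕ∞) (Fap c δ) := by
  unfold Fap
  refine ContDiff.sub (ContDiff.div_const (ContDiff.add (ContDiff.sqrt ?_ ?_) ?_) _) contDiff_const
  · fun_prop
  · intro t; positivity
  · fun_prop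

lemma Fap_deriv (c : ℝ) (hδ : 0 < δ) (t : ℝ) :
    deriv (Fap c δ) t = ((t - c - δ) / Real.sqrt ((t - c - δ) ^ 2 + δ ^ 4) + 1) / 2 := by
  have hp : 0 < (t - c - δ) ^ 2 + δ ^ 4 := by positivity
  have h1 : HasDerivAt (fun t : ℝ => t - c - δ) 1 t := ((hasDerivAt_id t).sub_const c).sub_const δ
  have h2 := ((((h1.pow 2).add_const (δ ^ 4)).sqrt hp.ne').add h1).div_const 2
  have h3 := h2.sub_const ((Real.sqrt ((0 - c - δ) ^ 2 + δ ^ 4) + (0 - c - δ)) / 2)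
  have h4 : HasDerivAt (Fap c δ) _ t := h3
  rw [h4.deriv]
  have := Real.sqrt_pos.2 hp
  simp only [Pi.pow_apply]
  field_simp
  simp
  ring

lemma posPart_mem (hz : MemH10 Ω z D)
    (hc : 0 ≤ c) :
    MemH10 Ω (fun x => max (z x - c) 0) (fun x => if c < z x then D x else 0) := by
  classical
  set δ : ℕ → ℝ := fun j => 1 / ((j : ℝ) + 1) with hδ
  have hδp : ∀ j, 0 < δ j := fun j => by simp only [hδ]; positivity
  have hδl : Tendsto δ atTop (𝓝 0) := tendsto_one_div_add_atTop_nhds_zero_nat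
  have key := chain_lim (M := 1) (F := fun j => Fap c (δ j)) (F' := fun t => max (t - c) 0)
    (G := fun t => if c < t then 1 else 0) hz (fun j => Fap_contDiff c (hδp j)) (fun j => by simp [Fap])
    (fun j t => by
      rw [Fap_deriv c (hδp j)]
      have hp : 0 < (t - c - δ j) ^ 2 + δ j ^ 4 := by have := hδp j; positivity
      have h1 : |(t - c - δ j) / Real.sqrt ((t - c - δ j) ^ 2 + δ j ^ 4)| ≤ 1 := by
        rw [abs_div, abs_of_pos (Real.sqrt_pos.2 hp), div_le_one (Real.sqrt_pos.2 hp)]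
        apply Real.abs_le_sqrt
        have := pow_pos (hδp j) 4
        linarith
      rw [abs_le] at *
      constructor <;> linarith [h1.1, h1.2])
    (fun t => by
      have hcont : Continuous fun d => Fap c d t := by unfold Fap; fun_prop
      have := (hcont.tendsto 0).comp hδl
      refine this.trans_eq ?_
      congr 1
      simp only [Fap, sub_zero, ne_eq, OfNat.ofNat_ne_zero, not_false_eq_true, zero_pow, add_zero, Real.sqrt_sq_eq_abs]
      rw [show (0 : ℝ) - c = -c by ring, abs_neg, abs_of_nonneg hc]
      rcases le_total (t - c) 0 with h | h
      · rw [max_eq_right h, abs_of_nonpos h]; ring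
      · rw [max_eq_left h, abs_of_nonneg h]; ring)
    (fun t => by
      simp only [fun j => Fap_deriv c (hδp j) t]
      rcases eq_or_ne t c with rfl | hne
      · simp only [lt_irrefl, if_false, sub_self, zero_sub]
        have : ∀ j, (-δ j / Real.sqrt ((-δ j) ^ 2 + δ j ^ 4) + 1) / 2 = (- (1 / Real.sqrt (1 + δ j ^ 2)) + 1) / 2 := by
          intro j
          have hj := hδp j
          rw [show (-δ j) ^ 2 + δ j ^ 4 = (δ j) ^ 2 * (1 + δ j ^ 2) by ring, Real.sqrt_mul (sq_nonneg _), Real.sqrt_sq hj.le]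
          have := Real.sqrt_pos.2 (show 0 < 1 + δ j ^ 2 by positivity)
          field_simp
        simp only [this]
        have hcont : Continuous fun d : ℝ => (- (1 / Real.sqrt (1 + d ^ 2)) + 1) / 2 := by
          have h0 : ∀ d : ℝ, Real.sqrt (1 + d ^ 2) ≠ 0 := fun d => (Real.sqrt_pos.2 (by positivity)).ne'
          fun_prop (disch := exact h0 _)
        have := (hcont.tendsto 0).comp hδl
        refine this.trans_eq ?_
        congr 1; norm_num
      · have hne' : t - c ≠ 0 := sub_ne_zero.2 hne
        have hcont : ContinuousAt (fun d : ℝ => ((t - c - d) / Real.sqrt ((t - c - d) ^ 2 + d ^ 4) + 1) / 2) 0 := by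
          have h0 : Real.sqrt ((t - c - 0) ^ 2 + 0 ^ 4) ≠ 0 := by
            simp [Real.sqrt_sq_eq_abs, hne']
          have c1 : ContinuousAt (fun d : ℝ => t - c - d) 0 := by fun_prop
          have c2 : ContinuousAt (fun d : ℝ => Real.sqrt ((t - c - d) ^ 2 + d ^ 4)) 0 := by fun_prop
          exact ((c1.div c2 h0).add continuousAt_const).div_const 2
        have := hcont.tendsto.comp hδl
        refine this.trans_eq ?_
        congr 1
        simp only [sub_zero, ne_eq, OfNat.ofNat_ne_zero, not_false_eq_true, zero_pow, add_zero, Real.sqrt_sq_eq_abs]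
        rcases lt_or_gt_of_ne hne with h | h
        · rw [if_neg (not_lt.2 h.le), abs_of_neg (by linarith), div_neg, div_self hne']; norm_num
        · rw [if_pos h, abs_of_pos (by linarith), div_self hne']; norm_num)
  convert key using 2 with x
  split_ifs <;> simp


lemma pos_mem (hz : MemH10 Ω z D) :
    MemH10 Ω (fun x => max (z x) 0) (fun x => if 0 < z x then D x else 0) := by
  simpa using posPart_mem hz le_rfl

lemma neg_mem (hz : MemH10 Ω z D) :
    MemH10 Ω (fun x => max (- z x) 0) (fun x => if z x < 0 then - D x else 0) := by
  simpa using pos_mem (hz.smul (-1))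

/-- gradient of a truncation is dominated -/
lemma trunc_le (P : Euc n → Prop) [DecidablePred P] (hD : MemLp D 2 volume) :
    ∫ x, ‖if P x then D x else 0‖ ^ 2 ≤ ∫ x, ‖D x‖ ^ 2 := by
  refine integral_mono_of_nonneg (eof fun x => sq_nonneg _) (lsi hD) (eof fun x => ?_)
  dsimp only
  split_ifs
  · exact le_rfl
  · simp

lemma pos_neg_energy (hz : MemH10 Ω z D) :
    (∫ x, ‖if 0 < z x then D x else 0‖ ^ 2) + (∫ x, ‖if z x < 0 then - D x else 0‖ ^ 2) ≤ ∫ x, ‖D x‖ ^ 2 := by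
  rw [← integral_add (lsi (pos_mem hz).2.1) (lsi (neg_mem hz).2.1)]
  refine integral_mono ((lsi (pos_mem hz).2.1).add (lsi (neg_mem hz).2.1)) (lsi hz.2.1) fun x => ?_
  dsimp only
  rcases lt_trichotomy (z x) 0 with h | h | h
  · simp [h, h.le]
  · simp [h]
  · simp [h, h.le]

lemma abs_mem (hz : MemH10 Ω z D) :
    ∃ D', MemH10 Ω (fun x => |z x|) D' ∧ ∫ x, ‖D' x‖ ^ 2 ≤ ∫ x, ‖D x‖ ^ 2 := by
  have h := (pos_mem hz).add (neg_mem hz)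
  refine ⟨_, h.congr (eof fun x => ?_) (EventuallyEq.refl _ _), ?_⟩
  · dsimp only
    rcases le_total (z x) 0 with h | h
    · simp [h, abs_of_nonpos h]
    · simp [h, abs_of_nonneg h]
  · refine integral_mono (lsi h.2.1) (lsi hz.2.1) fun x => ?_
    dsimp only
    rcases lt_trichotomy (z x) 0 with h | h | h
    · simp [h, not_lt.2 h.le]
    · simp [h]
    · simp [h, not_lt.2 h.le]

lemma min_mem (ha : MemH10 Ω a A) (hb : MemH10 Ω b B) :
    MemH10 Ω (fun x => min (a x) (b x)) (fun x => if b x < a x then B x else A x) := by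
  have h := ha.sub (pos_mem (ha.sub hb))
  refine h.congr (eof fun x => ?_) (eof fun x => ?_)
  · dsimp only
    rcases le_total (a x) (b x) with h | h
    · simp [h]
    · simp [h]
  · dsimp only
    simp only [sub_pos]
    split_ifs <;> simp


lemma weak_lsc {D : ℕ → Euc n → Euc n} (hD : ∀ k, MemLp (D k) 2 volume) (hD' : MemLp D' 2 volume)
    (h : Tendsto (fun k => ∫ x, inner ℝ (D k x) (D' x)) atTop (𝓝 (∫ x, inner ℝ (D' x) (D' x)))) (hε : 0 < ε) :
    ∀ᶠ k in atTop, ∫ x, ‖D' x‖ ^ 2 ≤ (∫ x, ‖D k x‖ ^ 2) + ε := by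
  have h2 := h.eventually (lt_mem_nhds (show (∫ x, inner ℝ (D' x) (D' x)) - ε / 2 < _ by linarith))
  filter_upwards [h2] with k hk
  have := l2_expand (hD k) hD' (-1)
  have h0 : 0 ≤ ∫ x, ‖D k x + (-1 : ℝ) • D' x‖ ^ 2 := integral_nonneg fun x => sq_nonneg _
  simp only [real_inner_self_eq_norm_sq] at hk
  linarith

lemma weak_cl {u : ℕ → Euc n → ℝ} {D : ℕ → Euc n → Euc n}
    (h : ∀ k, MemH10 Ω (u k) (D k)) (h2 : ∀ k, ∫ x, ‖D k x‖ ^ 2 ≤ M) (hz : MemLp z 2 volume)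
    (hl : Tendsto (fun k => ∫ x, (u k x - z x) ^ 2) atTop (𝓝 0)) :
    ∃ D', MemH10 Ω z D' ∧ ∃ σ : ℕ → ℕ, StrictMono σ ∧ (∀ G : Euc n → Euc n, MemLp G 2 volume →
        Tendsto (fun k => ∫ x, inner ℝ (D (σ k) x) (G x)) atTop (𝓝 (∫ x, inner ℝ (D' x) (G x)))) := by
  have hb := (l2_rsq_tendsto (fun k => (h k).1) hz hl).bddAbove_range
  obtain ⟨M', hM'⟩ := hb
  obtain ⟨u', D', σ, hσ, hm, w1, w2⟩ := weak_H10 (M := max M M') h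
    (fun k => (hM' (mem_range_self k)).trans (le_max_right _ _)) (fun k => (h2 k).trans (le_max_left _ _))
  refine ⟨D', hm.congr ?_ (EventuallyEq.refl _ _), σ, hσ, w2⟩
  have hs : MemLp (fun x => u' x - z x) 2 volume := hm.1.sub hz
  have e : (∫ x, u' x * (u' x - z x)) = ∫ x, z x * (u' x - z x) := tendsto_nhds_unique (w1 _ hs)
    ((l2_mul_tendsto (fun k => (h k).1) hz hs hl).comp hσ.tendsto_atTop)
  have : ∫ x, (u' x - z x) ^ 2 = 0 := by
    rw [← sub_eq_zero, ← integral_sub (lmi hm.1 hs) (lmi hz hs)] at e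
    rw [← e]
    congr 1; ext x; ring
  filter_upwards [l2_rae_zero hs this] with x hx
  exact sub_eq_zero.1 hx

lemma weak_cl' {u : ℕ → Euc n → ℝ} {D : ℕ → Euc n → Euc n}
    (h : ∀ k, MemH10 Ω (u k) (D k)) (h2 : ∀ k, ∫ x, ‖D k x‖ ^ 2 ≤ M) (hz : MemH10 univ z Z)
    (hl : Tendsto (fun k => ∫ x, (u k x - z x) ^ 2) atTop (𝓝 0)) : MemH10 Ω z Z := by
  obtain ⟨D', hD', -⟩ := weak_cl h h2 hz.1 hl
  exact hD'.congr (EventuallyEq.refl _ _) (grad_unique (hD'.mono (subset_univ _)) hz)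



open scoped Manifold ContDiff in
lemma exists_cutoff (hK : IsCompact K) (hΩ : IsOpen Ω) (h : K ⊆ Ω) :
    ∃ χ : Euc n → ℝ, IsTestFun Ω χ ∧ (∀ x ∈ K, χ x = 1) ∧ ∀ x, χ x ∈ Icc (0:ℝ) 1 := by
  obtain ⟨L, hL, h1, h2⟩ := exists_compact_between hK hΩ h
  obtain ⟨f, f0, f1, f2⟩ := exists_contMDiffMap_zero_one_of_isClosed (n := (⊤ : ℕ∞)) 𝓘(ℝ, Euc n) (s := (interior L)ᶜ) (t := K)
    isOpen_interior.isClosed_compl hK.isClosed (disjoint_compl_left_iff_subset.2 h1)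
  have hs : Function.support f ⊆ L := by
    intro x hx
    by_contra hx'
    exact hx (f0 (fun h => hx' (interior_subset h)))
  have hts : tsupport f ⊆ L := closure_minimal hs hL.isClosed
  refine ⟨f, ⟨?_, hL.of_isClosed_subset (isClosed_tsupport _) hts, hts.trans h2⟩, fun x hx => f1 hx, f2⟩
  exact (f.contMDiff).contDiff

lemma bdd_cont {E : Type*} [NormedAddCommGroup E] {f : Euc n → E} (hf : Continuous f) (hc : HasCompactSupport f) :
    ∃ C : ℝ, 0 ≤ C ∧ ∀ x, ‖f x‖ ≤ C := by
  obtain ⟨C, hC⟩ := hf.bounded_above_of_compact_support hc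
  exact ⟨C, (norm_nonneg _).trans (hC 0), hC⟩

lemma IsTestFun.mul_left {χ : Euc n → ℝ} (hχ : IsTestFun Ω χ) (hφ : IsTestFun univ φ) :
    IsTestFun Ω (fun x => χ x * φ x) :=
  ⟨hχ.1.mul hφ.1, hχ.2.1.mul_right, (tsupport_mul_subset_left).trans hχ.2.2⟩


lemma cpt_mem (hK : IsCompact K) (hΩ : IsOpen Ω) (h : K ⊆ Ω)
    (hz : MemH10 univ z Z) (h0 : ∀ᵐ x ∂volume, x ∉ K → z x = 0) : MemH10 Ω z Z := by
  obtain ⟨χ, hχ, hχ1, hχ2⟩ := exists_cutoff hK hΩ h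
  obtain ⟨z1, z2, φ, hφ, l1, l2⟩ := id hz
  have ht := fun k => hχ.mul_left (hφ k)
  have hχn : ∀ x, ‖χ x‖ ≤ 1 := fun x => by rw [Real.norm_eq_abs, abs_of_nonneg (hχ2 x).1]; exact (hχ2 x).2
  obtain ⟨C, hC0, hC⟩ := bdd_cont hχ.continuous_gradient hχ.hasCompactSupport_gradient
  obtain ⟨M1, hM1⟩ := (l2_rsq_tendsto (fun k => (hφ k).memLp 2) z1 l1).bddAbove_range
  obtain ⟨M2, hM2⟩ := (l2_sq_tendsto (fun k => (hφ k).memLp_gradient 2) z2 l2).bddAbove_range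
  refine weak_cl' (M := 2 * (C ^ 2 * M1) + 2 * M2) (fun k => (ht k).memH10) (fun k => ?_) hz ?_
  · rw [gradient_mul' hχ.differentiable (hφ k).differentiable]
    have m1 : MemLp (fun x => φ k x • gradient χ x) 2 volume :=
      ((hφ k).1.continuous.smul hχ.continuous_gradient).memLp_of_hasCompactSupport (hφ k).2.1.smul_right
    have m2 : MemLp (fun x => χ x • gradient (φ k) x) 2 volume :=
      (hχ.1.continuous.smul (hφ k).continuous_gradient).memLp_of_hasCompactSupport hχ.2.1.smul_right
    refine (l2_triangle m1 m2).trans (add_le_add ?_ ?_)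
    · refine mlL ?_ (by norm_num)
      refine le_trans ?_ (mlL (hM1 (mem_range_self k)) (sq_nonneg C))
      rw [← integral_const_mul]
      refine integral_mono (lsi m1) ((lri ((hφ k).memLp 2)).const_mul _) fun x => ?_
      simp only [norm_smul, mul_pow, Real.norm_eq_abs, sq_abs]
      rw [mul_comm]
      exact mlR (pow_le_pow_left₀ (norm_nonneg _) (hC x) 2) (sq_nonneg _)
    · refine mlL ?_ (by norm_num)
      refine le_trans ?_ (hM2 (mem_range_self k))
      refine integral_mono (lsi m2) (lsi ((hφ k).memLp_gradient 2)) fun x => ?_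
      refine pow_le_pow_left₀ (norm_nonneg _) ?_ 2
      rw [norm_smul]
      exact mul_le_of_le_one_left (norm_nonneg _) (hχn x)
  · refine squeeze_zero (fun k => integral_nonneg fun x => sq_nonneg _) (fun k => ?_) l1
    refine integral_mono_of_nonneg (eof fun x => sq_nonneg _) (lri (((hφ k).memLp 2).sub z1)) ?_
    filter_upwards [h0] with x hx
    have e : χ x * φ k x - z x = χ x * (φ k x - z x) := by
      by_cases hxK : x ∈ K
      · rw [hχ1 x hxK]; ring
      · rw [hx hxK]; ring
    rw [e, mul_pow]
    have := hχ2 x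

    exact mul_le_of_le_one_left (sq_nonneg _) (pow_le_one₀ this.1 this.2)

lemma dom_mem (hΩ : IsOpen Ω)
    (ha : MemH10 Ω a A) (hb : MemH10 univ b B) (hb0 : ∀ᵐ x ∂volume, 0 ≤ b x) :
    MemH10 Ω (fun x => max (a x - b x) 0) (fun x => if b x < a x then A x - B x else 0) := by
  obtain ⟨z1, z2, φ, hφ, l1, l2⟩ := id ha
  have hu : MemH10 univ (fun x => max (a x - b x) 0) (fun x => if b x < a x then A x - B x else 0) := by
    simpa using pos_mem ((ha.mono (subset_univ _)).sub hb)
  have hk : ∀ k, MemH10 univ (fun x => max (φ k x - b x) 0) (fun x => if b x < φ k x then gradient (φ k) x - B x else 0) := by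
    intro k
    simpa using pos_mem (((hφ k).memH10.mono (subset_univ _)).sub hb)
  obtain ⟨M2, hM2⟩ := (l2_sq_tendsto (fun k => (hφ k).memLp_gradient 2) z2 l2).bddAbove_range
  refine weak_cl' (M := 2 * M2 + 2 * ∫ x, ‖B x‖ ^ 2) (fun k => cpt_mem (hφ k).2.1 hΩ (hφ k).2.2 (hk k) ?_) (fun k => ?_) hu ?_
  · filter_upwards [hb0] with x hx hx'
    rw [image_eq_zero_of_notMem_tsupport hx']
    exact max_eq_right (by linarith)
  · have m := ((hφ k).memLp_gradient 2).sub hb.2.1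
    refine (trunc_le _ m).trans ?_
    have := l2_triangle ((hφ k).memLp_gradient 2) hb.2.1.neg
    simp only [Pi.neg_apply, norm_neg, ← sub_eq_add_neg] at this
    refine this.trans (add_le_add (mlL (hM2 (mem_range_self k)) (by norm_num)) le_rfl)
  · refine squeeze_zero (fun k => integral_nonneg fun x => sq_nonneg _) (fun k => ?_) l1
    refine integral_mono_of_nonneg (eof fun x => sq_nonneg _) (lri (((hφ k).memLp 2).sub z1)) ?_
    refine eof fun x => sq_le_sq.2 ?_
    have := abs_max_sub_max_le_abs (φ k x - b x) (a x - b x) 0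
    simpa using this

lemma dom2_mem (hΩ : IsOpen Ω)
    (ha : MemH10 univ a A) (hb : MemH10 Ω b B) (h0 : ∀ᵐ x ∂volume, 0 ≤ a x) (h1 : ∀ᵐ x ∂volume, a x ≤ b x) :
    MemH10 Ω a A := by
  have := dom_mem hΩ hb ((hb.mono (subset_univ _)).sub ha) (by filter_upwards [h1] with x hx; linarith)
  have h2 := this.congr (u' := a) (by
    filter_upwards [h0] with x hx
    simp [hx]) (EventuallyEq.refl _ _)
  exact h2.congr (EventuallyEq.refl _ _) (grad_unique (h2.mono (subset_univ _)) ha)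



lemma memLp_shift {E : Type*} [NormedAddCommGroup E] {f : Euc n → E} {p : ℝ≥0∞} (hf : MemLp f p volume) (h : Euc n) :
    MemLp (fun x => f (x + h)) p volume :=
  hf.comp_measurePreserving (measurePreserving_add_right volume h)

lemma transl_test (hφ : IsTestFun univ φ) (h : Euc n) :
    ∫ x, (φ (x + h) - φ x) ^ 2 ≤ ‖h‖ ^ 2 * ∫ x, ‖gradient φ x‖ ^ 2 := by
  have hd := hφ.differentiable
  set g : Euc n → ℝ → ℝ := fun x t => inner ℝ (gradient φ (x + t • h)) h with hg
  have hgc : Continuous (fun p : Euc n × ℝ => g p.1 p.2) :=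
    (hφ.continuous_gradient.comp (by fun_prop)).inner continuous_const
  have hgx : ∀ x, Continuous (g x) := fun x => by
    have hl : Continuous fun t : ℝ => x + t • h := by fun_prop
    exact (hφ.continuous_gradient.comp hl).inner continuous_const
  have hder : ∀ x t, HasDerivAt (fun t : ℝ => φ (x + t • h)) (g x t) t := by
    intro x t
    have h1 : HasDerivAt (fun t : ℝ => x + t • h) h t := by
      simpa using ((hasDerivAt_id t).smul_const h).const_add x
    have := (hd (x + t • h)).hasFDerivAt.comp_hasDerivAt t h1
    have e : g x t = (fderiv ℝ φ (x + t • h)) h := by simp only [hg]; rw [inner_gradient_left]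
    rw [e]
    exact this
  have hpt : ∀ x, (φ (x + h) - φ x) ^ 2 ≤ ∫ t in (0:ℝ)..1, (g x t) ^ 2 := by
    intro x
    have e : ∫ t in (0:ℝ)..1, g x t = φ (x + h) - φ x := by
      rw [intervalIntegral.integral_eq_sub_of_hasDerivAt (fun t _ => hder x t) ((hgx x).intervalIntegrable _ _)]
      simp
    set m := φ (x + h) - φ x
    have h0 : 0 ≤ ∫ t in (0:ℝ)..1, (g x t - m) ^ 2 :=
      intervalIntegral.integral_nonneg (by norm_num) fun t _ => sq_nonneg _
    have e2 : ∫ t in (0:ℝ)..1, (g x t - m) ^ 2 = (∫ t in (0:ℝ)..1, (g x t) ^ 2) - 2 * m * (∫ t in (0:ℝ)..1, g x t) + m ^ 2 := by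
      have i1 : IntervalIntegrable (fun t => (g x t) ^ 2) volume 0 1 := ((hgx x).pow 2).intervalIntegrable _ _
      have i2 : IntervalIntegrable (fun t => 2 * m * g x t) volume 0 1 := (continuous_const.mul (hgx x)).intervalIntegrable _ _
      have i3 : IntervalIntegrable (fun t : ℝ => m ^ 2) volume 0 1 := continuous_const.intervalIntegrable _ _
      have e3 : ∀ t, (g x t - m) ^ 2 = (g x t) ^ 2 - 2 * m * g x t + m ^ 2 := fun t => by ring
      simp only [e3]
      rw [intervalIntegral.integral_add (i1.sub i2) i3, intervalIntegral.integral_sub i1 i2, intervalIntegral.integral_const_mul]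
      simp
    rw [e2, e] at h0
    nlinarith
  have hGsq : Integrable (fun x => ‖gradient φ x‖ ^ 2) volume := lsi (hφ.memLp_gradient 2)
  have hint : Integrable (Function.uncurry fun x t => (g x t) ^ 2) (volume.prod (volume.restrict (Ioc (0:ℝ) 1))) := by
    have hcont : Continuous (Function.uncurry fun x t => (g x t) ^ 2) := hgc.pow 2
    obtain ⟨r, hr⟩ := hφ.hasCompactSupport_gradient.isCompact.isBounded.subset_closedBall 0
    have hK : IsCompact ((closedBall (0 : Euc n) (r + ‖h‖)) ×ˢ (Icc (0:ℝ) 1)) := (isCompact_closedBall _ _).prod isCompact_Icc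
    have i1 : IntegrableOn (Function.uncurry fun x t => (g x t) ^ 2) ((closedBall (0 : Euc n) (r + ‖h‖)) ×ˢ (Icc (0:ℝ) 1)) (volume.prod volume) :=
      hcont.continuousOn.integrableOn_compact hK
    have i2 : IntegrableOn (Function.uncurry fun x t => (g x t) ^ 2) (univ ×ˢ (Ioc (0:ℝ) 1)) (volume.prod volume) := by
      refine i1.of_forall_diff_eq_zero (MeasurableSet.univ.prod measurableSet_Ioc) ?_
      rintro ⟨x, t⟩ ⟨⟨-, ht⟩, hx⟩
      have hx' : x ∉ closedBall (0 : Euc n) (r + ‖h‖) := fun hh => hx ⟨hh, ht.1.le, ht.2⟩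
      have : gradient φ (x + t • h) = 0 := by
        apply image_eq_zero_of_notMem_tsupport
        intro hm
        apply hx'
        have h1 := hr hm
        simp only [mem_closedBall, dist_zero_right] at h1 ⊢
        have h2 : ‖x‖ ≤ ‖x + t • h‖ + ‖t • h‖ := by simpa using norm_sub_le (x + t • h) (t • h)
        have h3 : ‖t • h‖ ≤ ‖h‖ := by
          rw [norm_smul, Real.norm_eq_abs, abs_of_pos ht.1]
          exact mul_le_of_le_one_left (norm_nonneg _) ht.2
        linarith
      simp only [Function.uncurry, hg, this, inner_zero_left]
      norm_num
    rw [IntegrableOn, ← Measure.prod_restrict, Measure.restrict_univ] at i2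
    exact i2
  have hsw := integral_integral_swap hint
  have hL : Integrable (fun x => (φ (x + h) - φ x) ^ 2) volume :=
    lri ((memLp_shift (hφ.memLp 2) h).sub (hφ.memLp 2))
  have h1 : ∫ x, (φ (x + h) - φ x) ^ 2 ≤ ∫ x, ∫ t in Ioc (0:ℝ) 1, (g x t) ^ 2 := by
    refine integral_mono hL hint.integral_prod_left fun x => ?_
    have := hpt x
    rwa [intervalIntegral.integral_of_le (by norm_num)] at this
  refine h1.trans ?_
  rw [hsw]
  have h2 : ∀ t, ∫ x, (g x t) ^ 2 ≤ ‖h‖ ^ 2 * ∫ x, ‖gradient φ x‖ ^ 2 := by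
    intro t
    have e : ∫ x, ‖gradient φ x‖ ^ 2 = ∫ x, ‖gradient φ (x + t • h)‖ ^ 2 :=
      (integral_add_right_eq_self (fun x => ‖gradient φ x‖ ^ 2) (t • h)).symm
    rw [e, ← integral_const_mul]
    refine integral_mono_of_nonneg (eof fun x => sq_nonneg _)
      ((hGsq.comp_add_right (t • h)).const_mul _) (eof fun x => ?_)
    have := abs_real_inner_le_norm (gradient φ (x + t • h)) h
    have h3 := pow_le_pow_left₀ (abs_nonneg _) this 2
    rw [sq_abs, mul_pow] at h3
    simpa [hg, mul_comm] using h3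
  have h3 : ∫ t in Ioc (0:ℝ) 1, ∫ x, (g x t) ^ 2 ≤ ∫ t in Ioc (0:ℝ) 1, ‖h‖ ^ 2 * ∫ x, ‖gradient φ x‖ ^ 2 := by
    refine integral_mono_of_nonneg (eof fun t => integral_nonneg fun x => sq_nonneg _) (integrable_const _) (eof h2)
  refine h3.trans_eq ?_
  simp

lemma transl (hz : MemH10 univ z D) (h : Euc n) :
    ∫ x, (z (x + h) - z x) ^ 2 ≤ ‖h‖ ^ 2 * ∫ x, ‖D x‖ ^ 2 := by
  obtain ⟨z1, z2, φ, hφ, l1, l2⟩ := hz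
  have t2 := (l2_sq_tendsto (fun k => (hφ k).memLp_gradient 2) z2 l2).const_mul (‖h‖ ^ 2)
  have t1 : Tendsto (fun k => ∫ x, (φ k (x + h) - φ k x) ^ 2) atTop (𝓝 (∫ x, (z (x + h) - z x) ^ 2)) := by
    refine l2_rsq_tendsto (f := fun k x => φ k (x + h) - φ k x) (f' := fun x => z (x + h) - z x) (fun k => (memLp_shift ((hφ k).memLp 2) h).sub ((hφ k).memLp 2)) ((memLp_shift z1 h).sub z1) ?_
    have := l1.const_mul 4
    rw [mul_zero] at this
    refine squeeze_zero (fun k => integral_nonneg fun x => sq_nonneg _) (fun k => ?_) this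
    have m := ((hφ k).memLp 2).sub z1
    have := l2_triangle (memLp_shift m h) m.neg
    have e : ∫ x, ‖(φ k - z) (x + h)‖ ^ 2 = ∫ x, ‖(φ k - z) x‖ ^ 2 := integral_add_right_eq_self (fun x => ‖(φ k - z) x‖ ^ 2) h
    rw [e] at this
    simp only [Pi.neg_apply, norm_neg, Real.norm_eq_abs, sq_abs, Pi.sub_apply] at this
    have e2 : ∀ x, φ k (x + h) - φ k x - (z (x + h) - z x) = φ k (x + h) - z (x + h) + -(φ k x - z x) := fun x => by ring
    simp only [e2]
    linarith
  exact le_of_tendsto_of_tendsto' t1 t2 fun k => transl_test (hφ k) h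

lemma shift_inner (hz : MemLp z 2 volume) (h : Euc n) :
    ∫ x, (z (x + h) - z x) ^ 2 = 2 * (∫ x, z x ^ 2) - 2 * ∫ x, z x * z (x + h) := by
  have := l2_expand' (memLp_shift hz h) hz (-1)
  have e : ∫ x, z (x + h) ^ 2 = ∫ x, z x ^ 2 := integral_add_right_eq_self (fun x => z x ^ 2) h
  rw [e] at this
  have e2 : ∀ x, z (x + h) + -1 * z x = z (x + h) - z x := fun x => by ring
  simp only [e2] at this
  rw [this]
  have e3 : ∀ x, z (x + h) * z x = z x * z (x + h) := fun x => by ring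
  simp only [e3]
  ring

/-- Poincaré inequality. -/
lemma poincare (hn : 0 < n) (hR : 0 < R) (hz : MemH10 (ball 0 R) z D) :
    ∫ x, z x ^ 2 ≤ 2 * R ^ 2 * ∫ x, ‖D x‖ ^ 2 := by
  set h : Euc n := (2 * R) • EuclideanSpace.single (⟨0, hn⟩ : Fin n) (1:ℝ)
  have hh : ‖h‖ = 2 * R := by simp [h, norm_smul, abs_of_pos hR]
  have t := transl (hz.mono (subset_univ _)) h
  rw [shift_inner hz.1, hh] at t
  have e : ∫ x, z x * z (x + h) = 0 := by
    rw [integral_eq_zero_of_ae]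
    have a := hz.ae_zero
    have b := (measurePreserving_add_right volume h).quasiMeasurePreserving.ae a
    filter_upwards [a, b] with x ha hb
    simp only [mem_ball, dist_zero_right, not_lt] at ha hb
    rcases le_or_gt R ‖x‖ with hx | hx
    · simp [ha hx]
    · have : R ≤ ‖x + h‖ := by
        have := norm_sub_le (x + h) x
        simp only [add_sub_cancel_left, hh] at this
        linarith
      simp [hb this]
  rw [e] at t
  nlinarith

lemma exists_kernel (hr : 0 < r) : ∃ (κ : Euc n → ℝ) (C : ℝ), 0 < C ∧ Continuous κ ∧ HasCompactSupport κ ∧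
    (∀ x, 0 ≤ κ x) ∧ (∀ x, κ x ≤ C) ∧ ∫ x, κ x = 1 ∧ ∀ x, r ≤ ‖x‖ → κ x = 0 := by
  let b : ContDiffBump (0 : Euc n) := ⟨r / 2, r, by linarith, by linarith⟩
  have hc : Continuous (b.normed volume) := b.continuous_normed
  have hcs : HasCompactSupport (b.normed volume) := b.hasCompactSupport_normed
  obtain ⟨C, hC0, hC⟩ := bdd_cont hc hcs
  refine ⟨b.normed volume, C + 1, by linarith, hc, hcs, fun x => b.nonneg_normed x, fun x => ?_, b.integral_normed, fun x hx => ?_⟩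
  · have := (le_abs_self _).trans (hC x); linarith
  · have : x ∉ Function.support (b.normed volume) := by
      rw [b.support_normed_eq]; simpa [b] using hx
    simpa using this

lemma integrable_of_supp (hS : volume S ≠ ∞) (hz : MemLp z 2 volume)
    (h0 : ∀ᵐ x ∂volume, x ∉ S → z x = 0) : Integrable z volume := by
  have h1 : IntegrableOn z S volume := by
    have : IsFiniteMeasure (volume.restrict S) := ⟨by simpa using hS.lt_top⟩
    exact memLp_one_iff_integrable.1 ((hz.restrict S).mono_exponent (by norm_num))
  exact h1.integrable_of_ae_notMem_eq_zero h0

lemma l1_bound (hSm : MeasurableSet S) (hS : volume S ≠ ∞) (hz : MemLp z 2 volume)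
    (h0 : ∀ᵐ x ∂volume, x ∉ S → z x = 0) : (∫ x, |z x|) ^ 2 ≤ (volume S).toReal * ∫ x, z x ^ 2 := by
  have hi : MemLp (S.indicator (fun _ => (1:ℝ))) 2 volume := memLp_indicator_const 2 hSm 1 (Or.inr hS)
  have := l2_cs' hi hz.norm
  have e1 : ∫ x, S.indicator (fun _ => (1:ℝ)) x ^ 2 = (volume S).toReal := by
    have : ∀ x, S.indicator (fun _ => (1:ℝ)) x ^ 2 = S.indicator (fun _ => (1:ℝ)) x := by
      intro x; by_cases h : x ∈ S <;> simp [h]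
    simp only [this]
    rw [integral_indicator_const _ hSm]; simp [Measure.real]
  have e2 : ∫ x, S.indicator (fun _ => (1:ℝ)) x * ‖z x‖ = ∫ x, |z x| := by
    apply integral_congr_ae
    filter_upwards [h0] with x hx
    by_cases h : x ∈ S
    · simp [h]
    · simp [h, hx h]
  rw [e1, e2] at this
  simpa using this

lemma prod_int {κ : Euc n → ℝ} (hzi : Integrable z volume) (hκ : Continuous κ)
    (h0 : ∀ x, 0 ≤ κ x) (hC : ∀ x, κ x ≤ C) :
    Integrable (fun p : Euc n × Euc n => z p.1 * z p.2 * κ (p.2 - p.1)) (volume.prod volume) := by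
  have h1 := hzi.mul_prod hzi
  refine h1.mul_bdd (c := C) ((hκ.comp (by fun_prop)).aestronglyMeasurable) (eof fun p => ?_)
  rw [Real.norm_eq_abs, abs_of_nonneg (h0 _)]; exact hC _

/-- Key inequality. -/
lemma key_ineq (hz : MemH10 univ z D) (hzi : Integrable z volume)
    {κ : Euc n → ℝ} (hκ : Continuous κ) (hκc : HasCompactSupport κ)
    (h0 : ∀ x, 0 ≤ κ x) (hC : ∀ x, κ x ≤ C) (h1 : ∫ x, κ x = 1) (hr : 0 ≤ r) (hsupp : ∀ x, r ≤ ‖x‖ → κ x = 0) :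
    ∫ x, z x ^ 2 ≤ (r ^ 2 / 2) * (∫ x, ‖D x‖ ^ 2) + ∫ x, ∫ y, z x * z y * κ (y - x) := by
  have hp := prod_int hzi hκ h0 hC
  have hp2 : Integrable (fun p : Euc n × Euc n => z p.1 * z (p.1 + p.2) * κ p.2) (volume.prod volume) := by
    have := (measurePreserving_prod_add (volume : Measure (Euc n)) (volume : Measure (Euc n))).integrable_comp_of_integrable hp
    simpa [Function.comp_def] using this
  have e1 : ∫ x, ∫ y, z x * z y * κ (y - x) = ∫ x, ∫ h, z x * z (x + h) * κ h := by
    congr 1; ext x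
    have := integral_add_left_eq_self (μ := (volume : Measure (Euc n))) (fun y => z x * z y * κ (y - x)) x
    rw [← this]; simp
  rw [e1, integral_integral_swap hp2]
  have e2 : ∀ h, ∫ x, z x * z (x + h) * κ h = κ h * ∫ x, z x * z (x + h) := by
    intro h; rw [integral_mul_const, mul_comm]
  have hκi : Integrable κ volume := hκ.integrable_of_hasCompactSupport hκc
  have e3 : (∫ x, z x ^ 2) - (r ^ 2 / 2) * (∫ x, ‖D x‖ ^ 2) = ∫ h, κ h * ((∫ x, z x ^ 2) - (r ^ 2 / 2) * (∫ x, ‖D x‖ ^ 2)) := by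
    rw [integral_mul_const, h1, one_mul]
  suffices (∫ x, z x ^ 2) - (r ^ 2 / 2) * (∫ x, ‖D x‖ ^ 2) ≤ ∫ h, ∫ x, z x * z (x + h) * κ h by linarith
  rw [e3]
  refine integral_mono (hκi.mul_const _) hp2.integral_prod_right fun h => ?_
  simp only [e2]
  rcases le_or_gt r ‖h‖ with hh | hh
  · simp [hsupp h hh]
  · refine mlL ?_ (h0 h)
    have t := transl hz h
    rw [shift_inner hz.1] at t
    have : ‖h‖ ^ 2 * ∫ x, ‖D x‖ ^ 2 ≤ r ^ 2 * ∫ x, ‖D x‖ ^ 2 :=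
      mlR (pow_le_pow_left₀ (norm_nonneg _) hh.le 2) (integral_nonneg fun x => sq_nonneg _)
    linarith

/-- Crude Faber–Krahn inequality. -/
lemma faber_krahn (n : ℕ) (Λ : ℝ) (hΛ : 0 < Λ) : ∃ c₀ : ℝ, 0 < c₀ ∧ ∀ (z : Euc n → ℝ) (D : Euc n → Euc n) (S : Set (Euc n)),
    MemH10 univ z D → MeasurableSet S → volume S ≠ ∞ → (∀ᵐ x ∂volume, x ∉ S → z x = 0) →
    ∫ x, ‖D x‖ ^ 2 ≤ Λ * ∫ x, z x ^ 2 → 0 < ∫ x, z x ^ 2 → c₀ ≤ (volume S).toReal := by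
  obtain ⟨κ, C, hC0, hκ, hκc, h0, hC, h1, hs⟩ := exists_kernel (n := n) (r := Real.sqrt (1 / Λ)) (by positivity)
  refine ⟨1 / (2 * C), by positivity, fun z D S hz hSm hS hzS hΛz hpos => ?_⟩
  have hzi := integrable_of_supp hS hz.1 hzS
  have k := key_ineq hz hzi hκ hκc h0 hC h1 (Real.sqrt_nonneg _) hs
  rw [Real.sq_sqrt (by positivity)] at k
  have hp := prod_int hzi hκ h0 hC
  have e : ∫ x, ∫ y, z x * z y * κ (y - x) ≤ C * (∫ x, |z x|) ^ 2 := by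
    rw [← integral_prod _ hp]
    have : ∫ p : Euc n × Euc n, C * (|z p.1| * |z p.2|) ∂(volume.prod volume) = C * (∫ x, |z x|) ^ 2 := by
      rw [integral_const_mul, integral_prod_mul (fun x => |z x|) (fun x => |z x|), sq]
    rw [← this]
    refine integral_mono hp ((hzi.abs.mul_prod hzi.abs).const_mul C) fun p => ?_
    dsimp only
    have : z p.1 * z p.2 ≤ |z p.1| * |z p.2| := by rw [← abs_mul]; exact le_abs_self _
    calc z p.1 * z p.2 * κ (p.2 - p.1) ≤ |z p.1| * |z p.2| * κ (p.2 - p.1) := mlR this (h0 _)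
      _ ≤ |z p.1| * |z p.2| * C := mlL (hC _) (by positivity)
      _ = _ := by ring
  have l := l1_bound hSm hS hz.1 hzS
  have h5 : 1 / Λ / 2 * ∫ x, ‖D x‖ ^ 2 ≤ 1 / 2 * ∫ x, z x ^ 2 := by
    calc 1 / Λ / 2 * ∫ x, ‖D x‖ ^ 2 ≤ 1 / Λ / 2 * (Λ * ∫ x, z x ^ 2) := mlL hΛz (by positivity)
      _ = _ := by field_simp
  have h6 : C * (∫ x, |z x|) ^ 2 ≤ C * ((volume S).toReal * ∫ x, z x ^ 2) := mlL l hC0.le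
  have h7 : (1 / 2) * ∫ x, z x ^ 2 ≤ (C * (volume S).toReal) * ∫ x, z x ^ 2 := by linarith
  have h8 := le_of_mul_le_mul_right h7 hpos
  rw [div_le_iff₀ (by positivity)]
  linarith

/-- Rellich: weak convergence to zero in `H¹₀(B_R)` implies strong `L²` convergence. -/
lemma rellich {z : ℕ → Euc n → ℝ} {D : ℕ → Euc n → Euc n}
    (hz : ∀ k, MemH10 (ball 0 R) (z k) (D k)) (hb : ∀ k, ∫ x, (z k x) ^ 2 ≤ M) (hD : ∀ k, ∫ x, ‖D k x‖ ^ 2 ≤ M)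
    (hw : ∀ g : Euc n → ℝ, MemLp g 2 volume → Tendsto (fun k => ∫ x, z k x * g x) atTop (𝓝 0)) :
    Tendsto (fun k => ∫ x, (z k x) ^ 2) atTop (𝓝 0) := by
  have hM0 : 0 ≤ M := (integral_nonneg fun x => sq_nonneg _).trans (hb 0)
  have hfin : volume (ball (0 : Euc n) R) ≠ ∞ := measure_ball_lt_top.ne
  rw [Metric.tendsto_atTop']
  intro ε hε
  have hr : 0 < Real.sqrt (ε / (M + 1)) := by positivity
  obtain ⟨κ, C, hC0, hκ, hκc, h0, hC, h1, hs⟩ := exists_kernel (n := n) hr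
  have hzi := fun k => integrable_of_supp hfin (hz k).1 (hz k).ae_zero
  set a : ℕ → Euc n → ℝ := fun k x => ∫ y, z k y * κ (y - x) with ha
  have hκL : ∀ x, MemLp (fun y => κ (y - x)) 2 volume := fun x => by
    have := memLp_shift (hκ.memLp_of_hasCompactSupport hκc (p := 2) (μ := volume)) (-x)
    simpa [sub_eq_add_neg] using this
  have ha0 : ∀ x, Tendsto (fun k => a k x) atTop (𝓝 0) := fun x => hw _ (hκL x)
  set K := ∫ y, κ y ^ 2
  have hab : ∀ k x, |a k x| ≤ Real.sqrt (M * K) := by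
    intro k x
    apply Real.abs_le_sqrt
    refine (l2_cs' (hz k).1 (hκL x)).trans ?_
    have : ∫ y, κ (y - x) ^ 2 = K := integral_sub_right_eq_self (fun y => κ y ^ 2) x
    rw [this]
    exact mlR (hb k) (integral_nonneg fun x => sq_nonneg _)
  have ham : ∀ k, AEStronglyMeasurable (a k) volume := by
    intro k
    have : AEStronglyMeasurable (fun p : Euc n × Euc n => z k p.2 * κ (p.2 - p.1)) (volume.prod volume) :=
      ((hz k).1.1.comp_snd).mul ((hκ.comp (by fun_prop)).aestronglyMeasurable)
    exact this.integral_prod_right'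
  set B := ball (0 : Euc n) R
  set f : ℕ → Euc n → ℝ := fun k x => B.indicator (a k) x with hf
  have hd := l2_dct (f := f) (f' := fun _ => (0:ℝ)) (b := B.indicator fun _ => Real.sqrt (M * K))
    (fun k => (ham k).indicator measurableSet_ball) (memLp_indicator_const 2 measurableSet_ball _ (Or.inr hfin))
    (fun k => eof fun x => by
      by_cases h : x ∈ B
      · simpa [hf, h] using hab k x
      · simp [hf, h])
    (eof fun x => by
      by_cases h : x ∈ B
      · simpa [hf, h] using ha0 x
      · simp [hf, h])
  have hfL : ∀ k, MemLp (f k) 2 volume := fun k =>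
    (memLp_indicator_const 2 measurableSet_ball (Real.sqrt (M * K)) (Or.inr hfin)).mono ((ham k).indicator measurableSet_ball)
      (eof fun x => by
      by_cases h : x ∈ B
      · rw [indicator_of_mem (show x ∈ ball (0 : Euc n) R from h), Real.norm_eq_abs, Real.norm_eq_abs, abs_of_nonneg (Real.sqrt_nonneg (M * K))]
        simpa [hf, h] using hab k x
      · simp [hf, h])
  have hd2 := hd.2
  simp only [sub_zero, Real.norm_eq_abs, sq_abs] at hd2
  have hq : ∀ k, ∫ x, ∫ y, z k x * z k y * κ (y - x) ≤ Real.sqrt (M * ∫ x, f k x ^ 2) := by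
    intro k
    have : ∫ x, ∫ y, z k x * z k y * κ (y - x) = ∫ x, z k x * f k x := by
      apply integral_congr_ae
      filter_upwards [(hz k).ae_zero] with x hx
      by_cases h : x ∈ B
      · simp only [hf, h, indicator_of_mem, ha, mul_assoc]
        rw [integral_const_mul]
      · simp [hx h]
    rw [this]
    refine (le_abs_self _).trans (Real.abs_le_sqrt ((l2_cs' (hz k).1 (hfL k)).trans ?_))
    exact mlR (hb k) (integral_nonneg fun x => sq_nonneg _)
  have hl : Tendsto (fun k => Real.sqrt (M * ∫ x, f k x ^ 2)) atTop (𝓝 0) := by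
    simpa using (hd2.const_mul M).sqrt
  obtain ⟨N, hN⟩ := eventually_atTop.1 (hl.eventually (gt_mem_nhds (half_pos hε)))
  refine ⟨N, fun k hk => ?_⟩
  have kk := key_ineq ((hz k).mono (subset_univ _)) (hzi k) hκ hκc h0 hC h1 hr.le hs
  rw [Real.sq_sqrt (by positivity)] at kk
  have h3 : ε / (M + 1) / 2 * ∫ x, ‖D k x‖ ^ 2 ≤ ε / (M + 1) / 2 * M := mlL (hD k) (by positivity)
  have h4 : ε / (M + 1) / 2 * M ≤ ε / 2 := by
    rw [div_div, div_mul_eq_mul_div, div_le_iff₀ (by positivity)]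
    nlinarith
  have := hN k hk.le
  have := hq k
  rw [Real.dist_eq, sub_zero, abs_of_nonneg (integral_nonneg fun x => sq_nonneg _)]
  linarith

/-- Weak sequential compactness with strong `L²` convergence. -/
lemma wsc (hn : 0 < n) (hR : 0 < R) {u : ℕ → Euc n → ℝ} {D : ℕ → Euc n → Euc n} (hΩ : Ω ⊆ ball 0 R)
    (hu : ∀ k, MemH10 Ω (u k) (D k)) (hD : ∀ k, ∫ x, ‖D k x‖ ^ 2 ≤ M) :
    ∃ u' D', ∃ σ : ℕ → ℕ, StrictMono σ ∧ MemH10 Ω u' D' ∧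
      Tendsto (fun k => ∫ x, (u (σ k) x - u' x) ^ 2) atTop (𝓝 0) ∧
      (∀ G : Euc n → Euc n, MemLp G 2 volume →
        Tendsto (fun k => ∫ x, inner ℝ (D (σ k) x) (G x)) atTop (𝓝 (∫ x, inner ℝ (D' x) (G x)))) := by
  have hM0 : 0 ≤ M := (integral_nonneg fun x => sq_nonneg _).trans (hD 0)
  have hb : ∀ k, ∫ x, (u k x) ^ 2 ≤ 2 * R ^ 2 * M := fun k => (poincare hn hR ((hu k).mono hΩ)).trans
    (mlL (hD k) (by positivity))
  obtain ⟨u', D', σ, hσ, hm, w1, w2⟩ := weak_H10 (M := max M (2 * R ^ 2 * M)) hu (fun k => (hb k).trans (le_max_right _ _))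
    (fun k => (hD k).trans (le_max_left _ _))
  refine ⟨u', D', σ, hσ, hm, ?_, w2⟩
  have hs := fun k => ((hu (σ k)).sub hm).mono hΩ
  set M' := 2 * M + 2 * ∫ x, ‖D' x‖ ^ 2
  have hDs : ∀ k, ∫ x, ‖D (σ k) x - D' x‖ ^ 2 ≤ M' := by
    intro k
    have := l2_triangle (hu (σ k)).2.1 hm.2.1.neg
    simp only [Pi.neg_apply, norm_neg, ← sub_eq_add_neg] at this
    have := hD (σ k)
    linarith
  have hM'0 : 0 ≤ M' := (integral_nonneg fun x => sq_nonneg _).trans (hDs 0)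
  refine rellich (M := max M' (2 * R ^ 2 * M')) hs (fun k => ?_) (fun k => (hDs k).trans (le_max_left _ _)) (fun g hg => ?_)
  · exact ((poincare hn hR (hs k)).trans (mlL (hDs k) (by positivity))).trans (le_max_right _ _)
  · have := (w1 g hg).sub_const (∫ x, u' x * g x)
    rw [sub_self] at this
    refine this.congr fun k => ?_
    rw [← integral_sub (lmi (hu _).1 hg) (lmi hm.1 hg)]
    congr 1; ext x; ring



lemma solve_abs0 {E F G : Type*} [NormedAddCommGroup E] [InnerProductSpace ℝ E] [CompleteSpace E]
    [NormedAddCommGroup F] [InnerProductSpace ℝ F] [NormedAddCommGroup G] [InnerProductSpace ℝ G]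
    (T1 : E →L[ℝ] F) (T2 : E →L[ℝ] G) (c κ : ℝ) (hκ : 0 < κ)
    (hco : ∀ p, κ * ‖p‖ ^ 2 ≤ ‖T2 p‖ ^ 2 - c * ‖T1 p‖ ^ 2) (f : F) :
    ∃ p, ∀ q, inner ℝ (T2 p) (T2 q) - c * inner ℝ (T1 p) (T1 q) = inner ℝ f (T1 q) := by
  let B : E →L[ℝ] E →L[ℝ] ℝ := (innerSL ℝ).bilinearComp T2 T2 - c • (innerSL ℝ).bilinearComp T1 T1
  have hB : ∀ p q : E, B p q = inner ℝ (T2 p) (T2 q) - c * inner ℝ (T1 p) (T1 q) := by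
    intro p q; rfl
  have hcB : IsCoercive B := by
    refine ⟨κ, hκ, fun p => ?_⟩
    rw [hB, real_inner_self_eq_norm_sq, real_inner_self_eq_norm_sq, mul_assoc, ← sq]
    exact hco p
  let g : E := (InnerProductSpace.toDual ℝ E).symm ((innerSL ℝ f).comp T1)
  have hg : ∀ q : E, inner ℝ g q = inner ℝ f (T1 q) := by
    intro q; simp only [g]; rw [InnerProductSpace.toDual_symm_apply]; rfl
  refine ⟨hcB.continuousLinearEquivOfBilin.symm g, fun q => ?_⟩
  have h1 := hcB.continuousLinearEquivOfBilin_apply (hcB.continuousLinearEquivOfBilin.symm g) q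
  rw [ContinuousLinearEquiv.apply_symm_apply, hg, hB] at h1
  exact h1.symm

lemma solve_abs (V : Submodule ℝ (XH n)) (hV : IsClosed (V : Set (XH n))) (c κ : ℝ) (hκ : 0 < κ)
    (hco : ∀ p ∈ V, κ * ‖p‖ ^ 2 ≤ ‖p.snd‖ ^ 2 - c * ‖p.fst‖ ^ 2) (f : Lp ℝ 2 (volume : Measure (Euc n))) :
    ∃ p ∈ V, ∀ q ∈ V, inner ℝ p.snd q.snd - c * inner ℝ p.fst q.fst = inner ℝ f q.fst := by
  have : CompleteSpace V := hV.completeSpace_coe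
  obtain ⟨p, hp⟩ := solve_abs0 ((WithLp.fstL 2 ℝ (Lp ℝ 2 (volume : Measure (Euc n))) (Lp (Euc n) 2 (volume : Measure (Euc n)))).comp V.subtypeL) ((WithLp.sndL 2 ℝ _ _).comp V.subtypeL) c κ hκ (fun p => hco p p.2) f
  exact ⟨p, p.2, fun q hq => hp ⟨q, hq⟩⟩


/-- The solution operator on the orthogonal complement of `u`. -/
lemma solve2 (hu : MemLp u 2 volume) (hf : MemLp f 2 volume) (hl : 0 ≤ l) (hκ : 0 < κ)
    (gap : ∀ q Q, MemH10 Ω q Q → ∫ x, q x * u x = 0 → (l + κ) * ∫ x, q x ^ 2 ≤ ∫ x, ‖Q x‖ ^ 2) :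
    ∃ ψ Ψ, MemH10 Ω ψ Ψ ∧ ∫ x, ψ x * u x = 0 ∧ ∀ χ X, MemH10 Ω χ X → ∫ x, χ x * u x = 0 →
      (∫ x, inner ℝ (Ψ x) (X x)) - l * ∫ x, ψ x * χ x = ∫ x, f x * χ x := by
  let U : XH n →L[ℝ] ℝ := (innerSL ℝ (hu.toLp u)).comp (WithLp.fstL 2 ℝ _ _)
  let V : Submodule ℝ (XH n) := HS Ω ⊓ LinearMap.ker U.toLinearMap
  have hV : IsClosed (V : Set (XH n)) := (isClosed_HS Ω).inter U.isClosed_ker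
  have hUmk : ∀ (p : XH n), U p = ∫ x, p.fst x * u x := by
    intro p
    change inner ℝ (hu.toLp u) p.fst = _
    conv_lhs => rw [← Lp.toLp_coeFn p.fst (Lp.memLp _)]
    rw [inner_toLp]
    congr 1
  have hc : ∀ p ∈ V, min (κ / (l + κ) / 2) (κ / 2) * ‖p‖ ^ 2 ≤ ‖p.snd‖ ^ 2 - l * ‖p.fst‖ ^ 2 := by
    rintro p ⟨hp1, hp2⟩
    have h1 := gap _ _ (memH10_of_mem hp1) (by rw [← hUmk]; exact hp2)
    have e1 : ∫ x, p.fst x ^ 2 = ‖p.fst‖ ^ 2 := by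
      have := norm_toLp_sq (Lp.memLp p.fst)
      rw [Lp.toLp_coeFn] at this
      rw [this]; simp
    have e2 : ∫ x, ‖p.snd x‖ ^ 2 = ‖p.snd‖ ^ 2 := by
      have := norm_toLp_sq (Lp.memLp p.snd)
      rw [Lp.toLp_coeFn] at this
      rw [this]
    rw [e1, e2] at h1
    rw [WithLp.prod_norm_sq_eq_of_L2]
    set a := ‖p.fst‖ ^ 2
    set b := ‖p.snd‖ ^ 2
    have ha : 0 ≤ a := sq_nonneg _
    have hb : 0 ≤ b := sq_nonneg _
    have hlk : 0 < l + κ := by linarith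
    have h2 : κ / (l + κ) * b ≤ b - l * a := by
      have : a ≤ b / (l + κ) := by rw [le_div_iff₀ hlk]; linarith
      have h3 : l * a ≤ l * (b / (l + κ)) := mlL this hl
      have h4 : κ / (l + κ) * b = b - l * (b / (l + κ)) := by field_simp; ring
      linarith
    have h3 : κ * a ≤ b - l * a := by linarith
    have h4 : min (κ / (l + κ) / 2) (κ / 2) * a ≤ κ / 2 * a := mlR (min_le_right _ _) ha
    have h5 : min (κ / (l + κ) / 2) (κ / 2) * b ≤ κ / (l + κ) / 2 * b := mlR (min_le_left _ _) hb
    linarith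
  obtain ⟨p, ⟨hp1, hp2⟩, hp⟩ := solve_abs V hV l _ (by positivity) hc (hf.toLp f)
  refine ⟨p.fst, p.snd, memH10_of_mem hp1, by rw [← hUmk]; exact hp2, fun χ X hχ h0 => ?_⟩
  obtain ⟨x1, x2, x3⟩ := memH10_iff.1 hχ
  have := hp (mkX χ X x1 x2) ⟨x3, by
    change U _ = 0
    rw [hUmk, ← h0]
    apply integral_congr_ae
    filter_upwards [x1.coeFn_toLp] with x hx
    change (x1.toLp χ) x * u x = _
    rw [hx]⟩
  change inner ℝ p.snd (x2.toLp X) - l * inner ℝ p.fst (x1.toLp χ) = inner ℝ (hf.toLp f) (x1.toLp χ) at this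
  rw [inner_toLp, ← Lp.toLp_coeFn p.snd (Lp.memLp _), ← Lp.toLp_coeFn p.fst (Lp.memLp _), inner_toLp, inner_toLp] at this
  simp only [RCLike.inner_apply, conj_trivial] at this
  simp only [mul_comm (χ _)] at this
  exact this

/-- `w` is the weak solution of `-Δw = f` in `H¹₀(Ω)`. -/
def IsSol (Ω : Set (Euc n)) (f w : Euc n → ℝ) (W : Euc n → Euc n) : Prop :=
  MemH10 Ω w W ∧ ∀ χ X, MemH10 Ω χ X → ∫ x, inner ℝ (W x) (X x) = ∫ x, f x * χ x

lemma sol_exists (hn : 0 < n) (hR : 0 < R) (hΩ : Ω ⊆ ball 0 R) (hf : MemLp f 2 volume) :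
    ∃ w W, IsSol Ω f w W := by
  obtain ⟨ψ, Ψ, h1, -, h2⟩ := solve2 (Ω := Ω) (u := fun _ => 0) (f := f) (l := 0) (κ := 1 / (2 * R ^ 2)) MemLp.zero hf le_rfl (by positivity)
    (fun q Q hq _ => by
      have := poincare hn hR (hq.mono hΩ)
      rw [zero_add, div_mul_eq_mul_div, div_le_iff₀ (by positivity)]
      linarith)
  exact ⟨ψ, Ψ, h1, fun χ X hχ => by simpa using h2 χ X hχ (by simp)⟩

lemma zero_of_grad_zero (hn : 0 < n) (hR : 0 < R) (hz : MemH10 (ball 0 R) z D)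
    (h : ∫ x, ‖D x‖ ^ 2 ≤ 0) : z =ᵐ[volume] 0 := by
  refine l2_rae_zero hz.1 (le_antisymm ?_ (integral_nonneg fun x => sq_nonneg _))
  have := poincare hn hR hz
  nlinarith [sq_nonneg R]

lemma sol_nonneg (hn : 0 < n) (hR : 0 < R) (hΩ : Ω ⊆ ball 0 R)
    (hw : IsSol Ω f w W) (hf : ∀ᵐ x ∂volume, 0 ≤ f x) : ∀ᵐ x ∂volume, 0 ≤ w x := by
  have hm := neg_mem hw.1
  have h1 := hw.2 _ _ hm
  have h2 : 0 ≤ ∫ x, f x * max (- w x) 0 := integral_nonneg_of_ae (by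
    filter_upwards [hf] with x hx
    exact mul_nonneg hx (le_max_right _ _))
  have h3 : ∫ x, ‖if w x < 0 then - W x else 0‖ ^ 2 ≤ 0 := by
    rw [← h1] at h2
    have : ∫ x, ‖if w x < 0 then - W x else 0‖ ^ 2 = - ∫ x, inner ℝ (W x) (if w x < 0 then - W x else 0) := by
      rw [← integral_neg]
      congr 1; ext x
      split_ifs <;> simp
    linarith
  filter_upwards [zero_of_grad_zero hn hR (hm.mono hΩ) h3] with x hx
  have : max (- w x) 0 = 0 := hx
  linarith [le_max_left (- w x) 0]

/-- Comparison principle. -/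
lemma sol_le (hn : 0 < n) (hR : 0 < R) (hΩo : IsOpen Ω) (hΩ : Ω ⊆ ball 0 R) (hs : Ω ⊆ Ω')
    (hfL : MemLp f 2 volume) (hfL' : MemLp f' 2 volume)
    (hw : IsSol Ω f w W) (hw' : IsSol Ω' f' w' W') (hf : ∀ᵐ x ∂volume, f x ≤ f' x) (h0 : ∀ᵐ x ∂volume, 0 ≤ w' x) :
    ∀ᵐ x ∂volume, w x ≤ w' x := by
  have hm := dom_mem hΩo hw.1 (hw'.1.mono (subset_univ _)) h0
  have h1 := hw.2 _ _ hm
  have h2 := hw'.2 _ _ (hm.mono hs)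
  have h3 : ∫ x, ‖if w' x < w x then W x - W' x else 0‖ ^ 2 ≤ 0 := by
    have e : ∫ x, ‖if w' x < w x then W x - W' x else 0‖ ^ 2 =
        (∫ x, inner ℝ (W x) (if w' x < w x then W x - W' x else 0)) - ∫ x, inner ℝ (W' x) (if w' x < w x then W x - W' x else 0) := by
      rw [← integral_sub (lii hw.1.2.1 hm.2.1) (lii hw'.1.2.1 hm.2.1)]
      congr 1; ext x
      rw [← inner_sub_left]
      split_ifs <;> simp [real_inner_self_eq_norm_sq]
    rw [e, h1, h2, sub_nonpos]
    refine integral_mono_ae (lmi hfL hm.1) (lmi hfL' hm.1) ?_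
    filter_upwards [hf] with x hx
    exact mlR hx (le_max_right _ _)
  filter_upwards [zero_of_grad_zero hn hR (hm.mono hΩ) h3] with x hx
  have : max (w x - w' x) 0 = 0 := hx
  linarith [le_max_left (w x - w' x) 0]

lemma IsSol.neg (h : IsSol Ω f w W) :
    IsSol Ω (fun x => - f x) (fun x => - w x) (fun x => - W x) := by
  refine ⟨by simpa using h.1.smul (-1), fun χ X hχ => ?_⟩
  have := h.2 χ X hχ
  simp only [inner_neg_left, neg_mul, integral_neg, this]

lemma sol_abs_le (hn : 0 < n) (hR : 0 < R) (hΩo : IsOpen Ω) (hΩ : Ω ⊆ ball 0 R)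
    (hfL : MemLp f 2 volume) (hfL' : MemLp f' 2 volume)
    (hw : IsSol Ω f w W) (hw' : IsSol Ω f' w' W') (hf : ∀ᵐ x ∂volume, |f x| ≤ f' x) :
    ∀ᵐ x ∂volume, |w x| ≤ w' x := by
  have h0 := sol_nonneg hn hR hΩ hw' (by filter_upwards [hf] with x hx; exact (abs_nonneg _).trans hx)
  have h1 := sol_le hn hR hΩo hΩ Subset.rfl hfL hfL' hw hw' (by filter_upwards [hf] with x hx; exact (le_abs_self _).trans hx) h0
  have h2 := sol_le hn hR hΩo hΩ Subset.rfl hfL.neg hfL' hw.neg hw' (by filter_upwards [hf] with x hx; exact (neg_le_abs _).trans hx) h0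
  filter_upwards [h1, h2] with x a b
  exact abs_le.2 ⟨by linarith, a⟩

lemma sol_energy (hf : MemLp f 2 volume) (hw : IsSol Ω f w W)
    (hz : MemH10 Ω z Z) :
    (1 / 2) * (∫ x, ‖Z x‖ ^ 2) - ∫ x, f x * z x =
      (1 / 2) * (∫ x, ‖W x‖ ^ 2) - (∫ x, f x * w x) + (1 / 2) * ∫ x, ‖Z x - W x‖ ^ 2 := by
  have h1 := hw.2 _ _ hz
  have h2 := hw.2 _ _ hw.1
  have h3 := l2_expand hz.2.1 hw.1.2.1 (-1)
  simp only [neg_smul, one_smul, ← sub_eq_add_neg] at h3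
  simp only [real_inner_self_eq_norm_sq] at h2
  rw [h3]
  have : ∫ x, inner ℝ (Z x) (W x) = ∫ x, f x * z x := by
    rw [← h1]; congr 1; ext x; rw [real_inner_comm]
  rw [this]
  linarith


def oneB (n : ℕ) (R : ℝ) : Euc n → ℝ := (ball (0 : Euc n) R).indicator (fun _ => 1)

lemma oneBm (R : ℝ) : MemLp (oneB n R) 2 volume :=
  memLp_indicator_const 2 measurableSet_ball 1 (Or.inr measure_ball_lt_top.ne)

lemma oneB_mul (hΩ : Ω ⊆ ball 0 R) (hz : MemH10 Ω z Z) :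
    ∫ x, oneB n R x * z x = ∫ x, z x := by
  apply integral_congr_ae
  filter_upwards [(hz.mono hΩ).ae_zero] with x hx
  by_cases h : x ∈ ball (0 : Euc n) R
  · simp only [oneB, indicator_of_mem h, one_mul]
  · rw [hx h, mul_zero]

lemma MemH10.integrable (hΩ : Ω ⊆ ball 0 R) (hz : MemH10 Ω z Z) :
    Integrable z volume := integrable_of_supp (S := ball (0 : Euc n) R) measure_ball_lt_top.ne hz.1 (hz.mono hΩ).ae_zero

lemma tor_integral (hΩ : Ω ⊆ ball 0 R) (hz : MemH10 Ω z Z) :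
    ∫ x, ((1 / 2) * ‖Z x‖ ^ 2 - z x) = (1 / 2) * (∫ x, ‖Z x‖ ^ 2) - ∫ x, z x := by
  rw [integral_sub ((lsi hz.2.1).const_mul _) (hz.integrable hΩ), integral_const_mul]

lemma tor_eq (hΩ : Ω ⊆ ball 0 R) (hw : IsSol Ω (oneB n R) w W) :
    tor Ω = (1 / 2) * (∫ x, ‖W x‖ ^ 2) - (∫ x, w x) := by
  apply le_antisymm
  · refine csInf_le ⟨(1 / 2) * (∫ x, ‖W x‖ ^ 2) - (∫ x, w x), ?_⟩ ⟨w, W, hw.1, (tor_integral hΩ hw.1).symm⟩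
    rintro r ⟨z, Z, hz, rfl⟩
    have := sol_energy (oneBm R) hw hz
    rw [oneB_mul hΩ hz, oneB_mul hΩ hw.1] at this
    rw [tor_integral hΩ hz, this]
    have : 0 ≤ ∫ x, ‖Z x - W x‖ ^ 2 := integral_nonneg fun x => sq_nonneg _
    linarith
  · refine le_csInf ⟨_, w, W, hw.1, rfl⟩ ?_
    rintro r ⟨z, Z, hz, rfl⟩
    have := sol_energy (oneBm R) hw hz
    rw [oneB_mul hΩ hz, oneB_mul hΩ hw.1] at this
    rw [tor_integral hΩ hz, this]
    have : 0 ≤ ∫ x, ‖Z x - W x‖ ^ 2 := integral_nonneg fun x => sq_nonneg _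
    linarith

lemma tor_grad (hΩ : Ω ⊆ ball 0 R) (hw : IsSol Ω (oneB n R) w W) :
    ∫ x, ‖W x‖ ^ 2 = ∫ x, w x := by
  have := hw.2 _ _ hw.1
  rw [oneB_mul hΩ hw.1] at this
  simpa only [real_inner_self_eq_norm_sq] using this

lemma tor_eq' (hΩ : Ω ⊆ ball 0 R) (hw : IsSol Ω (oneB n R) w W) :
    tor Ω = - (1 / 2) * (∫ x, w x) := by
  rw [tor_eq hΩ hw, tor_grad hΩ hw]; ring

lemma tor_le (hn : 0 < n) (hR : 0 < R) (hΩ : Ω ⊆ ball 0 R) (hz : MemH10 Ω z Z) :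
    tor Ω ≤ (1 / 2) * (∫ x, ‖Z x‖ ^ 2) - (∫ x, z x) := by
  obtain ⟨w, W, hw⟩ := sol_exists hn hR hΩ (oneBm R)
  rw [tor_eq hΩ hw]
  have := sol_energy (oneBm R) hw hz
  rw [oneB_mul hΩ hz, oneB_mul hΩ hw.1] at this
  rw [this]
  have : 0 ≤ ∫ x, ‖Z x - W x‖ ^ 2 := integral_nonneg fun x => sq_nonneg _
  linarith

lemma tor_mono (hn : 0 < n) (hR : 0 < R) (hs : Ω ⊆ Ω') (hΩ' : Ω' ⊆ ball 0 R) : tor Ω' ≤ tor Ω := by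
  obtain ⟨w, W, hw⟩ := sol_exists hn hR (hs.trans hΩ') (oneBm R)
  rw [tor_eq (hs.trans hΩ') hw]
  exact tor_le hn hR hΩ' (hw.1.mono hs)

lemma tor_nonpos (hn : 0 < n) (hR : 0 < R) (hΩ : Ω ⊆ ball 0 R) : tor Ω ≤ 0 := by
  simpa using tor_le hn hR hΩ (MemH10.zero Ω)

def Ctor (n : ℕ) (R : ℝ) : ℝ := R ^ 2 * (volume (ball (0 : Euc n) R)).toReal

lemma tor_w_bound (hn : 0 < n) (hR : 0 < R) (hΩ : Ω ⊆ ball 0 R) (hw : IsSol Ω (oneB n R) w W) :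
    ∫ x, ‖W x‖ ^ 2 ≤ 2 * Ctor n R := by
  have h1 := tor_grad hΩ hw
  have h2 := l1_bound measurableSet_ball (measure_ball_lt_top (x := (0 : Euc n)) (r := R)).ne hw.1.1 (hw.1.mono hΩ).ae_zero
  have h3 := poincare hn hR (hw.1.mono hΩ)
  have h4 : ∫ x, w x ≤ ∫ x, |w x| := integral_mono (hw.1.integrable hΩ) (hw.1.integrable hΩ).abs fun x => le_abs_self _
  set a := ∫ x, ‖W x‖ ^ 2
  set V := (volume (ball (0 : Euc n) R)).toReal
  have ha : 0 ≤ a := integral_nonneg fun x => sq_nonneg _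
  have hV : 0 ≤ V := ENNReal.toReal_nonneg
  have h5 : a ^ 2 ≤ V * (2 * R ^ 2 * a) := by
    calc a ^ 2 ≤ (∫ x, |w x|) ^ 2 := pow_le_pow_left₀ ha (by linarith) 2
      _ ≤ _ := h2
      _ ≤ _ := mlL h3 hV
  rcases ha.eq_or_lt with h | h
  · rw [← h]; unfold Ctor; positivity
  · have : a * a ≤ (2 * Ctor n R) * a := by unfold Ctor; nlinarith
    exact le_of_mul_le_mul_right this h

lemma tor_lower (hn : 0 < n) (hR : 0 < R) (hΩ : Ω ⊆ ball 0 R) : - Ctor n R ≤ tor Ω := by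
  obtain ⟨w, W, hw⟩ := sol_exists hn hR hΩ (oneBm R)
  have := tor_w_bound hn hR hΩ hw
  rw [tor_eq' hΩ hw, ← tor_grad hΩ hw]
  linarith



lemma ray_exists (hΩ : IsOpen Ω) (hne : Ω.Nonempty) : ∃ z Z, MemH10 Ω z Z ∧ (∫ x, z x ^ 2) ≠ 0 := by
  obtain ⟨x, hx⟩ := hne
  obtain ⟨r, hr, hs⟩ := Metric.nhds_basis_closedBall.mem_iff.1 (hΩ.mem_nhds hx)
  obtain ⟨χ, h1, h2, h3⟩ := exists_cutoff (isCompact_closedBall x r) hΩ hs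
  refine ⟨χ, _, h1.memH10, fun h => ?_⟩
  have h4 := l2_rae_zero (h1.memLp 2) h
  have h5 : volume (ball x r) = 0 := by
    refine measure_mono_null (fun y hy => ?_) (ae_iff.1 h4)
    simp [h2 y (ball_subset_closedBall hy)]
  exact (measure_ball_pos volume x hr).ne' h5

lemma lam1_bdd (Ω : Set (Euc n)) : BddBelow {r | ∃ u Du, MemH10 Ω u Du ∧ (∫ x, u x ^ 2) ≠ 0 ∧
    r = (∫ x, ‖Du x‖ ^ 2) / (∫ x, u x ^ 2)} := by
  refine ⟨0, ?_⟩
  rintro r ⟨u, U, -, -, rfl⟩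
  exact div_nonneg (integral_nonneg fun _ => sq_nonneg _) (integral_nonneg fun _ => sq_nonneg _)

lemma lam1_le (hz : MemH10 Ω z Z) :
    lam1 Ω * ∫ x, z x ^ 2 ≤ ∫ x, ‖Z x‖ ^ 2 := by
  have h0 : 0 ≤ ∫ x, z x ^ 2 := integral_nonneg fun _ => sq_nonneg _
  rcases h0.eq_or_lt with h | h
  · rw [← h, mul_zero]; exact integral_nonneg fun _ => sq_nonneg _
  · rw [← le_div_iff₀ h]
    exact csInf_le (lam1_bdd Ω) ⟨z, Z, hz, h.ne', rfl⟩

lemma le_lam1 (hΩ : IsOpen Ω) (hne : Ω.Nonempty)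
    (h : ∀ z Z, MemH10 Ω z Z → c * ∫ x, z x ^ 2 ≤ ∫ x, ‖Z x‖ ^ 2) : c ≤ lam1 Ω := by
  obtain ⟨z, Z, hz, h0⟩ := ray_exists hΩ hne
  refine le_csInf ⟨_, z, Z, hz, h0, rfl⟩ ?_
  rintro r ⟨z, Z, hz, h0, rfl⟩
  rw [le_div_iff₀ (lt_of_le_of_ne (integral_nonneg fun _ => sq_nonneg _) (Ne.symm h0))]
  exact h z Z hz

lemma lam1_ge (hn : 0 < n) (hR : 0 < R) (hΩ : IsOpen Ω) (hne : Ω.Nonempty) (hb : Ω ⊆ ball 0 R) :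
    1 / (2 * R ^ 2) ≤ lam1 Ω := by
  refine le_lam1 hΩ hne fun z Z hz => ?_
  have := poincare hn hR (hz.mono hb)
  rw [div_mul_eq_mul_div, div_le_iff₀ (by positivity)]
  linarith

lemma lam1_pos (hn : 0 < n) (hR : 0 < R) (hΩ : IsOpen Ω) (hne : Ω.Nonempty) (hb : Ω ⊆ ball 0 R) :
    0 < lam1 Ω := lt_of_lt_of_le (by positivity) (lam1_ge hn hR hΩ hne hb)

lemma lam1_mono (hΩ : IsOpen Ω) (hne : Ω.Nonempty) (hs : Ω ⊆ Ω') : lam1 Ω' ≤ lam1 Ω :=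
  le_lam1 hΩ hne fun _ _ hz => lam1_le (hz.mono hs)

/-- Normalized first eigenfunction with its gradient. -/
def EF (Ω : Set (Euc n)) (u : Euc n → ℝ) (U : Euc n → Euc n) : Prop :=
  (∀ᵐ x ∂volume, 0 ≤ u x) ∧ MemH10 Ω u U ∧ (∫ x, u x ^ 2) = 1 ∧ ∫ x, ‖U x‖ ^ 2 = lam1 Ω

lemma eig_exists (hn : 0 < n) (hR : 0 < R) (hΩ : IsOpen Ω) (hne : Ω.Nonempty) (hb : Ω ⊆ ball 0 R) :
    ∃ u U, EF Ω u U ∧ ∀ x ∉ Ω, u x = 0 := by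
  obtain ⟨z0, Z0, hz0, h00⟩ := ray_exists hΩ hne
  have key : ∀ k : ℕ, ∃ z Z, MemH10 Ω z Z ∧ (∫ x, z x ^ 2) = 1 ∧ ∫ x, ‖Z x‖ ^ 2 ≤ lam1 Ω + 1 / ((k : ℝ) + 1) := by
    intro k
    have : lam1 Ω < lam1 Ω + 1 / ((k : ℝ) + 1) := by linarith [Nat.one_div_pos_of_nat (α := ℝ) (n := k)]
    obtain ⟨r, ⟨z, Z, hz, h0, rfl⟩, hr⟩ := exists_lt_of_csInf_lt (s := {r | ∃ u Du, MemH10 Ω u Du ∧ (∫ x, u x ^ 2) ≠ 0 ∧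
      r = (∫ x, ‖Du x‖ ^ 2) / (∫ x, u x ^ 2)}) ⟨_, z0, Z0, hz0, h00, rfl⟩ this
    have hp : 0 < ∫ x, z x ^ 2 := lt_of_le_of_ne (integral_nonneg fun _ => sq_nonneg _) (Ne.symm h0)
    set a := ∫ x, z x ^ 2
    have hc : (Real.sqrt a)⁻¹ ^ 2 = a⁻¹ := by rw [inv_pow, Real.sq_sqrt hp.le]
    refine ⟨_, _, hz.smul (Real.sqrt a)⁻¹, ?_, ?_⟩
    · simp only [mul_pow, hc]
      rw [integral_const_mul]; exact inv_mul_cancel₀ h0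
    · simp only [norm_smul, mul_pow, Real.norm_eq_abs, sq_abs, hc]
      rw [integral_const_mul, ← div_eq_inv_mul]; exact hr.le
  choose z Z hz h1 h2 using key
  obtain ⟨u, U, σ, hσ, hu, hl, hw⟩ := wsc hn hR hb hz (M := lam1 Ω + 1) (fun k => (h2 k).trans (by
    gcongr
    rw [div_le_one (by positivity)]; linarith [(Nat.cast_nonneg k : (0:ℝ) ≤ k)]))
  have e1 : ∫ x, u x ^ 2 = 1 := by
    have := l2_rsq_tendsto (fun k => (hz (σ k)).1) hu.1 hl
    simp only [h1] at this
    exact tendsto_nhds_unique this tendsto_const_nhds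
  have e2 : ∫ x, ‖U x‖ ^ 2 ≤ lam1 Ω := by
    refine le_of_forall_pos_le_add fun ε hε => ?_
    have a1 := weak_lsc (fun k => (hz (σ k)).2.1) hu.2.1 (hw U hu.2.1) (half_pos hε)
    have a2 : ∀ᶠ k : ℕ in atTop, 1 / ((σ k : ℝ) + 1) < ε / 2 :=
      (tendsto_one_div_add_atTop_nhds_zero_nat.comp hσ.tendsto_atTop).eventually (gt_mem_nhds (half_pos hε))
    obtain ⟨k, k1, k2⟩ := (a1.and a2).exists
    linarith [h2 (σ k)]
  obtain ⟨D, hD, hDl⟩ := abs_mem hu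
  have hind : (fun x => |u x|) =ᵐ[volume] Ω.indicator (fun x => |u x|) := by
    filter_upwards [hu.ae_zero] with x hx
    by_cases h : x ∈ Ω
    · rw [indicator_of_mem h]
    · rw [indicator_of_notMem h, hx h, abs_zero]
  have hD' := hD.congr hind (ae_eq_refl D)
  have e3 : ∫ x, (Ω.indicator (fun x => |u x|) x) ^ 2 = 1 := by
    rw [← e1]
    apply integral_congr_ae
    filter_upwards [hind] with x hx
    rw [← hx, sq_abs]
  refine ⟨_, D, ⟨?_, hD', e3, le_antisymm (hDl.trans e2) ?_⟩, fun x hx => indicator_of_notMem hx _⟩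
  · filter_upwards [] with x
    exact indicator_nonneg (fun _ _ => abs_nonneg _) x
  · have := lam1_le hD'
    rwa [e3, mul_one] at this

lemma quad_zero {a b : ℝ} (h : ∀ t : ℝ, 0 ≤ 2 * t * a + t ^ 2 * b) : a = 0 := by
  by_contra ha
  have h1 := h (- a / (|b| + 1))
  have hb : 0 < |b| + 1 := by positivity
  have h2 : 2 * (-a / (|b| + 1)) * a + (-a / (|b| + 1)) ^ 2 * b = a ^ 2 / (|b| + 1) ^ 2 * (b - 2 * (|b| + 1)) := by
    field_simp; ring
  rw [h2] at h1
  have h3 : 0 < a ^ 2 / (|b| + 1) ^ 2 := by positivity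
  nlinarith [le_abs_self b, abs_nonneg b]

lemma EF.sol (h : EF Ω u U) : IsSol Ω (fun x => lam1 Ω * u x) u U := by
  refine ⟨h.2.1, fun χ X hχ => ?_⟩
  obtain ⟨-, hu, h1, h2⟩ := h
  simp only [mul_assoc]
  rw [integral_const_mul, ← sub_eq_zero]
  refine quad_zero (b := (∫ x, ‖X x‖ ^ 2) - lam1 Ω * ∫ x, χ x ^ 2) fun t => ?_
  have := lam1_le (hu.lin hχ t)
  rw [l2_expand hu.2.1 hχ.2.1, l2_expand' hu.1 hχ.1, h1, h2] at this
  linarith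

/-- Solutions extended by zero are subsolutions. -/
lemma subsol (hΩ : IsOpen Ω) (hF : MemLp F 2 volume)
    (hF0 : ∀ᵐ x ∂volume, 0 ≤ F x) (hy : IsSol Ω F y Y) (hψ : IsTestFun univ ψ) (h0 : ∀ x, 0 ≤ ψ x) :
    ∫ x, inner ℝ (Y x) (gradient ψ x) ≤ ∫ x, F x * ψ x := by
  have main : ∀ ε : ℝ, 0 < ε → ∫ x, inner ℝ (Y x) (gradient ψ x) ≤ (∫ x, F x * ψ x) + ε * ∫ x, ‖gradient ψ x‖ ^ 2 := by
    intro ε hε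
    have hm := dom_mem hΩ hy.1 (hψ.memH10.smul ε) (eof fun x => mul_nonneg hε.le (h0 x))
    have h1 := sol_energy hF hy hm
    have hn0 : ∀ (f : Euc n → Euc n), 0 ≤ ∫ x, ‖f x‖ ^ 2 := fun f => integral_nonneg fun x => sq_nonneg _
    have h2 := hn0 (fun x => (if ε * ψ x < y x then Y x - ε • gradient ψ x else 0) - Y x)
    have h3 := trunc_le (fun x => ε * ψ x < y x) (hy.1.2.1.sub ((hψ.memLp_gradient 2).const_smul ε))
    simp only [Pi.sub_apply, Pi.smul_apply] at h3
    have h4 := l2_expand hy.1.2.1 (hψ.memLp_gradient 2) (-ε)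
    simp only [neg_smul, ← sub_eq_add_neg] at h4
    have h5 : (∫ x, F x * y x) - ε * ∫ x, F x * ψ x ≤ ∫ x, F x * max (y x - ε * ψ x) 0 := by
      rw [← integral_const_mul, ← integral_sub (lmi hF hy.1.1) ((lmi hF (hψ.memLp 2)).const_mul _)]
      refine integral_mono_ae ((lmi hF hy.1.1).sub ((lmi hF (hψ.memLp 2)).const_mul _)) (lmi hF hm.1) ?_
      filter_upwards [hF0] with x hx
      calc F x * y x - ε * (F x * ψ x) = F x * (y x - ε * ψ x) := by ring
        _ ≤ _ := mlL (le_max_left _ _) hx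
    have h6 := hn0 (gradient ψ)
    have h7 : ε * ∫ x, inner ℝ (Y x) (gradient ψ x) ≤ ε * ((∫ x, F x * ψ x) + ε * ∫ x, ‖gradient ψ x‖ ^ 2) := by nlinarith
    exact le_of_mul_le_mul_left h7 hε
  refine le_of_forall_pos_le_add fun ε hε => ?_
  have hc : 0 ≤ ∫ x, ‖gradient ψ x‖ ^ 2 := integral_nonneg fun x => sq_nonneg _
  have := main (ε / ((∫ x, ‖gradient ψ x‖ ^ 2) + 1)) (by positivity)
  refine this.trans ?_
  gcongr
  rw [div_mul_eq_mul_div, div_le_iff₀ (by positivity)]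
  nlinarith



def zet (z : Euc n) : ℝ := expNegInvGlue (1 - ‖z‖ ^ 2)
def phi (z : Euc n) : ℝ := 2 * (((1 - ‖z‖ ^ 2)⁻¹) ^ 2 * expNegInvGlue (1 - ‖z‖ ^ 2))

lemma eng_deriv (t : ℝ) : HasDerivAt expNegInvGlue ((t⁻¹) ^ 2 * expNegInvGlue t) t := by
  simpa using expNegInvGlue.hasDerivAt_polynomial_eval_inv_mul 1 t

lemma zet_nonneg (z : Euc n) : 0 ≤ zet z := expNegInvGlue.nonneg _

lemma zet_le_phi (z : Euc n) : zet z ≤ phi z := by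
  unfold zet phi
  rcases le_or_gt (1 - ‖z‖ ^ 2) 0 with h | h
  · simp [expNegInvGlue.zero_of_nonpos h]
  · have h1 : 1 ≤ (1 - ‖z‖ ^ 2)⁻¹ := (one_le_inv₀ h).2 (by linarith [sq_nonneg ‖z‖])
    have h2 := expNegInvGlue.nonneg (1 - ‖z‖ ^ 2)
    have h3 : 1 ≤ ((1 - ‖z‖ ^ 2)⁻¹) ^ 2 := one_le_pow₀ h1
    nlinarith

lemma phi_nonneg (z : Euc n) : 0 ≤ phi z := (zet_nonneg z).trans (zet_le_phi z)

lemma phi_zero {z : Euc n} (h : 1 ≤ ‖z‖) : phi z = 0 := by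
  have : 1 - ‖z‖ ^ 2 ≤ 0 := by nlinarith
  simp [phi, expNegInvGlue.zero_of_nonpos this]

lemma zet_zero {z : Euc n} (h : 1 ≤ ‖z‖) : zet z = 0 := le_antisymm ((zet_le_phi z).trans (phi_zero h).le) (zet_nonneg z)

lemma phi_cont : Continuous (phi : Euc n → ℝ) := by
  have h : (phi : Euc n → ℝ) = fun z => 2 * deriv expNegInvGlue (1 - ‖z‖ ^ 2) := by
    ext z; rw [(eng_deriv _).deriv]; rfl
  rw [h]
  have : Continuous (deriv expNegInvGlue) := (expNegInvGlue.contDiff (n := 1)).continuous_deriv le_rfl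
  fun_prop

lemma phi_supp : HasCompactSupport (phi : Euc n → ℝ) :=
  HasCompactSupport.intro (isCompact_closedBall (0 : Euc n) 1) fun z hz => phi_zero (by
    simp only [mem_closedBall, dist_zero_right, not_le] at hz; exact hz.le)

lemma phi_bdd : ∃ C : ℝ, 0 ≤ C ∧ ∀ z : Euc n, phi z ≤ C := by
  obtain ⟨C, h0, h⟩ := bdd_cont (n := n) phi_cont phi_supp
  exact ⟨C, h0, fun z => (le_abs_self _).trans (h z)⟩

lemma phi_int : Integrable (phi : Euc n → ℝ) volume := phi_cont.integrable_of_hasCompactSupport phi_supp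

lemma phi_memLp : MemLp (phi : Euc n → ℝ) 2 volume := phi_cont.memLp_of_hasCompactSupport phi_supp

def cphi (n : ℕ) : ℝ := ∫ z : Euc n, phi z

lemma cphi_pos : 0 < cphi n := by
  refine (phi_cont.integral_pos_of_hasCompactSupport_nonneg_nonzero phi_supp phi_nonneg (x := 0) ?_)
  have := expNegInvGlue.pos_of_pos (x := 1) one_pos
  simp [phi, this.ne']

def phv (z : Euc n) : Euc n := phi z • z

lemma phv_cont : Continuous (phv : Euc n → Euc n) := phi_cont.smul continuous_id
lemma phv_supp : HasCompactSupport (phv : Euc n → Euc n) := phi_supp.smul_right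
lemma phv_memLp : MemLp (phv : Euc n → Euc n) 2 volume := phv_cont.memLp_of_hasCompactSupport phv_supp

def zets (x : Euc n) (r : ℝ) (q : Euc n) : ℝ := zet (r⁻¹ • (q - x))

lemma zets_grad (x : Euc n) (r : ℝ) (q : Euc n) : HasGradientAt (zets x r) (- r⁻¹ • phv (r⁻¹ • (q - x))) q := by
  rw [hasGradientAt_iff_hasFDerivAt]
  have h1 : HasFDerivAt (fun q : Euc n => r⁻¹ • (q - x)) (r⁻¹ • ContinuousLinearMap.id ℝ (Euc n)) q :=
    HasFDerivAt.const_smul (f := fun q : Euc n => q - x) ((hasFDerivAt_id q).sub_const x) r⁻¹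
  have h2 := (h1.norm_sq.const_sub 1)
  have h3 := (eng_deriv (1 - ‖r⁻¹ • (q - x)‖ ^ 2)).comp_hasFDerivAt q h2
  refine h3.congr_fderiv ?_
  ext e
  simp only [phv, phi, ContinuousLinearMap.smul_apply, ContinuousLinearMap.neg_apply, ContinuousLinearMap.comp_apply, ContinuousLinearMap.id_apply, innerSL_apply_apply,
    InnerProductSpace.toDual_apply_apply, inner_smul_left, inner_smul_right, inner_neg_left, smul_eq_mul, conj_trivial, nsmul_eq_mul]
  push_cast
  ring

lemma zets_test (x : Euc n) {r' : ℝ} (hr : 0 < r) (hrr : r < r') : IsTestFun (ball x r') (zets x r) := by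
  have hs : tsupport (zets x r) ⊆ closedBall x r := by
    refine closure_minimal (fun q hq => ?_) isClosed_closedBall
    by_contra h
    simp only [mem_closedBall, dist_eq_norm, not_le] at h
    refine hq (zet_zero ?_)
    rw [norm_smul, norm_inv, Real.norm_eq_abs, abs_of_pos hr, ← div_eq_inv_mul, one_le_div hr]
    exact h.le
  refine ⟨?_, ?_, hs.trans (closedBall_subset_ball hrr)⟩
  · unfold zets zet
    refine (expNegInvGlue.contDiff (n := ⊤)).comp (contDiff_const.sub (ContDiff.norm_sq ℝ ?_))
    fun_prop
  · exact (isCompact_closedBall x r).of_isClosed_subset (isClosed_tsupport _) hs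

lemma cv (x : Euc n) (hr : 0 < r) (g : Euc n → ℝ) : ∫ p, g (x + r • p) = (r ^ n)⁻¹ * ∫ q, g q := by
  have := Measure.integral_comp_smul (volume : Measure (Euc n)) (fun p => g (x + p)) r
  rw [this, integral_add_left_eq_self, finrank_euclideanSpace_fin, abs_of_pos (by positivity), smul_eq_mul]

lemma cv' (x : Euc n) (hr : 0 < r) (g : Euc n → Euc n → ℝ) :
    ∫ p, g (x + r • p) p = (r ^ n)⁻¹ * ∫ q, g q (r⁻¹ • (q - x)) := by
  rw [← cv x hr]
  congr 1; ext p
  rw [add_sub_cancel_left, inv_smul_smul₀ hr.ne']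

def mv (y : Euc n → ℝ) (x : Euc n) (r : ℝ) : ℝ := ∫ p, y (x + r • p) * phi p
def mvD (Y : Euc n → Euc n) (x : Euc n) (r : ℝ) : ℝ := ∫ p, inner ℝ (Y (x + r • p)) (phv p)

lemma mvD_eq (Y : Euc n → Euc n) (x : Euc n) (hr : 0 < r) :
    mvD Y x r = - (r * (r ^ n)⁻¹) * ∫ q, inner ℝ (Y q) (gradient (zets x r) q) := by
  unfold mvD
  rw [cv' x hr (fun a b => inner ℝ (Y a) (phv b))]
  simp only [(zets_grad x r _).gradient, inner_smul_right]
  rw [integral_const_mul]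
  field_simp

lemma memLp_scale {E : Type*} [NormedAddCommGroup E] {f : Euc n → E} (hf : MemLp f 2 volume) (x : Euc n) (hr : 0 < r) :
    MemLp (fun p => f (x + r • p)) 2 volume := by
  have h1 := memLp_shift hf x
  have hq := Measure.quasiMeasurePreserving_smul (volume : Measure (Euc n)) hr.ne'
  have h2 : AEStronglyMeasurable (fun p : Euc n => f (r • p + x)) volume := h1.1.comp_quasiMeasurePreserving hq
  simp only [add_comm x]
  rw [memLp_two_iff_integrable_sq_norm h2]
  exact (integrable_comp_smul_iff volume (fun q => ‖f (q + x)‖ ^ 2) hr.ne').2 ((memLp_two_iff_integrable_sq_norm h1.1).1 h1)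

lemma mv_diff_test (hf : IsTestFun univ f) (x : Euc n) (r : ℝ) : HasDerivAt (mv f x) (mvD (gradient f) x r) r := by
  obtain ⟨C, hC0, hC⟩ := bdd_cont hf.continuous_gradient hf.hasCompactSupport_gradient
  have c1 := hf.differentiable.continuous
  have c2 := hf.continuous_gradient
  have c3 := phi_cont (n := n)
  have c4 := phv_cont (n := n)
  refine (hasDerivAt_integral_of_dominated_loc_of_deriv_le (s := univ) (bound := fun p => C * ‖phv p‖) univ_mem
    (F := fun r p => f (x + r • p) * phi p) (F' := fun r p => inner ℝ (gradient f (x + r • p)) (phv p))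
    (eof fun r => ?_) ?_ ?_ ?_ ?_ ?_).2
  · exact (Continuous.mul (c1.comp (by fun_prop)) c3).aestronglyMeasurable
  · exact (Continuous.mul (c1.comp (by fun_prop)) c3).integrable_of_hasCompactSupport phi_supp.mul_left
  · exact (Continuous.inner (c2.comp (by fun_prop)) c4).aestronglyMeasurable
  · filter_upwards [] with p t _
    refine (norm_inner_le_norm _ _).trans ?_
    gcongr
    exact hC _
  · exact (c4.norm.integrable_of_hasCompactSupport phv_supp.norm).const_mul C
  · filter_upwards [] with p t _
    have h1 : HasDerivAt (fun t : ℝ => x + t • p) p t := by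
      simpa using ((hasDerivAt_id t).smul_const p).const_add x
    have h2 := (hf.differentiable (x + t • p)).hasGradientAt.hasFDerivAt.comp_hasDerivAt t h1
    have h3 := h2.mul_const (phi p)
    refine h3.congr_deriv ?_
    rw [phv, inner_smul_right, InnerProductSpace.toDual_apply_apply, mul_comm]

lemma mvD_bound (hY : MemLp Y 2 volume) (x : Euc n) (hr : 0 < r) :
    (mvD Y x r) ^ 2 ≤ (r ^ n)⁻¹ * (∫ q, ‖Y q‖ ^ 2) * ∫ p : Euc n, ‖phv p‖ ^ 2 := by
  rw [← cv x hr]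
  exact l2_cs (memLp_scale hY x hr) phv_memLp

lemma mv_bound (hy : MemLp y 2 volume) (x : Euc n) (hr : 0 < r) :
    (mv y x r) ^ 2 ≤ (r ^ n)⁻¹ * (∫ q, y q ^ 2) * ∫ p : Euc n, phi p ^ 2 := by
  rw [← cv x hr]
  exact l2_cs' (memLp_scale hy x hr) phi_memLp

lemma mvD_sub (hY : MemLp Y 2 volume) (hZ : MemLp Z 2 volume) (x : Euc n) (hr : 0 < r) :
    mvD (fun q => Y q - Z q) x r = mvD Y x r - mvD Z x r := by
  unfold mvD
  rw [← integral_sub (lii (memLp_scale hY x hr) phv_memLp) (lii (memLp_scale hZ x hr) phv_memLp)]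
  simp only [inner_sub_left]


lemma mv_hasDeriv (hy : MemH10 univ y Y) (x : Euc n) (hr : 0 < r) :
    HasDerivAt (mv y x) (mvD Y x r) r := by
  obtain ⟨f, hf, h1, h2⟩ := hy.2.2
  refine hasDerivAt_of_tendstoLocallyUniformlyOn (s := Ioi (r / 2)) (f := fun k => mv (f k) x) (f' := fun k => mvD (gradient (f k)) x) (l := atTop) isOpen_Ioi ?_
    (eof fun k t _ => mv_diff_test (hf k) x t) ?_ (by simp [hr])
  · refine TendstoUniformlyOn.tendstoLocallyUniformlyOn ?_
    rw [Metric.tendstoUniformlyOn_iff]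
    intro ε hε
    have h3 : Tendsto (fun k => ((r / 2) ^ n)⁻¹ * (∫ q, ‖gradient (f k) q - Y q‖ ^ 2) * ∫ p : Euc n, ‖phv p‖ ^ 2) atTop (𝓝 0) := by
      simpa using (h2.const_mul (((r / 2) ^ n)⁻¹)).mul_const (∫ p : Euc n, ‖phv p‖ ^ 2)
    filter_upwards [h3.eventually (gt_mem_nhds (show 0 < ε ^ 2 by positivity))] with k hk t ht
    have ht' : r / 2 < t := ht
    have ht0 : 0 < t := by linarith
    rw [dist_comm, Real.dist_eq, ← mvD_sub ((hf k).memLp_gradient 2) hy.2.1 x ht0]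
    refine abs_lt_of_sq_lt_sq ((mvD_bound (((hf k).memLp_gradient 2).sub hy.2.1) x ht0).trans_lt (lt_of_le_of_lt ?_ hk)) hε.le
    have a0 : 0 ≤ ∫ p : Euc n, ‖phv p‖ ^ 2 := integral_nonneg fun x => sq_nonneg _
    have a1 : 0 ≤ ∫ q, ‖gradient (f k) q - Y q‖ ^ 2 := integral_nonneg fun x => sq_nonneg _
    simp only [Pi.sub_apply]
    gcongr
  · intro t ht
    have ht' : r / 2 < t := ht
    have ht0 : 0 < t := by linarith
    have := l2_mul_tendsto (f := fun k p => f k (x + t • p)) (f' := fun p => y (x + t • p)) (g := phi) (fun k => memLp_scale ((hf k).memLp 2) x ht0) (memLp_scale hy.1 x ht0) phi_memLp (by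
      have e : ∀ k, ∫ p, (f k (x + t • p) - y (x + t • p)) ^ 2 = (t ^ n)⁻¹ * ∫ q, (f k q - y q) ^ 2 := fun k => cv x ht0 (fun q => (f k q - y q) ^ 2)
      simp only [e]
      simpa using h1.const_mul ((t ^ n)⁻¹))
    exact this

lemma mv_lebesgue (hyi : Integrable y volume) :
    ∀ᵐ x ∂volume, Tendsto (fun s => mv y x s) (𝓝[>] 0) (𝓝 (cphi n * y x)) := by
  obtain ⟨C, hC0, hC⟩ := phi_bdd (n := n)
  filter_upwards [IsUnifLocDoublingMeasure.ae_tendsto_average_norm_sub (volume : Measure (Euc n)) hyi.locallyIntegrable 1] with x hx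
  have h1 := hx (fun _ : ℝ => x) id tendsto_id (by
    filter_upwards [self_mem_nhdsWithin] with s hs
    exact mem_closedBall_self (by simpa using (le_of_lt hs)))
  have h2 := h1.const_mul (C * (volume (closedBall (0 : Euc n) 1)).toReal)
  rw [mul_zero] at h2
  rw [tendsto_iff_dist_tendsto_zero]
  refine squeeze_zero' (eof fun _ => dist_nonneg) ?_ h2
  filter_upwards [self_mem_nhdsWithin] with s hs
  have hs : 0 < s := hs
  have hint : Integrable (fun q => y q * phi (s⁻¹ • (q - x))) volume := by
    refine hyi.mul_bdd (c := C) (phi_cont.comp (by fun_prop)).aestronglyMeasurable (eof fun q => ?_)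
    rw [Real.norm_eq_abs, abs_of_nonneg (phi_nonneg _)]; exact hC _
  have hint1 : Integrable (fun q => phi (s⁻¹ • (q - x))) volume := by
    have := (integrable_comp_smul_iff (volume : Measure (Euc n)) phi (inv_ne_zero hs.ne')).2 phi_int
    exact this.comp_sub_right x
  have e1 : mv y x s - cphi n * y x = (s ^ n)⁻¹ * ∫ q, (y q - y x) * phi (s⁻¹ • (q - x)) := by
    have a1 : mv y x s = (s ^ n)⁻¹ * ∫ q, y q * phi (s⁻¹ • (q - x)) := cv' x hs (fun a b => y a * phi b)
    have a2 : cphi n = (s ^ n)⁻¹ * ∫ q, phi (s⁻¹ • (q - x)) := cv' x hs (fun a b => phi b)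
    simp only [sub_mul]
    rw [integral_sub hint (hint1.const_mul _), integral_const_mul, a1, a2]
    ring
  have e2 : |∫ q, (y q - y x) * phi (s⁻¹ • (q - x))| ≤ C * ∫ q in closedBall x s, ‖y q - y x‖ := by
    rw [← integral_const_mul, ← integral_indicator measurableSet_closedBall]
    refine (norm_integral_le_integral_norm _).trans (integral_mono_of_nonneg (eof fun q => norm_nonneg ((y q - y x) * phi (s⁻¹ • (q - x)))) ?_ (eof fun q => ?_))
    · rw [integrable_indicator_iff measurableSet_closedBall]
      have : IntegrableOn (fun q => y q - y x) (closedBall x s) volume := hyi.integrableOn.sub (integrableOn_const (measure_closedBall_lt_top.ne))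
      exact this.norm.const_mul C
    · by_cases hq : q ∈ closedBall x s
      · rw [indicator_of_mem hq]
        change ‖(y q - y x) * phi _‖ ≤ _
        rw [norm_mul, mul_comm, Real.norm_eq_abs (phi _), abs_of_nonneg (phi_nonneg _)]
        exact mlR (hC _) (norm_nonneg _)
      · rw [indicator_of_notMem hq]
        change ‖(y q - y x) * phi _‖ ≤ _
        rw [phi_zero, mul_zero, norm_zero]
        simp only [mem_closedBall, dist_eq_norm, not_le] at hq
        rw [norm_smul, norm_inv, Real.norm_eq_abs, abs_of_pos hs, ← div_eq_inv_mul, one_le_div hs]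
        exact hq.le
  have e3 : ⨍ q in closedBall x s, ‖y q - y x‖ = ((s ^ n) * (volume (closedBall (0 : Euc n) 1)).toReal)⁻¹ * ∫ q in closedBall x s, ‖y q - y x‖ := by
    rw [setAverage_eq, smul_eq_mul, measureReal_def, Measure.addHaar_closedBall' _ _ hs.le, finrank_euclideanSpace_fin, ENNReal.toReal_mul, ENNReal.toReal_ofReal (by positivity)]
  have hV : 0 < (volume (closedBall (0 : Euc n) 1)).toReal := ENNReal.toReal_pos (measure_closedBall_pos _ _ one_pos).ne' measure_closedBall_lt_top.ne
  rw [Real.dist_eq, e1, abs_mul, abs_of_pos (by positivity : 0 < (s ^ n)⁻¹), id, e3]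
  calc (s ^ n)⁻¹ * |∫ q, (y q - y x) * phi (s⁻¹ • (q - x))| ≤ (s ^ n)⁻¹ * (C * ∫ q in closedBall x s, ‖y q - y x‖) := by gcongr
    _ = _ := by field_simp

lemma mv_cont (hyi : Integrable y volume) (hs : 0 < s) : Continuous fun x => mv y x s := by
  obtain ⟨C, hC0, hC⟩ := phi_bdd (n := n)
  have : (fun x => mv y x s) = fun x => (s ^ n)⁻¹ * ∫ q, y q * phi (s⁻¹ • (q - x)) := by
    ext x; exact cv' x hs (fun a b => y a * phi b)
  rw [this]
  refine continuous_const.mul (continuous_of_dominated (bound := fun q => |y q| * C) (fun x => ?_) (fun x => ?_) (hyi.abs.mul_const C) ?_)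
  · exact hyi.1.mul (phi_cont.comp (by fun_prop)).aestronglyMeasurable
  · filter_upwards [] with q
    rw [norm_mul, Real.norm_eq_abs, Real.norm_eq_abs, abs_of_nonneg (phi_nonneg _)]
    gcongr; exact hC _
  · filter_upwards [] with q
    exact continuous_const.mul (phi_cont.comp (by fun_prop))



lemma phir_memLp (x : Euc n) (hr : 0 < r) : MemLp (fun q => phi (r⁻¹ • (q - x))) 2 volume := by
  have := memLp_scale (phi_memLp (n := n)) (-(r⁻¹ • x)) (inv_pos.2 hr)
  simpa only [smul_sub, neg_add_eq_sub] using this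

lemma phir_int (x : Euc n) (hr : 0 < r) : Integrable (fun q => phi (r⁻¹ • (q - x))) volume := by
  have := (integrable_comp_smul_iff (volume : Measure (Euc n)) phi (inv_ne_zero hr.ne')).2 phi_int
  exact this.comp_sub_right x

lemma mvD_lower (hy : MemLp y 2 volume) (hy0 : ∀ᵐ x ∂volume, 0 ≤ y x) (hF : MemLp F 2 volume)
    (hsub : ∀ ψ : Euc n → ℝ, IsTestFun univ ψ → (∀ x, 0 ≤ ψ x) → ∫ x, inner ℝ (Y x) (gradient ψ x) ≤ ∫ x, F x * ψ x)
    (hΛ : 0 ≤ Λ) (hC : 0 ≤ C) (hFl : ∀ᵐ x ∂volume, F x ≤ Λ * y x + C) (x : Euc n) (hr : 0 < r) :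
    - (r * (Λ * mv y x r + C * cphi n)) ≤ mvD Y x r := by
  have ht := (zets_test x hr (lt_add_one r)).mono (subset_univ _)
  have h1 := hsub _ ht (fun q => zet_nonneg _)
  have i1 := lmi hy (phir_memLp x hr)
  have h2 : ∫ q, F q * zets x r q ≤ Λ * (∫ q, y q * phi (r⁻¹ • (q - x))) + C * ∫ q, phi (r⁻¹ • (q - x)) := by
    rw [← integral_const_mul, ← integral_const_mul, ← integral_add (i1.const_mul _) ((phir_int x hr).const_mul _)]
    refine integral_mono_ae (lmi hF (ht.memLp 2)) ((i1.const_mul _).add ((phir_int x hr).const_mul _)) ?_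
    filter_upwards [hy0, hFl] with q a b
    have := mul_nonneg hΛ a
    calc F q * zets x r q ≤ (Λ * y q + C) * zets x r q := mlR b (zet_nonneg _)
      _ ≤ (Λ * y q + C) * phi (r⁻¹ • (q - x)) := mlL (zet_le_phi _) (by linarith)
      _ = _ := by ring
  have a1 : mv y x r = (r ^ n)⁻¹ * ∫ q, y q * phi (r⁻¹ • (q - x)) := cv' x hr (fun a b => y a * phi b)
  have a2 : cphi n = (r ^ n)⁻¹ * ∫ q, phi (r⁻¹ • (q - x)) := cv' x hr (fun a b => phi b)
  rw [mvD_eq Y x hr, a1, a2]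
  have h3 := mlL (h1.trans h2) (by positivity : 0 ≤ r * (r ^ n)⁻¹)
  linarith

lemma mv_nonneg (hy0 : ∀ᵐ x ∂volume, 0 ≤ y x) (x : Euc n) (hr : 0 < r) : 0 ≤ mv y x r := by
  have a1 : mv y x r = (r ^ n)⁻¹ * ∫ q, y q * phi (r⁻¹ • (q - x)) := cv' x hr (fun a b => y a * phi b)
  rw [a1]
  refine mul_nonneg (by positivity) (integral_nonneg_of_ae ?_)
  filter_upwards [hy0] with q hq
  exact mul_nonneg hq (phi_nonneg _)

def Linf (n : ℕ) (Λ C S : ℝ) : ℝ := (Real.exp Λ * (Real.sqrt (S * ∫ p : Euc n, phi p ^ 2) + C * cphi n)) / cphi n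

lemma Linf_nonneg {S : ℝ} (hC : 0 ≤ C) : 0 ≤ Linf n Λ C S := by
  have := cphi_pos (n := n)
  unfold Linf; positivity

lemma linf (hy : MemH10 (ball 0 R) y Y) (hy0 : ∀ᵐ x ∂volume, 0 ≤ y x) (hF : MemLp F 2 volume)
    (hsub : ∀ ψ : Euc n → ℝ, IsTestFun univ ψ → (∀ x, 0 ≤ ψ x) → ∫ x, inner ℝ (Y x) (gradient ψ x) ≤ ∫ x, F x * ψ x)
    {S : ℝ} (hΛ : 0 ≤ Λ) (hC : 0 ≤ C) (hFl : ∀ᵐ x ∂volume, F x ≤ Λ * y x + C) (hS : ∫ x, y x ^ 2 ≤ S) :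
    ∀ᵐ x ∂volume, y x ≤ Linf n Λ C S := by
  have hc := cphi_pos (n := n)
  have key : ∀ x : Euc n, ∀ s : ℝ, 0 < s → s ≤ 1 → mv y x s ≤ Real.exp Λ * (Real.sqrt (S * ∫ p : Euc n, phi p ^ 2) + C * cphi n) := by
    intro x s hs hs1
    let G : ℝ → ℝ := fun r => Real.exp (Λ * r) * (mv y x r + C * cphi n * r)
    have hG : ∀ r, 0 < r → HasDerivAt G (Real.exp (Λ * r) * Λ * (mv y x r + C * cphi n * r) + Real.exp (Λ * r) * (mvD Y x r + C * cphi n)) r := by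
      intro r hr
      have e1 : HasDerivAt (fun r => Real.exp (Λ * r)) (Real.exp (Λ * r) * Λ) r := by
        simpa using ((hasDerivAt_id r).const_mul Λ).exp
      have e2 : HasDerivAt (fun r => mv y x r + C * cphi n * r) (mvD Y x r + C * cphi n) r := by
        have e3 : HasDerivAt (fun r : ℝ => C * cphi n * r) (C * cphi n) r := by
          simpa using (hasDerivAt_id r).const_mul (C * cphi n)
        exact (mv_hasDeriv (hy.mono (subset_univ _)) x hr).add e3
      exact e1.mul e2
    have hmono : MonotoneOn G (Ioc 0 1) := by
      refine monotoneOn_of_deriv_nonneg (convex_Ioc 0 1) (fun r hr => (hG r hr.1).continuousAt.continuousWithinAt) (fun r hr => ?_) (fun r hr => ?_)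
      · rw [interior_Ioc] at hr
        exact (hG r hr.1).differentiableAt.differentiableWithinAt
      · rw [interior_Ioc] at hr
        rw [(hG r hr.1).deriv]
        have b1 := mvD_lower hy.1 hy0 hF hsub hΛ hC hFl x hr.1
        have b2 := mv_nonneg hy0 x hr.1
        have b3 : 0 ≤ Λ * (mv y x r + C * cphi n * r) + (mvD Y x r + C * cphi n) := by
          have c1 : 0 ≤ C * cphi n := by positivity
          have c2 : 0 ≤ Λ * mv y x r := by positivity
          have c3 : 0 ≤ Λ * (C * cphi n * r) := mul_nonneg hΛ (mul_nonneg c1 hr.1.le)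
          nlinarith [mul_nonneg (add_nonneg c1 c2) (sub_nonneg.2 hr.2.le)]
        have := mul_nonneg (Real.exp_pos (Λ * r)).le b3
        linarith
    have h1 := hmono ⟨hs, hs1⟩ ⟨one_pos, le_rfl⟩ hs1
    have h2 := mv_nonneg hy0 x hs
    have h3 : mv y x s ≤ G s := by
      have d1 : 1 ≤ Real.exp (Λ * s) := Real.one_le_exp (by positivity)
      have d2 : 0 ≤ C * cphi n * s := by positivity
      change _ ≤ Real.exp (Λ * s) * (mv y x s + C * cphi n * s)
      nlinarith
    refine h3.trans (h1.trans ?_)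
    change Real.exp (Λ * 1) * (mv y x 1 + C * cphi n * 1) ≤ _
    rw [mul_one, mul_one]
    gcongr
    refine Real.le_sqrt_of_sq_le ((mv_bound hy.1 x one_pos).trans ?_)
    rw [one_pow, inv_one, one_mul]
    exact mlR hS (integral_nonneg fun _ => sq_nonneg _)
  filter_upwards [mv_lebesgue (hy.integrable Subset.rfl)] with x hx
  have := le_of_tendsto hx (b := Real.exp Λ * (Real.sqrt (S * ∫ p : Euc n, phi p ^ 2) + C * cphi n)) (by
    filter_upwards [Ioc_mem_nhdsGT (zero_lt_one (α := ℝ))] with s hs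
    exact key x s hs.1 hs.2)
  rw [Linf, le_div_iff₀ hc]
  linarith

lemma IsSol.smul (h : IsSol Ω f w W) (c : ℝ) :
    IsSol Ω (fun x => c * f x) (fun x => c * w x) (fun x => c • W x) := by
  refine ⟨h.1.smul c, fun χ X hχ => ?_⟩
  simp only [inner_smul_left, mul_assoc, integral_const_mul, h.2 χ X hχ, conj_trivial]

lemma IsSol.sub (hf : MemLp f 2 volume) (hf' : MemLp f' 2 volume)
    (h : IsSol Ω f w W) (h' : IsSol Ω f' w' W') :
    IsSol Ω (fun x => f x - f' x) (fun x => w x - w' x) (fun x => W x - W' x) := by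
  refine ⟨h.1.sub h'.1, fun χ X hχ => ?_⟩
  simp only [inner_sub_left, sub_mul]
  rw [integral_sub (lii h.1.2.1 hχ.2.1) (lii h'.1.2.1 hχ.2.1), integral_sub (lmi hf hχ.1) (lmi hf' hχ.1), h.2 χ X hχ, h'.2 χ X hχ]

lemma oneB_nonneg (R : ℝ) (x : Euc n) : 0 ≤ oneB n R x := indicator_nonneg (fun _ _ => zero_le_one) x
lemma oneB_le (R : ℝ) (x : Euc n) : oneB n R x ≤ 1 := indicator_le_self' (f := fun _ => (1:ℝ)) (fun _ _ => zero_le_one) x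




lemma u_bound (hn : 0 < n) (hR : 0 < R) (hΩ : IsOpen Ω) (hne : Ω.Nonempty) (hb : Ω ⊆ ball 0 R)
    (hu : EF Ω u U) (hΛ : lam1 Ω ≤ Λ) : ∀ᵐ x ∂volume, u x ≤ Linf n Λ 0 1 := by
  have hp := lam1_pos hn hR hΩ hne hb
  have hF : MemLp (fun x => lam1 Ω * u x) 2 volume := hu.2.1.1.const_mul _
  have hF0 : ∀ᵐ x ∂volume, 0 ≤ lam1 Ω * u x := by filter_upwards [hu.1] with x hx; positivity
  refine linf (hu.2.1.mono hb) hu.1 hF (fun ψ h1 h2 => subsol hΩ hF hF0 hu.sol h1 h2) (hp.le.trans hΛ) le_rfl ?_ hu.2.2.1.le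
  filter_upwards [hu.1] with x hx
  rw [add_zero]
  gcongr

lemma u_le_w (hn : 0 < n) (hR : 0 < R) (hΩ : IsOpen Ω) (hne : Ω.Nonempty) (hb : Ω ⊆ ball 0 R)
    (hu : EF Ω u U) (hw : IsSol Ω (oneB n R) w W) (hΛ : lam1 Ω ≤ Λ) : ∀ᵐ x ∂volume, u x ≤ Λ * Linf n Λ 0 1 * w x := by
  have hp := lam1_pos hn hR hΩ hne hb
  have hL := Linf_nonneg (n := n) (Λ := Λ) (S := 1) le_rfl
  have h0 : ∀ᵐ x ∂volume, 0 ≤ oneB n R x := eof (oneB_nonneg R)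
  refine sol_le hn hR hΩ hb Subset.rfl (hu.2.1.1.const_mul _) ((oneBm R).const_mul _) hu.sol (hw.smul (Λ * Linf n Λ 0 1)) ?_ ?_
  · filter_upwards [hu.1, u_bound hn hR hΩ hne hb hu hΛ, (hu.2.1.mono hb).ae_zero] with x a b c
    by_cases h : x ∈ ball (0 : Euc n) R
    · simp only [oneB, indicator_of_mem h, mul_one]
      gcongr
      exact hp.le.trans hΛ
    · rw [c h, mul_zero]
      exact mul_nonneg (mul_nonneg (hp.le.trans hΛ) hL) (oneB_nonneg R x)
  · filter_upwards [sol_nonneg hn hR hb hw h0] with x hx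
    exact mul_nonneg (mul_nonneg (hp.le.trans hΛ) hL) hx



lemma fpen_diff (hη : 0 < η) (hη1 : η ≤ 1) (h : s ≤ t) :
    η * (t - s) ≤ fpen v η t - fpen v η s ∧ fpen v η t - fpen v η s ≤ (t - s) / η := by
  have hi : 1 ≤ η⁻¹ := (one_le_inv₀ hη).2 hη1
  unfold fpen
  simp only [div_eq_mul_inv]
  split_ifs with h1 h2 h2
  · constructor
    · linarith
    · nlinarith
  · linarith
  · have a : 0 < t - v := by linarith
    have b : 0 ≤ v - s := by linarith
    constructor <;> nlinarith
  · constructor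
    · nlinarith
    · linarith

lemma vol_fin (hb : Ω ⊆ ball 0 R) : volume Ω ≠ ∞ := ((measure_mono hb).trans_lt measure_ball_lt_top).ne

lemma baseE_lower (hn : 0 < n) (hR : 0 < R) (hη : 0 < η) (hη1 : η ≤ 1) (hT : 0 ≤ 𝔗) (hv : 0 < v) (hΩ : Ω ∈ Hclass n R vmax) :
    lam1 Ω - 𝔗 * Ctor n R - η * v ≤ baseE v η 𝔗 Ω ∧ fpen v η (volume Ω).toReal - 𝔗 * Ctor n R ≤ baseE v η 𝔗 Ω := by
  obtain ⟨h1, h2, h3, h4⟩ := hΩ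
  have a := lam1_pos hn hR h1 h2 h3
  have b := mlL (tor_lower hn hR h3) hT
  have c := (fpen_diff (v := v) hη hη1 (ENNReal.toReal_nonneg (a := volume Ω))).1
  have d : fpen v η 0 = - (η * v) := by simp [fpen, hv.le]
  have e : 0 ≤ η * ((volume Ω).toReal - 0) := mul_nonneg hη.le (by simp)
  unfold baseE
  constructor <;> linarith

lemma Emin_le (hn : 0 < n) (hR : 0 < R) (hη : 0 < η) (hη1 : η ≤ 1) (hT : 0 ≤ 𝔗) (hv : 0 < v) (hΩ : Ω ∈ Hclass n R vmax) :
    Emin n R vmax v η 𝔗 ≤ baseE v η 𝔗 Ω := by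
  refine csInf_le ⟨- 𝔗 * Ctor n R - η * v, ?_⟩ ⟨Ω, hΩ, rfl⟩
  rintro _ ⟨Ω, hΩ, rfl⟩
  have := (baseE_lower hn hR hη hη1 hT hv hΩ).1
  have := lam1_pos hn hR hΩ.1 hΩ.2.1 hΩ.2.2.1
  linarith


lemma inner_approx (hb : Ω ⊆ ball 0 R) (hp : MemH10 Ω p P) (hp0 : ∀ᵐ x ∂volume, 0 ≤ p x)
    (ht : 0 < t) (hδ : 0 < δ) : ∃ O, IsOpen O ∧ O ⊆ Ω ∧ ∃ a A φ, MemH10 O a A ∧ (∫ x, ‖A x‖ ^ 2 ≤ (∫ x, ‖P x‖ ^ 2) + δ) ∧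
      (∫ x, (a x - p x) ^ 2 ≤ δ + 8 * t ^ 2 * (volume (ball (0 : Euc n) R)).toReal) ∧ MemLp φ 2 volume ∧ (∫ x, (φ x - p x) ^ 2 ≤ δ) ∧ ∀ x ∈ O, t < φ x := by
  obtain ⟨f, hf, h1, h2⟩ := hp.2.2
  have h3 := l2_sq_tendsto (fun k => (hf k).memLp_gradient 2) hp.2.1 h2
  obtain ⟨k, k1, k2⟩ := ((h1.eventually (gt_mem_nhds (half_pos hδ))).and (h3.eventually (gt_mem_nhds (lt_add_of_pos_right _ hδ)))).exists
  set φ := f k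
  have hφ := hf k
  have hc := hφ.differentiable.continuous
  have hsub : ∀ s, 0 < s → {x | s ≤ φ x} ⊆ tsupport φ := fun s hs x hx => subset_tsupport _ (by
    have : s ≤ φ x := hx
    exact (by linarith : 0 < φ x).ne')
  refine ⟨{x | t < φ x}, isOpen_lt continuous_const hc, fun x (hx : t < φ x) => hφ.2.2 (hsub t ht (show t ≤ φ x from le_of_lt hx)), fun x => max (φ x - 2 * t) 0, fun x => if 2 * t < φ x then gradient φ x else 0, φ, ?_, ?_, ?_, hφ.memLp 2, by linarith, fun x hx => hx⟩
  · refine cpt_mem (K := {x | 2 * t ≤ φ x}) ?_ (isOpen_lt continuous_const hc) (fun x (hx : 2 * t ≤ φ x) => by change t < φ x; linarith)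
      (posPart_mem (hφ.memH10.mono (subset_univ _)) (by linarith)) (eof fun x hx => ?_)
    · exact hφ.2.1.of_isClosed_subset (isClosed_le continuous_const hc) (hsub _ (by linarith))
    · simp only [mem_setOf_eq, not_le] at hx
      exact max_eq_right (by linarith)
  · exact (trunc_le (fun x => 2 * t < φ x) (hφ.memLp_gradient 2)).trans k2.le
  · have i1 : Integrable (fun x => (φ x - p x) ^ 2) volume := lri ((hφ.memLp 2).sub hp.1)
    have i2 : Integrable ((ball (0 : Euc n) R).indicator (fun _ => 8 * t ^ 2)) volume :=
      (integrable_indicator_iff measurableSet_ball).2 (integrableOn_const measure_ball_lt_top.ne)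
    have e : ∫ x, (max (φ x - 2 * t) 0 - p x) ^ 2 ≤ ∫ x, (2 * (φ x - p x) ^ 2 + (ball (0 : Euc n) R).indicator (fun _ => 8 * t ^ 2) x) := by
      refine integral_mono_of_nonneg (eof fun _ => sq_nonneg _) ((i1.const_mul 2).add i2) ?_
      filter_upwards [hp0, hp.ae_zero] with x a b
      change (max (φ x - 2 * t) 0 - p x) ^ 2 ≤ _
      by_cases hx : x ∈ ball (0 : Euc n) R
      · rw [indicator_of_mem hx]
        rcases le_total (φ x - 2 * t) 0 with h | h
        · rw [max_eq_right h]
          rcases le_total (p x) (2 * t) with h' | h'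
          · nlinarith [sq_nonneg (φ x - p x)]
          · nlinarith [sq_nonneg (φ x - p x + 2 * t), sq_nonneg (φ x - p x - 2 * t)]
        · rw [max_eq_left h]
          nlinarith [sq_nonneg (φ x - p x + 2 * t)]
      · rw [indicator_of_notMem hx, b fun h => hx (hb h)]
        have : φ x = 0 := image_eq_zero_of_notMem_tsupport fun h => hx (hb (hφ.2.2 h))
        rw [this, max_eq_right (by linarith)]; simp
    rw [integral_add (i1.const_mul 2) i2, integral_const_mul, integral_indicator measurableSet_ball, setIntegral_const, smul_eq_mul, measureReal_def] at e
    linarith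

lemma markov (hφ : MemLp φ 2 volume) (hp : MemLp p 2 volume) (hp0 : ∀ᵐ x ∂volume, 0 ≤ p x)
    (ht : 0 < t) (h : ∫ x, (φ x - p x) ^ 2 ≤ δ) (hO : ∀ x ∈ O, t < φ x) : volume (O \ {x | 0 < p x}) ≤ ENNReal.ofReal (δ / t ^ 2) := by
  have i1 : Integrable (fun x => (φ x - p x) ^ 2) volume := lri (hφ.sub hp)
  have h1 := mul_meas_ge_le_integral_of_nonneg (eof fun x => sq_nonneg (φ x - p x)) i1 (t ^ 2)
  have ht2 : 0 < t ^ 2 := by positivity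
  have h2 : volume (O \ {x | 0 < p x}) ≤ volume {x | t ^ 2 ≤ (φ x - p x) ^ 2} := by
    refine measure_mono_ae ?_
    filter_upwards [hp0] with x a b
    have b1 := hO x b.1
    have b2 : p x ≤ 0 := not_lt.1 b.2
    change t ^ 2 ≤ (φ x - p x) ^ 2
    exact pow_le_pow_left₀ ht.le (by linarith) 2
  have hfin : volume {x | t ^ 2 ≤ (φ x - p x) ^ 2} ≠ ∞ := (i1.measure_ge_lt_top ht2).ne
  refine h2.trans ?_
  rw [← ENNReal.ofReal_toReal hfin]
  refine ENNReal.ofReal_le_ofReal ?_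
  rw [le_div_iff₀ ht2, mul_comm]
  exact h1.trans h

/-- Standing assumptions on the parameters. -/
structure Par (n : ℕ) (R v vmax η 𝔗 Λ c₀ κ : ℝ) : Prop where
  hn : 0 < n
  hR : 0 < R
  hv : 0 < v
  hvv : v < vmax
  hη : 0 < η
  hη1 : η ≤ 1
  hT : 0 < 𝔗
  hκ : 0 < κ
  hκ1 : κ ≤ 1
  hΛ : 0 < Λ
  hfk : ∀ (z : Euc n → ℝ) (D : Euc n → Euc n) (S : Set (Euc n)), MemH10 univ z D → MeasurableSet S → volume S ≠ ∞ →
    (∀ᵐ x ∂volume, x ∉ S → z x = 0) → ∫ x, ‖D x‖ ^ 2 ≤ 2 * (Λ + 1) * ∫ x, z x ^ 2 → 0 < ∫ x, z x ^ 2 → c₀ ≤ (volume S).toReal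
  hgap : κ + κ + 𝔗 * Ctor n R < η * c₀
  hNM : ∀ Ω ∈ Hclass n R vmax, baseE v η 𝔗 Ω ≤ Emin n R vmax v η 𝔗 + κ → lam1 Ω ≤ Λ ∧ (volume Ω).toReal ≤ (v + vmax) / 2

lemma l2_close (ha : MemLp a 2 volume) (hp : MemLp p 2 volume) {θ : ℝ} (hθ : 0 < θ) (h : ∫ x, (a x - p x) ^ 2 ≤ δ) :
    (1 - θ) * (∫ x, p x ^ 2) - δ / θ ≤ ∫ x, a x ^ 2 := by
  have i1 : Integrable (fun x => (a x - p x) ^ 2) volume := lri (ha.sub hp)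
  have e : ∫ x, ((1 - θ) * p x ^ 2 - θ⁻¹ * (a x - p x) ^ 2) ≤ ∫ x, a x ^ 2 := by
    refine integral_mono (((lri hp).const_mul _).sub (i1.const_mul _)) (lri ha) fun x => ?_
    change (1 - θ) * p x ^ 2 - θ⁻¹ * (a x - p x) ^ 2 ≤ a x ^ 2
    have : a x ^ 2 - ((1 - θ) * p x ^ 2 - θ⁻¹ * (a x - p x) ^ 2) = (a x - p x) ^ 2 + θ⁻¹ * (θ * p x + (a x - p x)) ^ 2 := by field_simp; ring
    have h2 : 0 ≤ (a x - p x) ^ 2 + θ⁻¹ * (θ * p x + (a x - p x)) ^ 2 := by positivity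
    linarith
  rw [integral_sub ((lri hp).const_mul _) (i1.const_mul _), integral_const_mul, integral_const_mul] at e
  have : θ⁻¹ * ∫ x, (a x - p x) ^ 2 ≤ δ / θ := by rw [div_eq_inv_mul]; gcongr
  linarith

lemma nonempty_of_mem (h : MemH10 O a A) (h0 : 0 < ∫ x, a x ^ 2) : O.Nonempty := by
  by_contra hO
  rw [not_nonempty_iff_eq_empty] at hO
  have : ∫ x, a x ^ 2 = 0 := by
    rw [← integral_zero (Euc n) ℝ (μ := volume)]
    apply integral_congr_ae
    filter_upwards [h.ae_zero] with x hx
    rw [hx (by simp [hO])]; simp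
  linarith

lemma excise (H : Par n R v vmax η 𝔗 Λ c₀ κ) (hΩ : Ω ∈ Hclass n R vmax)
    (hE : baseE v η 𝔗 Ω ≤ Emin n R vmax v η 𝔗 + κ) {M : Euc n → Euc n} (hp : MemH10 Ω p P) (hm : MemH10 Ω m M)
    (hp0 : ∀ᵐ x ∂volume, 0 ≤ p x) (hpm : ∀ᵐ x ∂volume, 0 < p x → m x = 0) (hpp : 0 < ∫ x, p x ^ 2) (hmp : 0 < ∫ x, m x ^ 2)
    (h1 : ∫ x, ‖P x‖ ^ 2 ≤ (lam1 Ω + κ) * ∫ x, p x ^ 2) (h2 : ∫ x, ‖M x‖ ^ 2 ≤ 2 * (lam1 Ω + κ) * ∫ x, m x ^ 2) : False := by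
  obtain ⟨ho, hne, hb, hvol⟩ := hΩ
  obtain ⟨hL, -⟩ := H.hNM Ω ⟨ho, hne, hb, hvol⟩ hE
  have hlp := lam1_pos H.hn H.hR ho hne hb
  have key : ∀ ε : ℝ, 0 < ε → ε < 1 → ∃ O, IsOpen O ∧ O ⊆ Ω ∧ O.Nonempty ∧ lam1 O ≤ lam1 Ω + κ + ε ∧ volume (O \ {x | 0 < p x}) ≤ ENNReal.ofReal ε := by
    intro ε hε hε1
    set q := ∫ x, p x ^ 2
    set V := (volume (ball (0 : Euc n) R)).toReal
    have hV : 0 ≤ V := ENNReal.toReal_nonneg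
    set L := lam1 Ω + κ
    have hLp : 0 < L := by have := H.hκ; positivity
    set θ := ε / (4 * (L + 1))
    have hθ : 0 < θ := by positivity
    set d := θ * (θ * q)
    have hd : 0 < d := by positivity
    obtain ⟨t, ht, ht2⟩ : ∃ t : ℝ, 0 < t ∧ 8 * t ^ 2 * V ≤ d / 2 := by
      refine ⟨Real.sqrt (d / (16 * (V + 1))), by positivity, ?_⟩
      rw [Real.sq_sqrt (by positivity), mul_div_assoc', div_mul_eq_mul_div, div_le_div_iff₀ (by positivity) (by norm_num)]
      nlinarith
    set δ := min (d / 2) (min (ε * t ^ 2) (ε / 4 * q))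
    have hδ : 0 < δ := by positivity
    obtain ⟨O, hO, hOs, a, A, φ, ha, hA, hap, hφ, hφp, hOt⟩ := inner_approx hb hp hp0 ht hδ
    have hδ1 : δ ≤ d / 2 := min_le_left _ _
    have hδ2 : δ ≤ ε * t ^ 2 := (min_le_right _ _).trans (min_le_left _ _)
    have hδ3 : δ ≤ ε / 4 * q := (min_le_right _ _).trans (min_le_right _ _)
    have hc := l2_close ha.1 hp.1 hθ (hap.trans (by linarith : _ ≤ d))
    have e1 : d / θ = θ * q := by simp only [d]; field_simp
    rw [e1] at hc
    have hθ4 : θ * (4 * (L + 1)) = ε := by simp only [θ]; field_simp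
    have hθs : 2 * θ ≤ 1 / 2 := by nlinarith
    have hc' : (1 - 2 * θ) * q ≤ ∫ x, a x ^ 2 := by linarith
    have hap : 0 < ∫ x, a x ^ 2 := lt_of_lt_of_le (mul_pos (by linarith) hpp) hc'
    refine ⟨O, hO, hOs, nonempty_of_mem ha hap, ?_, ?_⟩
    · have b1 := lam1_le ha
      have b2 : lam1 O * ∫ x, a x ^ 2 ≤ (L + ε) * ∫ x, a x ^ 2 := by
        refine b1.trans (hA.trans ?_)
        have b3 : (L + ε) * ((1 - 2 * θ) * q) ≤ (L + ε) * ∫ x, a x ^ 2 := mlL hc' (by positivity)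
        have b4 : (L + ε / 4) ≤ (L + ε) * (1 - 2 * θ) := by nlinarith
        have b5 : (L + ε / 4) * q ≤ (L + ε) * (1 - 2 * θ) * q := mlR b4 hpp.le
        linarith
      exact le_of_mul_le_mul_right b2 hap
    · refine (markov hφ hp.1 hp0 ht hφp hOt).trans (ENNReal.ofReal_le_ofReal ?_)
      rw [div_le_iff₀ (by positivity)]; exact hδ2
  have main : ∀ ε : ℝ, 0 < ε → ε < 1 → η * (c₀ - ε) ≤ κ + κ + 𝔗 * Ctor n R + ε := by
    intro ε hε hε1
    obtain ⟨O, hO, hOs, hOne, hl, hv⟩ := key ε hε hε1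
    have hfin := vol_fin hb
    have hfinO := vol_fin (hOs.trans hb)
    set T := toMeasurable volume (O \ {x | 0 < p x})
    have hTv : volume T ≤ ENNReal.ofReal ε := (measure_toMeasurable _).trans_le hv
    have hS := H.hfk m M ((Ω \ O) ∪ T) (hm.mono (subset_univ _)) ((ho.measurableSet.diff hO.measurableSet).union (measurableSet_toMeasurable _ _))
      (((measure_union_le _ _).trans_lt (ENNReal.add_lt_top.2 ⟨(measure_mono diff_subset).trans_lt hfin.lt_top, hTv.trans_lt ENNReal.ofReal_lt_top⟩)).ne) (by
        filter_upwards [hm.ae_zero, hpm] with x a b hx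
        simp only [mem_union, not_or, mem_diff, not_and, not_not] at hx
        by_cases hxΩ : x ∈ Ω
        · by_cases hx0 : 0 < p x
          · exact b hx0
          · exact absurd (subset_toMeasurable volume (O \ {x | 0 < p x}) ⟨hx.1 hxΩ, hx0⟩) hx.2
        · exact a hxΩ) (h2.trans (by gcongr; linarith [H.hκ1])) hmp
    have hS2 : (volume ((Ω \ O) ∪ T)).toReal ≤ (volume Ω).toReal - (volume O).toReal + ε := by
      have c1 := measure_union_le (μ := volume) (Ω \ O) T
      have c2 : volume ((Ω \ O) ∪ T) ≤ (volume Ω - volume O) + ENNReal.ofReal ε := by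
        rw [← measure_diff hOs hO.measurableSet.nullMeasurableSet hfinO]
        exact c1.trans (add_le_add le_rfl hTv)
      have c3 := ENNReal.toReal_mono (ENNReal.add_ne_top.2 ⟨ENNReal.sub_ne_top hfin, ENNReal.ofReal_ne_top⟩) c2
      rwa [ENNReal.toReal_add (ENNReal.sub_ne_top hfin) ENNReal.ofReal_ne_top, ENNReal.toReal_sub_of_le (measure_mono hOs) hfin, ENNReal.toReal_ofReal hε.le] at c3
    have hvO : (volume O).toReal ≤ (volume Ω).toReal := ENNReal.toReal_mono hfin (measure_mono hOs)
    have hEO := Emin_le (vmax := vmax) H.hn H.hR H.hη H.hη1 H.hT.le H.hv (Ω := O) ⟨hO, hOne, hOs.trans hb, hvO.trans hvol⟩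
    have hf := (fpen_diff (v := v) H.hη H.hη1 hvO).1
    have t1 := mlL (tor_lower H.hn H.hR hb) H.hT.le
    have t2 := mul_nonpos_of_nonneg_of_nonpos H.hT.le (tor_nonpos H.hn H.hR (hOs.trans hb))
    have t3 : η * (c₀ - ε) ≤ η * ((volume Ω).toReal - (volume O).toReal) := mlL (by linarith) H.hη.le
    unfold baseE at hE hEO
    linarith
  have hg := H.hgap
  set g := η * c₀ - (κ + κ + 𝔗 * Ctor n R)
  have hgp : 0 < g := by simp only [g]; linarith
  have := main (min (g / 4) (1 / 2)) (by positivity) (by have := min_le_right (g / 4) (1 / 2 : ℝ); linarith)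
  have hm1 := min_le_left (g / 4) (1 / 2 : ℝ)
  have hm2 : 0 < min (g / 4) (1 / 2) := by positivity
  have := H.hη
  have := H.hη1
  nlinarith



lemma gap (H : Par n R v vmax η 𝔗 Λ c₀ κ) (hΩ : Ω ∈ Hclass n R vmax)
    (hE : baseE v η 𝔗 Ω ≤ Emin n R vmax v η 𝔗 + κ) (hu : EF Ω u U) (q : Euc n → ℝ) (Q : Euc n → Euc n)
    (hq : MemH10 Ω q Q) (h0 : ∫ x, q x * u x = 0) : (lam1 Ω + κ) * ∫ x, q x ^ 2 ≤ ∫ x, ‖Q x‖ ^ 2 := by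
  by_contra! hlt
  obtain ⟨u0, um, u1, ul⟩ := hu
  have hlp := lam1_pos H.hn H.hR hΩ.1 hΩ.2.1 hΩ.2.2.1
  have hκ := H.hκ
  set L := lam1 Ω + κ
  have hL : 0 < L := by positivity
  have hQ0 : 0 ≤ ∫ x, ‖Q x‖ ^ 2 := integral_nonneg fun _ => by positivity
  have hq0 : 0 < ∫ x, q x ^ 2 := by
    by_contra! h
    nlinarith
  have hx : ∫ x, inner ℝ (U x) (Q x) = 0 := by
    rw [(EF.sol ⟨u0, um, u1, ul⟩).2 q Q hq]
    have : ∀ x, lam1 Ω * u x * q x = lam1 Ω * (q x * u x) := fun x => by ring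
    simp_rw [this]
    rw [integral_const_mul, h0, mul_zero]
  have hx' : ∫ x, u x * q x = 0 := by rw [← h0]; exact integral_congr_ae (eof fun x => mul_comm _ _)
  set g : ℝ → ℝ := fun θ => ∫ x, (Real.cos θ * u x + Real.sin θ * q x) * |Real.cos θ * u x + Real.sin θ * q x|
  have hg : Continuous g := by
    have hb : Integrable (fun x => 2 * u x ^ 2 + 2 * q x ^ 2) volume := ((lri um.1).const_mul 2).add ((lri hq.1).const_mul 2)
    refine continuous_of_dominated (bound := fun x => 2 * u x ^ 2 + 2 * q x ^ 2) (fun θ => ?_) (fun θ => eof fun x => ?_) hb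
      (eof fun x => by fun_prop)
    · have : AEStronglyMeasurable (fun x => Real.cos θ * u x + Real.sin θ * q x) volume :=
        (um.1.aestronglyMeasurable.const_mul _).add (hq.1.aestronglyMeasurable.const_mul _)
      exact this.mul this.norm
    · rw [Real.norm_eq_abs, abs_mul, abs_abs, ← sq, sq_abs]
      have := Real.cos_sq_add_sin_sq θ
      have h1 : (Real.cos θ * u x + Real.sin θ * q x) ^ 2 ≤ 2 * (Real.cos θ ^ 2 * u x ^ 2) + 2 * (Real.sin θ ^ 2 * q x ^ 2) := by
        nlinarith [sq_nonneg (Real.cos θ * u x - Real.sin θ * q x)]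
      have h2 : Real.cos θ ^ 2 * u x ^ 2 ≤ 1 * u x ^ 2 := by gcongr; nlinarith [sq_nonneg (Real.sin θ)]
      have h3 : Real.sin θ ^ 2 * q x ^ 2 ≤ 1 * q x ^ 2 := by gcongr; nlinarith [sq_nonneg (Real.cos θ)]
      linarith
  have g0 : 0 ≤ g 0 := integral_nonneg_of_ae (by
    filter_upwards [u0] with x hx
    simp only [Real.cos_zero, Real.sin_zero, one_mul, zero_mul, add_zero, Pi.zero_apply]
    positivity)
  have g1 : g Real.pi ≤ 0 := integral_nonpos_of_ae (by
    filter_upwards [u0] with x hx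
    simp only [Real.cos_pi, Real.sin_pi, zero_mul, add_zero, Pi.zero_apply]
    nlinarith [abs_nonneg (-1 * u x)])
  obtain ⟨θ, -, hθ⟩ := intermediate_value_Icc' Real.pi_pos.le hg.continuousOn ⟨g1, g0⟩
  have hz := (um.smul (Real.cos θ)).lin hq (Real.sin θ)
  have e1 := l2_expand (um.smul (Real.cos θ)).2.1 hq.2.1 (Real.sin θ)
  have e2 := l2_expand' (um.smul (Real.cos θ)).1 hq.1 (Real.sin θ)
  simp only [inner_smul_left, norm_smul, mul_pow, integral_const_mul, mul_assoc, hx, hx', Real.norm_eq_abs, sq_abs, ul, u1, conj_trivial, mul_zero, add_zero, mul_one] at e1 e2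
  have hcs := Real.cos_sq_add_sin_sq θ
  have hen := pos_neg_energy hz
  have hp := pos_mem hz
  have hm := neg_mem hz
  set z := fun x => Real.cos θ * u x + Real.sin θ * q x with hzd
  have ez : ∫ x, z x ^ 2 = Real.cos θ ^ 2 + Real.sin θ ^ 2 * ∫ x, q x ^ 2 := by simpa only [hzd] using e2
  have zpos : 0 < ∫ x, z x ^ 2 := by
    rw [ez]
    rcases eq_or_ne (Real.sin θ) 0 with h | h
    · nlinarith
    · have := mul_pos (pow_pos (abs_pos.2 h) 2) hq0
      rw [sq_abs] at this
      nlinarith [sq_nonneg (Real.cos θ)]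
  have hLz : ∫ x, ‖Real.cos θ • U x + Real.sin θ • Q x‖ ^ 2 ≤ L * ∫ x, z x ^ 2 := by
    rw [e1, ez, mul_add]
    have a1 : Real.sin θ ^ 2 * ∫ x, ‖Q x‖ ^ 2 ≤ Real.sin θ ^ 2 * (L * ∫ x, q x ^ 2) := mlL hlt.le (sq_nonneg _)
    have a2 : Real.cos θ ^ 2 * lam1 Ω ≤ Real.cos θ ^ 2 * L := mlL (by simp only [L]; linarith) (sq_nonneg _)
    linarith
  have ip := lri hp.1
  have im := lri hm.1
  have s1 : (∫ x, max (z x) 0 ^ 2) + ∫ x, max (- z x) 0 ^ 2 = ∫ x, z x ^ 2 := by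
    rw [← integral_add ip im]
    refine integral_congr_ae (eof fun x => ?_)
    change max (z x) 0 ^ 2 + max (- z x) 0 ^ 2 = z x ^ 2
    rcases le_total (z x) 0 with h | h
    · rw [max_eq_right h, max_eq_left (by linarith)]; ring
    · rw [max_eq_left h, max_eq_right (by linarith)]; ring
  have s2 : (∫ x, max (z x) 0 ^ 2) - ∫ x, max (- z x) 0 ^ 2 = 0 := by
    rw [← integral_sub ip im]
    refine Eq.trans ?_ hθ
    refine integral_congr_ae (eof fun x => ?_)
    change max (z x) 0 ^ 2 - max (- z x) 0 ^ 2 = z x * |z x|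
    rcases le_total (z x) 0 with h | h
    · rw [max_eq_right h, max_eq_left (by linarith), abs_of_nonpos h]; ring
    · rw [max_eq_left h, max_eq_right (by linarith), abs_of_nonneg h]; ring
  have pp : 0 < ∫ x, max (z x) 0 ^ 2 := by linarith
  have mp : 0 < ∫ x, max (- z x) 0 ^ 2 := by linarith
  have pm1 : ∀ x, 0 < max (z x) 0 → max (- z x) 0 = 0 := fun x h => max_eq_right (by
    have := (lt_max_iff.1 h).resolve_right (lt_irrefl _); linarith)
  have pm2 : ∀ x, 0 < max (- z x) 0 → max (z x) 0 = 0 := fun x h => max_eq_right (by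
    have := (lt_max_iff.1 h).resolve_right (lt_irrefl _); linarith)
  have P0 : 0 ≤ ∫ x, ‖if 0 < z x then Real.cos θ • U x + Real.sin θ • Q x else 0‖ ^ 2 := integral_nonneg fun _ => by positivity
  have M0 : 0 ≤ ∫ x, ‖if z x < 0 then -(Real.cos θ • U x + Real.sin θ • Q x) else 0‖ ^ 2 := integral_nonneg fun _ => by positivity
  have k1 : L * ∫ x, z x ^ 2 = 2 * (L * ∫ x, max (z x) 0 ^ 2) := by rw [← s1, ← sub_eq_zero.1 s2]; ring
  have k2 : ∫ x, max (- z x) 0 ^ 2 = ∫ x, max (z x) 0 ^ 2 := (sub_eq_zero.1 s2).symm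
  rw [k1] at hLz
  rcases le_total (∫ x, ‖if 0 < z x then Real.cos θ • U x + Real.sin θ • Q x else 0‖ ^ 2) (L * ∫ x, max (z x) 0 ^ 2) with h | h
  · exact excise H hΩ hE hp hm (eof fun x => le_max_right _ _) (eof pm1) pp mp h (by rw [k2, mul_assoc]; linarith)
  · exact excise H hΩ hE hm hp (eof fun x => le_max_right _ _) (eof pm2) mp pp (by rw [k2]; linarith) (by rw [mul_assoc]; linarith)

lemma EF.unique (H : Par n R v vmax η 𝔗 Λ c₀ κ) (hΩ : Ω ∈ Hclass n R vmax)
    (hE : baseE v η 𝔗 Ω ≤ Emin n R vmax v η 𝔗 + κ) (hu : EF Ω u U) (hu0 : ∀ x ∉ Ω, u x = 0) : UniqueEigen Ω u := by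
  refine ⟨⟨hu.1, hu0, hu.2.2.1, U, hu.2.1, hu.2.2.2⟩, ?_⟩
  rintro u' ⟨p0, -, p1, U', pm, pl⟩
  set s := ∫ x, u' x * u x with hs
  have hq := pm.lin hu.2.1 (-s)
  have iu := lri hu.2.1.1
  have e1 := l2_expand' pm.1 hu.2.1.1 (-s)
  have e2 := l2_expand pm.2.1 hu.2.1.2.1 (-s)
  have e3 : ∫ x, inner ℝ (U' x) (U x) = lam1 Ω * s := by
    rw [(EF.sol ⟨p0, pm, p1, pl⟩).2 u U hu.2.1]
    simp_rw [mul_assoc]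
    rw [integral_const_mul]
  have e4 : ∫ x, (u' x + -s * u x) * u x = 0 := by
    have : ∀ x, (u' x + -s * u x) * u x = u' x * u x + -s * u x ^ 2 := fun x => by ring
    simp_rw [this]
    rw [integral_add (lmi pm.1 hu.2.1.1) (iu.const_mul _), integral_const_mul, hu.2.2.1]; simp [hs]
  rw [hu.2.2.1, p1, ← hs] at e1
  rw [hu.2.2.2, pl, e3] at e2
  have hg := gap H hΩ hE hu _ _ hq e4
  have hn0 : 0 ≤ ∫ x, (u' x + -s * u x) ^ 2 := integral_nonneg fun _ => sq_nonneg _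
  rw [e2, e1] at hg
  rw [e1] at hn0
  have hκ := H.hκ
  have hs1 : 1 - s ^ 2 = 0 := by nlinarith
  have hs0 : 0 ≤ s := integral_nonneg_of_ae (by filter_upwards [p0, hu.1] with x a b using mul_nonneg a b)
  have hs2 : s = 1 := by nlinarith
  have := l2_rae_zero hq.1 (by rw [e1]; linarith)
  filter_upwards [this] with x hx
  rw [hs2] at hx
  simp only [Pi.zero_apply] at hx
  linarith



lemma int_add3 {c : Euc n → ℝ} (ha : Integrable a volume) (hb : Integrable b volume) (hc : Integrable c volume) :
    ∫ x, (a x + b x + c x) = (∫ x, a x) + (∫ x, b x) + ∫ x, c x := by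
  rw [← integral_add ha hb]; exact integral_add (ha.add hb) hc

lemma sol_l2 (hn : 0 < n) (hR : 0 < R) (hb : Ω ⊆ ball 0 R) (hf : MemLp f 2 volume)
    (hy : IsSol Ω f y Y) : ∫ x, y x ^ 2 ≤ 4 * R ^ 4 * ∫ x, f x ^ 2 := by
  have h1 := poincare hn hR (hy.1.mono hb)
  have h2 := l2_cs' hf hy.1.1
  have h3 := hy.2 y Y hy.1
  simp only [real_inner_self_eq_norm_sq] at h3
  rw [← h3] at h2
  set E := ∫ x, ‖Y x‖ ^ 2
  have hE : 0 ≤ E := integral_nonneg fun _ => by positivity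
  have hf0 : 0 ≤ ∫ x, f x ^ 2 := integral_nonneg fun _ => sq_nonneg _
  have hy0 : 0 ≤ ∫ x, y x ^ 2 := integral_nonneg fun _ => sq_nonneg _
  set a := ∫ x, y x ^ 2
  set b := ∫ x, f x ^ 2
  rcases hy0.eq_or_lt with h | h
  · rw [← h]; positivity
  · have h4 : a * a ≤ (4 * R ^ 4 * b) * a := by
      calc a * a ≤ (2 * R ^ 2 * E) * (2 * R ^ 2 * E) := mul_le_mul h1 h1 hy0 (by positivity)
        _ = 4 * R ^ 4 * E ^ 2 := by ring
        _ ≤ 4 * R ^ 4 * (b * a) := by gcongr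
        _ = _ := by ring
    exact le_of_mul_le_mul_right h4 h

def VB (n : ℕ) (R : ℝ) : ℝ := (volume (ball (0 : Euc n) R)).toReal

lemma VB_nonneg (n : ℕ) (R : ℝ) : 0 ≤ VB n R := ENNReal.toReal_nonneg

def Kpsi (n : ℕ) (R Λ κ : ℝ) : ℝ := Linf n Λ (1 + (VB n R + 1) * Linf n Λ 0 1) (4 * R ^ 4 * (3 * (Λ ^ 2 * (VB n R / κ ^ 2)) + 6 * VB n R))

lemma oneB_sq (R : ℝ) : ∫ x, oneB n R x ^ 2 = VB n R := by
  have : (fun x => oneB n R x ^ 2) = (ball (0 : Euc n) R).indicator (fun _ => (1:ℝ)) := by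
    funext x
    by_cases h : x ∈ ball (0 : Euc n) R <;> simp [oneB, indicator, h]
  rw [this, integral_indicator measurableSet_ball, setIntegral_const]
  simp [VB, measureReal_def]

lemma psi_exists (hn : 0 < n) (hR : 0 < R) (hΩ : IsOpen Ω) (hne : Ω.Nonempty) (hb : Ω ⊆ ball 0 R) (hu : EF Ω u U)
    (hΛ : lam1 Ω ≤ Λ) (hκ : 0 < κ) (hl0 : 0 ≤ l) (hl : l ≤ lam1 Ω)
    (hgap : ∀ q Q, MemH10 Ω q Q → ∫ x, q x * u x = 0 → (lam1 Ω + κ) * ∫ x, q x ^ 2 ≤ ∫ x, ‖Q x‖ ^ 2)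
    {ξ : Euc n → ℝ} (hξ : AEStronglyMeasurable ξ volume) (hξ1 : ∀ᵐ x ∂volume, |ξ x| ≤ oneB n R x) :
    ∃ ψ Ψ, MemH10 Ω ψ Ψ ∧ ∫ x, ψ x * u x = 0 ∧ (∀ χ X, MemH10 Ω χ X → ∫ x, χ x * u x = 0 →
      (∫ x, inner ℝ (Ψ x) (X x)) - l * ∫ x, ψ x * χ x = ∫ x, ξ x * χ x) ∧ ∀ᵐ x ∂volume, |ψ x| ≤ Kpsi n R Λ κ := by
  have hξL : MemLp ξ 2 volume := (oneBm R).mono hξ (by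
    filter_upwards [hξ1] with x hx
    rw [Real.norm_eq_abs, Real.norm_eq_abs, abs_of_nonneg (oneB_nonneg R x)]; exact hx)
  have hV := VB_nonneg n R
  have hξs : ∫ x, ξ x ^ 2 ≤ VB n R := by
    rw [← oneB_sq]
    refine integral_mono_ae (lri hξL) (lri (oneBm R)) ?_
    filter_upwards [hξ1] with x hx
    exact sq_le_sq.2 (hx.trans (le_abs_self _))
  have hlam := lam1_pos hn hR hΩ hne hb
  have gap' : ∀ q Q, MemH10 Ω q Q → ∫ x, q x * u x = 0 → (l + κ) * ∫ x, q x ^ 2 ≤ ∫ x, ‖Q x‖ ^ 2 := fun q Q h h' =>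
    (mlR (by linarith) (integral_nonneg fun _ => sq_nonneg _)).trans (hgap q Q h h')
  obtain ⟨ψ, Ψ, hψ, hψu, heq⟩ := solve2 hu.2.1.1 hξL hl0 hκ gap'
  refine ⟨ψ, Ψ, hψ, hψu, heq, ?_⟩
  set b := ∫ x, ξ x * u x with hbd
  have hb2 : b ^ 2 ≤ VB n R := (l2_cs' hξL hu.2.1.1).trans (by rw [hu.2.2.1, mul_one]; exact hξs)
  have hb1 : |b| ≤ VB n R + 1 := by
    rw [← sq_abs] at hb2
    nlinarith [sq_nonneg (|b| - 1)]
  have hψ2 : ∫ x, ψ x ^ 2 ≤ VB n R / κ ^ 2 := by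
    have h1 := heq ψ Ψ hψ hψu
    have h2 := gap' ψ Ψ hψ hψu
    have h3 := l2_cs' hξL hψ.1
    simp only [real_inner_self_eq_norm_sq, ← sq] at h1
    set a := ∫ x, ψ x ^ 2
    set c := ∫ x, ξ x * ψ x
    have ha : 0 ≤ a := integral_nonneg fun _ => sq_nonneg _
    have h4 : κ * a ≤ c := by linarith
    rw [le_div_iff₀ (by positivity)]
    rcases ha.eq_or_lt with h | h
    · rw [← h]; simpa using hV
    · have h5 : (a * κ ^ 2) * a ≤ VB n R * a := by
        calc (a * κ ^ 2) * a = (κ * a) * (κ * a) := by ring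
          _ ≤ c * c := mul_self_le_mul_self (by positivity) h4
          _ = c ^ 2 := (sq c).symm
          _ ≤ _ := h3.trans (by gcongr)
      exact le_of_mul_le_mul_right h5 h
  set f : Euc n → ℝ := fun x => l * ψ x + ξ x + -b * u x with hf
  have hfL : MemLp f 2 volume := ((hψ.1.const_mul l).add hξL).add (hu.2.1.1.const_mul (-b))
  have hΨU : ∫ x, inner ℝ (Ψ x) (U x) = 0 := by
    have : ∀ x, inner ℝ (Ψ x) (U x) = inner ℝ (U x) (Ψ x) := fun x => real_inner_comm _ _
    simp_rw [this]
    rw [hu.sol.2 ψ Ψ hψ]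
    have : ∀ x, lam1 Ω * u x * ψ x = lam1 Ω * (ψ x * u x) := fun x => by ring
    simp_rw [this]
    rw [integral_const_mul, hψu, mul_zero]
  have hsol : IsSol Ω f ψ Ψ := by
    refine ⟨hψ, fun χ X hχ => ?_⟩
    set c := ∫ x, χ x * u x with hc
    have iχ := lmi hχ.1 hu.2.1.1
    have h1 := heq _ _ (hχ.lin hu.2.1 (-c)) (by
      have : ∀ x, (χ x + -c * u x) * u x = χ x * u x + -c * u x ^ 2 := fun x => by ring
      simp_rw [this]
      rw [integral_add iχ ((lri hu.2.1.1).const_mul _), integral_const_mul, hu.2.2.1]; simp [hc])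
    have e1 : ∫ x, inner ℝ (Ψ x) (X x + -c • U x) = ∫ x, inner ℝ (Ψ x) (X x) := by
      simp_rw [inner_add_right, inner_smul_right]
      rw [integral_add (lii hψ.2.1 hχ.2.1) ((lii hψ.2.1 hu.2.1.2.1).const_mul _), integral_const_mul, hΨU]; simp
    have e2 : ∫ x, ψ x * (χ x + -c * u x) = ∫ x, ψ x * χ x := by
      have : ∀ x, ψ x * (χ x + -c * u x) = ψ x * χ x + -c * (ψ x * u x) := fun x => by ring
      simp_rw [this]
      rw [integral_add (lmi hψ.1 hχ.1) ((lmi hψ.1 hu.2.1.1).const_mul _), integral_const_mul, hψu]; simp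
    have e3 : ∫ x, ξ x * (χ x + -c * u x) = (∫ x, ξ x * χ x) + -c * b := by
      have : ∀ x, ξ x * (χ x + -c * u x) = ξ x * χ x + -c * (ξ x * u x) := fun x => by ring
      simp_rw [this]
      rw [integral_add (lmi hξL hχ.1) ((lmi hξL hu.2.1.1).const_mul _), integral_const_mul]
    have e4 : ∫ x, f x * χ x = l * (∫ x, ψ x * χ x) + (∫ x, ξ x * χ x) + -b * c := by
      have : ∀ x, f x * χ x = l * (ψ x * χ x) + ξ x * χ x + -b * (χ x * u x) := fun x => by simp only [hf]; ring
      simp_rw [this]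
      rw [int_add3 ((lmi hψ.1 hχ.1).const_mul _) (lmi hξL hχ.1) (iχ.const_mul _), integral_const_mul, integral_const_mul]
    rw [e1, e2, e3] at h1
    rw [e4]; linarith
  have hfa : MemLp (fun x => |f x|) 2 volume := hfL.norm
  obtain ⟨y, Y, hy⟩ := sol_exists hn hR hb hfa
  have hψy := sol_abs_le hn hR hΩ hb hfL hfa hsol hy (eof fun x => le_rfl)
  have hf2 : ∫ x, |f x| ^ 2 ≤ 3 * (Λ ^ 2 * (VB n R / κ ^ 2)) + 6 * VB n R := by
    have i1 := (lri hψ.1).const_mul (3 * l ^ 2)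
    have i2 := (lri hξL).const_mul 3
    have i3 := (lri hu.2.1.1).const_mul (3 * b ^ 2)
    have : ∫ x, |f x| ^ 2 ≤ ∫ x, (3 * l ^ 2 * ψ x ^ 2 + 3 * ξ x ^ 2 + 3 * b ^ 2 * u x ^ 2) := by
      refine integral_mono (lri hfa) ((i1.add i2).add i3) fun x => ?_
      change |f x| ^ 2 ≤ 3 * l ^ 2 * ψ x ^ 2 + 3 * ξ x ^ 2 + 3 * b ^ 2 * u x ^ 2
      rw [sq_abs]
      simp only [hf]
      nlinarith [sq_nonneg (l * ψ x - ξ x), sq_nonneg (l * ψ x - (-b * u x)), sq_nonneg (ξ x - (-b * u x))]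
    rw [int_add3 i1 i2 i3, integral_const_mul, integral_const_mul, integral_const_mul, hu.2.2.1] at this
    have h1 : l ^ 2 * ∫ x, ψ x ^ 2 ≤ Λ ^ 2 * (VB n R / κ ^ 2) :=
      mul_le_mul (pow_le_pow_left₀ hl0 (hl.trans hΛ) 2) hψ2 (integral_nonneg fun _ => sq_nonneg _) (by positivity)
    linarith
  have hM0 : 0 ≤ Linf n Λ 0 1 := Linf_nonneg le_rfl
  have hyb := linf (Λ := Λ) (C := 1 + (VB n R + 1) * Linf n Λ 0 1) (hy.1.mono hb) (sol_nonneg hn hR hb hy (eof fun _ => abs_nonneg _)) hfa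
    (fun φ h h' => subsol hΩ hfa (eof fun _ => abs_nonneg _) hy h h') (by linarith) (by positivity) (by
      filter_upwards [hψy, hξ1, u_bound hn hR hΩ hne hb hu hΛ, hu.1] with x a1 a2 a3 a4
      have a5 := oneB_le (n := n) R x
      calc |f x| ≤ |l * ψ x + ξ x| + |-b * u x| := abs_add_le _ _
        _ ≤ |l * ψ x| + |ξ x| + |-b * u x| := by gcongr; exact abs_add_le _ _
        _ = l * |ψ x| + |ξ x| + |b| * u x := by rw [abs_mul, abs_mul, abs_neg, abs_of_nonneg hl0, abs_of_nonneg a4]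
        _ ≤ Λ * y x + 1 + (VB n R + 1) * Linf n Λ 0 1 := by
          have : l * |ψ x| ≤ Λ * y x := mul_le_mul (hl.trans hΛ) a1 (abs_nonneg _) (by linarith)
          have : |b| * u x ≤ (VB n R + 1) * Linf n Λ 0 1 := mul_le_mul hb1 a3 a4 (by linarith)
          linarith
        _ = _ := by ring)
    ((sol_l2 hn hR hb hfa hy).trans (mlL hf2 (by positivity)))
  filter_upwards [hψy, hyb] with x a1 a2
  exact a1.trans a2


def Cnest (n : ℕ) (R Λ κ : ℝ) : ℝ :=
  (1 + Linf n Λ 0 1 * (VB n R + 1)) * ((1 + Λ * Kpsi n R Λ κ) * (Λ * Linf n Λ 0 1 * 2))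

lemma Kpsi_nonneg : 0 ≤ Kpsi n R Λ κ :=
  Linf_nonneg (by have := VB_nonneg n R; have := Linf_nonneg (n := n) (Λ := Λ) (C := 0) (S := 1) le_rfl; positivity)

lemma Cnest_nonneg (hΛ : 0 ≤ Λ) : 0 ≤ Cnest n R Λ κ := by
  have := VB_nonneg n R
  have := Linf_nonneg (n := n) (Λ := Λ) (C := 0) (S := 1) le_rfl
  have := Kpsi_nonneg (n := n) (R := R) (Λ := Λ) (κ := κ)
  unfold Cnest
  positivity

lemma nested (hn : 0 < n) (hR : 0 < R) (hΩ : IsOpen Ω) (hne : Ω.Nonempty) (hΩ' : IsOpen Ω') (hb' : Ω' ⊆ ball 0 R) (hs : Ω ⊆ Ω')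
    {U' : Euc n → Euc n} (hu : EF Ω u U) (hu' : EF Ω' u' U') (hΛ : lam1 Ω ≤ Λ) (hκ : 0 < κ)
    (hgap : ∀ q Q, MemH10 Ω q Q → ∫ x, q x * u x = 0 → (lam1 Ω + κ) * ∫ x, q x ^ 2 ≤ ∫ x, ‖Q x‖ ^ 2) :
    ∫ x, |u x - u' x| ≤ Cnest n R Λ κ * (tor Ω - tor Ω') := by
  have hb := hs.trans hb'
  have hl := lam1_mono hΩ hne hs
  have hlp' := lam1_pos hn hR hΩ' (hne.mono hs) hb'
  set l := lam1 Ω'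
  set M := Linf n Λ 0 1 with hM
  have hM0 : 0 ≤ M := Linf_nonneg le_rfl
  have hVB := VB_nonneg n R
  have hlΛ : l ≤ Λ := hl.trans hΛ
  have uM := u_bound hn hR hΩ hne hb hu hΛ
  have uM' := u_bound hn hR hΩ' (hne.mono hs) hb' hu' hlΛ
  have hF : MemLp (fun x => l * u' x) 2 volume := hu'.2.1.1.const_mul l
  obtain ⟨v, V, hv⟩ := sol_exists hn hR hb hF
  have hF0 : ∀ᵐ x ∂volume, 0 ≤ l * u' x := by filter_upwards [hu'.1] with x hx using mul_nonneg hlp'.le hx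
  have hv0 := sol_nonneg hn hR hb hv hF0
  have hvu := sol_le hn hR hΩ hb hs hF hF hv hu'.sol (eof fun _ => le_rfl) hu'.1
  obtain ⟨w, W, hw⟩ := sol_exists hn hR hb (oneBm R)
  obtain ⟨w', W', hw'⟩ := sol_exists hn hR hb' (oneBm R)
  have h1L : MemLp (fun x => (l * M) * oneB n R x) 2 volume := (oneBm R).const_mul _
  have hfu : ∀ᵐ x ∂volume, 0 ≤ l * M * oneB n R x - l * u' x := by
    filter_upwards [uM', hu'.2.1.ae_zero] with x a b
    by_cases hx : x ∈ ball (0 : Euc n) R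
    · have : oneB n R x = 1 := by simp [oneB, hx]
      rw [this]; nlinarith
    · have : oneB n R x = 0 := by simp [oneB, hx]
      rw [this, b fun h => hx (hb' h)]; simp
  have d1 := IsSol.sub h1L hF (hw.smul (l * M)) hv
  have d2 := IsSol.sub h1L hF (hw'.smul (l * M)) hu'.sol
  have hle := sol_le hn hR hΩ hb hs (h1L.sub hF) (h1L.sub hF) d1 d2 (eof fun _ => le_rfl) (sol_nonneg hn hR hb' d2 hfu)
  set g := fun x => u' x - v x with hg
  have iu' := hu'.2.1.integrable hb'
  have iu := hu.2.1.integrable hb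
  have iv := hv.1.integrable hb
  have ig : Integrable g volume := iu'.sub iv
  have hw1 := hw.1.integrable hb
  have hw1' := hw'.1.integrable hb'
  set d := tor Ω - tor Ω' with hd
  have hd0 : 0 ≤ d := sub_nonneg.2 (tor_mono hn hR hs hb')
  have hgd : ∫ x, g x ≤ Λ * M * 2 * d := by
    have : ∫ x, g x ≤ ∫ x, (l * M) * (w' x - w x) := by
      refine integral_mono_ae ig ((hw1'.sub hw1).const_mul _) ?_
      filter_upwards [hle] with x hx
      simp only [hg]; linarith
    rw [integral_const_mul, integral_sub hw1' hw1] at this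
    have e1 := tor_eq' hb hw
    have e2 := tor_eq' hb' hw'
    have e3 : (∫ x, w' x) - ∫ x, w x = 2 * d := by rw [hd, e1, e2]; ring
    rw [e3] at this
    refine this.trans ?_
    have : l * M * (2 * d) ≤ Λ * M * (2 * d) := by gcongr
    linarith
  have hg0 : ∀ᵐ x ∂volume, 0 ≤ g x := by filter_upwards [hvu] with x hx using sub_nonneg.2 hx
  set s := ∫ x, v x * u x with hsd
  have hs0 : 0 ≤ s := integral_nonneg_of_ae (by filter_upwards [hv0, hu.1] with x a b using mul_nonneg a b)
  have hy := hv.1.lin hu.2.1 (-s)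
  set y := fun x => v x + -s * u x with hyd
  have hyu : ∫ x, y x * u x = 0 := by
    have : ∀ x, y x * u x = v x * u x + -s * u x ^ 2 := fun x => by simp only [hyd]; ring
    simp_rw [this]
    rw [integral_add (lmi hv.1.1 hu.2.1.1) ((lri hu.2.1.1).const_mul _), integral_const_mul, hu.2.2.1]; simp [hsd]
  have hym := hy.1.aestronglyMeasurable
  obtain ⟨ψ, Ψ, hψ, hψu, heq, hψK⟩ := psi_exists hn hR hΩ hne hb hu hΛ hκ hlp'.le hl hgap (ξ := fun x => y x / |y x|)
    (hym.aemeasurable.div hym.norm.aemeasurable).aestronglyMeasurable (by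
      filter_upwards [hy.ae_zero] with x hx
      by_cases h : x ∈ ball (0 : Euc n) R
      · have : oneB n R x = 1 := by simp [oneB, h]
        rw [this, abs_div, abs_abs]; exact div_self_le_one _
      · rw [hx fun h' => h (hb h')]; simp [oneB_nonneg])
  have hK := Kpsi_nonneg (n := n) (R := R) (Λ := Λ) (κ := κ)
  set K := Kpsi n R Λ κ
  have hy1 : ∫ x, |y x| = l * ∫ x, g x * ψ x := by
    have h1 := heq y _ hy hyu
    have e0 : ∀ x, y x / |y x| * y x = |y x| := fun x => by
      rcases eq_or_ne (y x) 0 with h | h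
      · simp [h]
      · rw [div_mul_eq_mul_div, ← abs_mul_abs_self, mul_div_assoc, div_self (abs_ne_zero.2 h), mul_one]
    simp_rw [e0] at h1
    rw [← h1]
    have c1 : ∀ x, inner ℝ (Ψ x) (V x + -s • U x) = inner ℝ (V x) (Ψ x) + -s * inner ℝ (U x) (Ψ x) := fun x => by
      rw [inner_add_right, inner_smul_right, real_inner_comm, real_inner_comm (U x)]
    have c2 : ∀ x, l * u' x * ψ x = l * (u' x * ψ x) := fun x => by ring
    have c3 : ∀ x, lam1 Ω * u x * ψ x = lam1 Ω * (ψ x * u x) := fun x => by ring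
    have c4 : ∀ x, ψ x * y x = v x * ψ x + -s * (ψ x * u x) := fun x => by simp only [hyd]; ring
    have c5 : ∀ x, g x * ψ x = u' x * ψ x - v x * ψ x := fun x => by simp only [hg]; ring
    simp_rw [c1, c4, c5]
    rw [integral_add (lii hv.1.2.1 hψ.2.1) ((lii hu.2.1.2.1 hψ.2.1).const_mul _), integral_const_mul,
      integral_add (lmi hv.1.1 hψ.1) ((lmi hψ.1 hu.2.1.1).const_mul _), integral_const_mul,
      integral_sub (lmi hu'.2.1.1 hψ.1) (lmi hv.1.1 hψ.1), hv.2 ψ Ψ hψ, hu.sol.2 ψ Ψ hψ]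
    simp_rw [c2, c3]
    rw [integral_const_mul, integral_const_mul, hψu]; ring
  have hgψ : ∫ x, g x * ψ x ≤ K * ∫ x, g x := by
    rw [← integral_const_mul]
    refine integral_mono_ae ?_ (ig.const_mul K) ?_
    · exact lmi (hu'.2.1.1.sub hv.1.1) hψ.1
    · filter_upwards [hψK, hg0] with x a b
      have := (le_abs_self _).trans a
      change g x * ψ x ≤ K * g x
      rw [mul_comm K]
      exact mlL this b
  have gi0 : 0 ≤ ∫ x, g x := integral_nonneg_of_ae hg0
  have hy2 : ∫ x, |y x| ≤ Λ * K * ∫ x, g x := by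
    rw [hy1]
    calc l * ∫ x, g x * ψ x ≤ l * (K * ∫ x, g x) := mlL hgψ hlp'.le
      _ ≤ Λ * (K * ∫ x, g x) := by gcongr
      _ = _ := by ring
  have iy : Integrable y volume := hy.integrable hb
  have hz : ∫ x, |u' x - s * u x| ≤ (1 + Λ * K) * ∫ x, g x := by
    have : ∫ x, |u' x - s * u x| ≤ ∫ x, (g x + |y x|) := by
      refine integral_mono_ae (iu'.sub (iu.const_mul s)).abs (ig.add iy.abs) ?_
      filter_upwards [hg0] with x a
      change |u' x - s * u x| ≤ g x + |y x|
      have : u' x - s * u x = g x + y x := by simp only [hg, hyd]; ring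
      rw [this]
      refine (abs_add_le _ _).trans ?_
      rw [abs_of_nonneg a]
    rw [integral_add ig iy.abs] at this
    linarith
  set δ := ∫ x, |u' x - s * u x| with hδ
  have hδ0 : 0 ≤ δ := integral_nonneg fun _ => abs_nonneg _
  have h1s : |1 - s| ≤ M * δ := by
    have e : 1 - s ^ 2 = ∫ x, (u' x - s * u x) * (u' x + s * u x) := by
      have : ∀ x, (u' x - s * u x) * (u' x + s * u x) = u' x ^ 2 - s ^ 2 * u x ^ 2 := fun x => by ring
      simp_rw [this]
      rw [integral_sub (lri hu'.2.1.1) ((lri hu.2.1.1).const_mul _), integral_const_mul, hu.2.2.1, hu'.2.2.1, mul_one]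
    have e2 : |1 - s ^ 2| ≤ (M * (1 + s)) * δ := by
      rw [e, hδ, ← integral_const_mul]
      refine abs_integral_le_integral_abs.trans (integral_mono_of_nonneg (eof fun _ => abs_nonneg _)
        ((iu'.sub (iu.const_mul s)).abs.const_mul _) ?_)
      filter_upwards [uM, uM', hu.1, hu'.1] with x a b c e
      change |(u' x - s * u x) * (u' x + s * u x)| ≤ M * (1 + s) * |u' x - s * u x|
      rw [abs_mul, mul_comm, abs_of_nonneg (by positivity : 0 ≤ u' x + s * u x)]
      gcongr
      nlinarith
    have e3 : |1 - s ^ 2| = |1 - s| * (1 + s) := by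
      rw [show 1 - s ^ 2 = (1 - s) * (1 + s) by ring, abs_mul, abs_of_nonneg (by linarith : 0 ≤ 1 + s)]
    rw [e3] at e2
    have : |1 - s| * (1 + s) ≤ (M * δ) * (1 + s) := by linarith
    exact le_of_mul_le_mul_right this (by linarith)
  have hu1 : ∫ x, u x ≤ VB n R + 1 := by
    have h1 := l1_bound measurableSet_ball measure_ball_lt_top.ne hu.2.1.1 (by
      filter_upwards [hu.2.1.ae_zero] with x hx h using hx fun h' => h (hb h') : ∀ᵐ x ∂volume, x ∉ ball (0 : Euc n) R → u x = 0)
    rw [hu.2.2.1, mul_one] at h1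
    have h2 : ∫ x, u x ≤ ∫ x, |u x| := integral_mono iu iu.abs fun x => le_abs_self _
    change (∫ x, |u x|) ^ 2 ≤ VB n R at h1
    nlinarith [sq_nonneg ((∫ x, |u x|) - 1)]
  have hu2 : 0 ≤ ∫ x, u x := integral_nonneg_of_ae hu.1
  have hfin : ∫ x, |u x - u' x| ≤ δ + |1 - s| * ∫ x, u x := by
    have ia : Integrable (fun x => |u' x - s * u x|) volume := (iu'.sub (iu.const_mul s)).abs
    rw [hδ, ← integral_const_mul, ← integral_add ia (iu.const_mul _)]
    refine integral_mono_ae (iu.sub iu').abs (ia.add (iu.const_mul _)) ?_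
    filter_upwards [hu.1] with x hx
    change |u x - u' x| ≤ |u' x - s * u x| + |1 - s| * u x
    have : u x - u' x = -(u' x - s * u x) + (1 - s) * u x := by ring
    rw [this]
    refine (abs_add_le _ _).trans ?_
    rw [abs_neg, abs_mul, abs_of_nonneg hx]
  have k1 : |1 - s| * ∫ x, u x ≤ (M * δ) * (VB n R + 1) := mul_le_mul h1s hu1 hu2 (by positivity)
  have hΛ0 : 0 ≤ Λ := by linarith
  calc ∫ x, |u x - u' x| ≤ (1 + M * (VB n R + 1)) * δ := by linarith
    _ ≤ (1 + M * (VB n R + 1)) * ((1 + Λ * K) * (Λ * M * 2 * d)) := by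
      refine mlL (hz.trans (mlL hgd (by positivity))) (by positivity)
    _ = _ := by unfold Cnest; ring


lemma hnest {τ₀ : ℝ} (H : Par n R v vmax η 𝔗 Λ c₀ κ) (hτ : τ₀ ≤ κ) {h : Set (Euc n) → ℝ} (ha : Admissible n R vmax v η 𝔗 τ₀ h)
    (hΩ : Ω ∈ Hclass n R vmax) (hΩ' : Ω' ∈ Hclass n R vmax) (hs : Ω ⊆ Ω')
    (hE : baseE v η 𝔗 Ω ≤ Emin n R vmax v η 𝔗 + τ₀) (hE' : baseE v η 𝔗 Ω' ≤ Emin n R vmax v η 𝔗 + τ₀) :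
    |h Ω - h Ω'| ≤ ((volume Ω').toReal - (volume Ω).toReal) + Cnest n R Λ κ * (tor Ω - tor Ω') := by
  obtain ⟨u, U, hu, hu0⟩ := eig_exists H.hn H.hR hΩ.1 hΩ.2.1 hΩ.2.2.1
  obtain ⟨u', U', hu', hu0'⟩ := eig_exists H.hn H.hR hΩ'.1 hΩ'.2.1 hΩ'.2.2.1
  have h1 := EF.unique H hΩ (by linarith) hu hu0
  have h2 := EF.unique H hΩ' (by linarith) hu' hu0'
  have h3 := ha.2 Ω hΩ Ω' hΩ' hE hE' u u' h1 h2
  have h4 := nested H.hn H.hR hΩ.1 hΩ.2.1 hΩ'.1 hΩ'.2.2.1 hs hu hu' (H.hNM Ω hΩ (by linarith)).1 H.hκ (gap H hΩ (by linarith) hu)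
  have h5 : symmDiff Ω Ω' = Ω' \ Ω := by
    rw [symmDiff_of_le hs]
  rw [h5, measure_diff hs hΩ.1.measurableSet.nullMeasurableSet (vol_fin hΩ.2.2.1),
    ENNReal.toReal_sub_of_le (measure_mono hs) (vol_fin hΩ'.2.2.1)] at h3
  linarith

lemma par_exists (hn : 0 < n) (hR : 0 < R) (hv : 0 < v) (hvv : v < vmax) :
    ∃ η₀ : ℝ, 0 < η₀ ∧ ∀ η : ℝ, 0 < η → η ≤ η₀ → ∃ 𝔗₀ : ℝ, 0 < 𝔗₀ ∧ ∀ 𝔗 : ℝ, 0 < 𝔗 → 𝔗 < 𝔗₀ → ∃ Λ c₀ κ, Par n R v vmax η 𝔗 Λ c₀ κ := by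
  haveI : Nonempty (Fin n) := ⟨⟨0, hn⟩⟩
  obtain ⟨U, hU0, hU, hUv⟩ := Set.exists_isOpen_lt_of_lt ({0} : Set (Euc n)) (ENNReal.ofReal v) (μ := volume) (by simpa using hv)
  have hBm : U ∩ ball 0 R ∈ Hclass n R vmax ∧ (volume (U ∩ ball (0 : Euc n) R)).toReal ≤ v := by
    have h1 : (volume (U ∩ ball (0 : Euc n) R)).toReal ≤ v :=
      ENNReal.toReal_le_of_le_ofReal hv.le ((measure_mono inter_subset_left).trans hUv.le)
    exact ⟨⟨hU.inter isOpen_ball, ⟨0, hU0 rfl, mem_ball_self hR⟩, inter_subset_right, by linarith⟩, h1⟩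
  set B := U ∩ ball (0 : Euc n) R
  obtain ⟨hB, hBv⟩ := hBm
  have hl := lam1_pos hn hR hB.1 hB.2.1 hB.2.2.1
  set L := lam1 B
  have hCt : 0 ≤ Ctor n R := by unfold Ctor; positivity
  refine ⟨min 1 ((vmax - v) / (2 * (L + 2))), lt_min one_pos (div_pos (by linarith) (by linarith)), fun η hη hη' => ?_⟩
  have hη1 := hη'.trans (min_le_left _ _)
  have hη2 := hη'.trans (min_le_right _ _)
  rw [le_div_iff₀ (by linarith)] at hη2
  obtain ⟨c₀, hc, hfk⟩ := faber_krahn n (2 * ((L + 2 + v) + 1)) (by linarith)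
  have hηc : 0 < η * c₀ := mul_pos hη hc
  refine ⟨min 1 (η * c₀ / 4) / (Ctor n R + 1), div_pos (lt_min one_pos (by linarith)) (by linarith), fun 𝔗 hT hT' => ?_⟩
  rw [lt_div_iff₀ (by linarith), lt_min_iff] at hT'
  have hκ : 0 < min 1 (η * c₀ / 4) := lt_min one_pos (by linarith)
  refine ⟨L + 2 + v, c₀, min 1 (η * c₀ / 4), ⟨hn, hR, hv, hvv, hη, hη1, hT, hκ, min_le_left _ _, by linarith, hfk, ?_, ?_⟩⟩
  · have := min_le_right 1 (η * c₀ / 4)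
    linarith
  · intro Ω hΩ hE
    have h1 := Emin_le hn hR hη hη1 hT.le hv hB
    have h2 : baseE v η 𝔗 B ≤ L := by
      have a1 : 𝔗 * tor B ≤ 0 := mul_nonpos_of_nonneg_of_nonpos hT.le (tor_nonpos hn hR hB.2.2.1)
      have a2 : fpen v η (volume B).toReal ≤ 0 := by
        rw [fpen, if_pos hBv]; exact mul_nonpos_of_nonneg_of_nonpos hη.le (by linarith)
      change L + _ + _ ≤ L
      linarith
    have h3 := min_le_left 1 (η * c₀ / 4)
    obtain ⟨h4, h5⟩ := baseE_lower hn hR hη hη1 hT.le hv hΩ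
    refine ⟨by nlinarith, ?_⟩
    by_cases hvo : (volume Ω).toReal ≤ v
    · linarith
    rw [fpen, if_neg hvo] at h5
    have h6 : ((volume Ω).toReal - v) / η ≤ L + 2 := by linarith
    rw [div_le_iff₀ hη] at h6
    linarith

structure St (n : ℕ) (R v vmax η 𝔗 Λ c₀ κ τ₀ τ : ℝ) (h : Set (Euc n) → ℝ) : Prop where
  P : Par n R v vmax η 𝔗 Λ c₀ κ
  h1 : τ₀ ≤ κ
  h2 : τ₀ ≤ η / 2
  h3 : τ₀ * Cnest n R Λ κ ≤ 𝔗 / 2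
  hτ : 0 < τ
  hττ : τ < τ₀
  adm : Admissible n R vmax v η 𝔗 τ₀ h

section
variable {R v vmax η 𝔗 Λ c₀ κ τ₀ τ : ℝ} {h : Set (Euc n) → ℝ}

lemma vol_le {A B : Set (Euc n)} (hs : A ⊆ B) (hb : B ⊆ ball 0 R) : (volume A).toReal ≤ (volume B).toReal :=
  ENNReal.toReal_mono (vol_fin hb) (measure_mono hs)

lemma St.nest (S : St n R v vmax η 𝔗 Λ c₀ κ τ₀ τ h) (hΩ : Ω ∈ Hclass n R vmax) (hΩ' : Ω' ∈ Hclass n R vmax) (hs : Ω ⊆ Ω')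
    (hE : baseE v η 𝔗 Ω ≤ Emin n R vmax v η 𝔗 + τ₀) (hE' : baseE v η 𝔗 Ω' ≤ Emin n R vmax v η 𝔗 + τ₀) :
    τ * |h Ω - h Ω'| ≤ η / 2 * ((volume Ω').toReal - (volume Ω).toReal) + 𝔗 / 2 * (tor Ω - tor Ω') := by
  have h0 := hnest S.P S.h1 S.adm hΩ hΩ' hs hE hE'
  have a1 := vol_le hs hΩ'.2.2.1
  have a2 := tor_mono S.P.hn S.P.hR hs hΩ'.2.2.1
  have a3 := Cnest_nonneg (n := n) (R := R) (κ := κ) S.P.hΛ.le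
  have t1 := S.h2
  have t2 := S.h3
  have t3 := S.hττ
  have t4 := S.hτ
  calc τ * |h Ω - h Ω'| ≤ τ * (((volume Ω').toReal - (volume Ω).toReal) + Cnest n R Λ κ * (tor Ω - tor Ω')) := by gcongr
    _ = τ * ((volume Ω').toReal - (volume Ω).toReal) + (τ * Cnest n R Λ κ) * (tor Ω - tor Ω') := by ring
    _ ≤ _ := by
      refine add_le_add (mlR (by linarith) (by linarith)) (mlR ?_ (by linarith))
      exact (mlR t3.le a3).trans t2

lemma St.outward (S : St n R v vmax η 𝔗 Λ c₀ κ τ₀ τ h) (hΩ : Ω ∈ Hclass n R vmax) (hV : V ∈ Hclass n R vmax) (hs : Ω ⊆ V)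
    (hE : baseE v η 𝔗 Ω ≤ Emin n R vmax v η 𝔗 + τ₀) (hE' : baseE v η 𝔗 V ≤ Emin n R vmax v η 𝔗 + τ₀)
    (hF : mainE v η 𝔗 τ h Ω ≤ mainE v η 𝔗 τ h V + ε) :
    𝔗 / 2 * (tor Ω - tor V) ≤ (1 / η + η / 2) * ((volume V).toReal - (volume Ω).toReal) + ε := by
  have h0 := S.nest hΩ hV hs hE hE'
  have h1 := (fpen_diff (v := v) S.P.hη S.P.hη1 (vol_le hs hV.2.2.1)).2
  have h2 := lam1_mono hΩ.1 hΩ.2.1 hs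
  have h3 : τ * h V - τ * h Ω ≤ τ * |h Ω - h V| := by
    rw [← mul_sub]; exact mlL (by rw [abs_sub_comm]; exact le_abs_self _) S.hτ.le
  unfold mainE baseE at hF
  rw [div_eq_mul_one_div] at h1
  linarith

lemma St.inward (S : St n R v vmax η 𝔗 Λ c₀ κ τ₀ τ h) (hΩ : Ω ∈ Hclass n R vmax) (hV : V ∈ Hclass n R vmax) (hs : V ⊆ Ω)
    (hE : baseE v η 𝔗 Ω ≤ Emin n R vmax v η 𝔗 + τ₀) (hE' : baseE v η 𝔗 V ≤ Emin n R vmax v η 𝔗 + τ₀)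
    (hF : mainE v η 𝔗 τ h Ω ≤ mainE v η 𝔗 τ h V + ε) :
    η / 2 * ((volume Ω).toReal - (volume V).toReal) ≤ lam1 V - lam1 Ω + 2 * 𝔗 * (tor V - tor Ω) + ε := by
  have h0 := S.nest hV hΩ hs hE' hE
  have h1 := (fpen_diff (v := v) S.P.hη S.P.hη1 (vol_le hs hΩ.2.2.1)).1
  have h3 : τ * h V - τ * h Ω ≤ τ * |h V - h Ω| := by
    rw [← mul_sub]; exact mlL (le_abs_self _) S.hτ.le
  have a2 : 0 ≤ 𝔗 * (tor V - tor Ω) := mul_nonneg S.P.hT.le (by linarith [tor_mono S.P.hn S.P.hR hs hΩ.2.2.1])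
  unfold mainE baseE at hF
  linarith

/-- adding a small set keeps admissibility -/
lemma St.add (S : St n R v vmax η 𝔗 Λ c₀ κ τ₀ τ h) (hΩ : Ω ∈ Hclass n R vmax) (hVo : IsOpen V) (hVb : V ⊆ ball 0 R) (hs : Ω ⊆ V) {m : ℝ}
    (hE : baseE v η 𝔗 Ω ≤ Emin n R vmax v η 𝔗 + δ) (hδ : δ ≤ τ₀) (hv : (volume V).toReal - (volume Ω).toReal ≤ m) (hm1 : m ≤ (vmax - v) / 2) (hm2 : m ≤ η * (τ₀ - δ)) :
    V ∈ Hclass n R vmax ∧ baseE v η 𝔗 V ≤ Emin n R vmax v η 𝔗 + τ₀ := by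
  have h4 := S.h1
  have h0 := (S.P.hNM Ω hΩ (by linarith)).2
  refine ⟨⟨hVo, hΩ.2.1.mono hs, hVb, by linarith⟩, ?_⟩
  have h1 := (fpen_diff (v := v) S.P.hη S.P.hη1 (vol_le hs hVb)).2
  have h2 := lam1_mono hΩ.1 hΩ.2.1 hs
  have a2 : 𝔗 * tor V ≤ 𝔗 * tor Ω := mlL (tor_mono S.P.hn S.P.hR hs hVb) S.P.hT.le
  have h3 : ((volume V).toReal - (volume Ω).toReal) / η ≤ τ₀ - δ := by
    rw [div_le_iff₀ S.P.hη]; linarith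
  unfold baseE at hE ⊢
  linarith

end


lemma l2_le_lim {f g : ℕ → Euc n → ℝ} {g' : Euc n → ℝ} (hf : ∀ k, MemLp (f k) 2 volume) (hf' : MemLp f' 2 volume) (hg : ∀ k, MemLp (g k) 2 volume) (hg' : MemLp g' 2 volume)
    (h1 : Tendsto (fun k => ∫ x, (f k x - f' x) ^ 2) atTop (𝓝 0)) (h2 : Tendsto (fun k => ∫ x, (g k x - g' x) ^ 2) atTop (𝓝 0))
    (h : ∀ k, ∀ᵐ x ∂volume, f k x ≤ g k x) : ∀ᵐ x ∂volume, f' x ≤ g' x := by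
  have n1 : ∀ x : ℝ, ‖x‖ ^ 2 = x ^ 2 := fun x => by rw [Real.norm_eq_abs, sq_abs]
  obtain ⟨σ, hσ, a1⟩ := l2_ae_subseq hf hf' (by simpa only [n1] using h1)
  obtain ⟨ρ, hρ, a2⟩ := l2_ae_subseq (fun k => hg (σ k)) hg' (by simp only [n1]; exact h2.comp hσ.tendsto_atTop)
  filter_upwards [a1, a2, ae_all_iff.2 h] with x x1 x2 x3
  exact le_of_tendsto_of_tendsto' (x1.comp hρ.tendsto_atTop) x2 fun k => x3 _

structure SeqD (R v vmax η 𝔗 τ₀ τ : ℝ) (h : Set (Euc n) → ℝ) (δ : ℝ) (ε : ℕ → ℝ) (Ω : ℕ → Set (Euc n))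
    (wk uk : ℕ → Euc n → ℝ) (Wk Uk : ℕ → Euc n → Euc n) (w u : Euc n → ℝ) (W U : Euc n → Euc n) : Prop where
  hΩ : ∀ k, Ω k ∈ Hclass n R vmax
  hε : Tendsto ε atTop (𝓝 0)
  hδ : δ < τ₀
  hE : ∀ k, baseE v η 𝔗 (Ω k) ≤ Emin n R vmax v η 𝔗 + δ
  hF : ∀ k, ∀ V ∈ Hclass n R vmax, mainE v η 𝔗 τ h (Ω k) ≤ mainE v η 𝔗 τ h V + ε k
  hw : ∀ k, IsSol (Ω k) (oneB n R) (wk k) (Wk k)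
  hu : ∀ k, EF (Ω k) (uk k) (Uk k)
  w0 : MemH10 (ball 0 R) w W
  u0 : MemH10 (ball 0 R) u U
  w1 : Tendsto (fun k => ∫ x, (wk k x - w x) ^ 2) atTop (𝓝 0)
  u1 : Tendsto (fun k => ∫ x, (uk k x - u x) ^ 2) atTop (𝓝 0)
  w2 : ∀ G : Euc n → Euc n, MemLp G 2 volume → Tendsto (fun k => ∫ x, inner ℝ (Wk k x) (G x)) atTop (𝓝 (∫ x, inner ℝ (W x) (G x)))
  u2 : ∀ G : Euc n → Euc n, MemLp G 2 volume → Tendsto (fun k => ∫ x, inner ℝ (Uk k x) (G x)) atTop (𝓝 (∫ x, inner ℝ (U x) (G x)))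

section
variable {R v vmax η 𝔗 Λ c₀ κ τ₀ τ : ℝ} {h : Set (Euc n) → ℝ}

lemma seq_exists (S : St n R v vmax η 𝔗 Λ c₀ κ τ₀ τ h) (hne : (Hclass n R vmax).Nonempty) : ∃ δ ε Ω wk uk Wk Uk w u W U,
    SeqD R v vmax η 𝔗 τ₀ τ h δ ε Ω wk uk Wk Uk w u W U := by
  obtain ⟨hn, hR, hv, hvv, hη, hη1, hT, hκ, -, hΛ, -, -, hNM⟩ := S.P
  have hττ := S.hττ
  have hτ := S.hτ
  have hh := S.adm.1
  set F := mainE v η 𝔗 τ h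
  have hbdd : BddBelow (F '' Hclass n R vmax) := by
    refine ⟨Emin n R vmax v η 𝔗, ?_⟩
    rintro _ ⟨Ω, hΩ, rfl⟩
    have := Emin_le hn hR hη hη1 hT.le hv hΩ
    have h2 := mul_nonneg hτ.le (hh Ω hΩ).1
    change _ ≤ baseE v η 𝔗 Ω + τ * h Ω
    linarith
  have hd : 0 < (τ₀ - τ) / 2 := by linarith
  set ε : ℕ → ℝ := fun k => (τ₀ - τ) / 2 * (1 / ((k : ℝ) + 1))
  have hε0 : ∀ k, 0 < ε k := fun k => mul_pos hd Nat.one_div_pos_of_nat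
  have hε1 : ∀ k, ε k ≤ (τ₀ - τ) / 2 := fun k => by
    have : 1 / ((k : ℝ) + 1) ≤ 1 := by rw [div_le_one (by positivity)]; linarith [(Nat.cast_nonneg k : (0 : ℝ) ≤ k)]
    calc ε k ≤ (τ₀ - τ) / 2 * 1 := mlL this hd.le
      _ = _ := mul_one _
  have hεt : Tendsto ε atTop (𝓝 0) := by
    have := (tendsto_one_div_add_atTop_nhds_zero_nat (𝕜 := ℝ)).const_mul ((τ₀ - τ) / 2)
    rwa [mul_zero] at this
  have hch : ∀ k, ∃ Ω ∈ Hclass n R vmax, F Ω < sInf (F '' Hclass n R vmax) + ε k := by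
    intro k
    obtain ⟨_, ⟨Ω, hΩ, rfl⟩, h1⟩ := exists_lt_of_csInf_lt (s := F '' Hclass n R vmax) (hne.image _) (lt_add_of_pos_right _ (hε0 k))
    exact ⟨Ω, hΩ, h1⟩
  choose Ω hΩ hΩF using hch
  have hF : ∀ k, ∀ V ∈ Hclass n R vmax, F (Ω k) ≤ F V + ε k := fun k V hV => by
    have := csInf_le hbdd (mem_image_of_mem F hV)
    linarith [hΩF k]
  have hE : ∀ k, baseE v η 𝔗 (Ω k) ≤ Emin n R vmax v η 𝔗 + (τ + τ₀) / 2 := by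
    intro k
    have h1 : baseE v η 𝔗 (Ω k) - (τ + τ₀) / 2 ≤ Emin n R vmax v η 𝔗 := by
      refine le_csInf (hne.image _) ?_
      rintro _ ⟨V, hV, rfl⟩
      have h1 : baseE v η 𝔗 (Ω k) + τ * h (Ω k) ≤ baseE v η 𝔗 V + τ * h V + ε k := hF k V hV
      have h2 := mul_nonneg hτ.le (hh _ (hΩ k)).1
      have h3 := mlL (hh _ hV).2 hτ.le
      linarith [hε1 k]
    linarith
  have hl : ∀ k, lam1 (Ω k) ≤ Λ := fun k => (hNM _ (hΩ k) (by linarith [hE k, S.h1])).1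
  choose wk Wk hw using fun k => sol_exists hn hR (hΩ k).2.2.1 (oneBm (n := n) R)
  choose uk Uk hu _ using fun k => eig_exists hn hR (hΩ k).1 (hΩ k).2.1 (hΩ k).2.2.1
  obtain ⟨w, W, σ, hσ, w0, w1, w2⟩ := wsc hn hR Subset.rfl (fun k => (hw k).1.mono (hΩ k).2.2.1) (fun k => tor_w_bound hn hR (hΩ k).2.2.1 (hw k))
  obtain ⟨u, U, ρ, hρ, u0, u1, u2⟩ := wsc hn hR (M := Λ) Subset.rfl (fun k => (hu (σ k)).2.1.mono (hΩ (σ k)).2.2.1) (fun k => by rw [(hu (σ k)).2.2.2]; exact hl _)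
  have hρt := hρ.tendsto_atTop
  exact ⟨(τ + τ₀) / 2, fun k => ε (σ (ρ k)), fun k => Ω (σ (ρ k)), fun k => wk (σ (ρ k)), fun k => uk (σ (ρ k)), fun k => Wk (σ (ρ k)), fun k => Uk (σ (ρ k)), w, u, W, U,
    fun k => hΩ _, (hεt.comp hσ.tendsto_atTop).comp hρt, by linarith, fun k => hE _, fun k => hF _, fun k => hw _, fun k => hu _, w0, u0, w1.comp hρt, u1,
    fun G hG => (w2 G hG).comp hρt, u2⟩

variable {δ : ℝ} {ε : ℕ → ℝ} {Ω : ℕ → Set (Euc n)} {wk uk : ℕ → Euc n → ℝ} {Wk Uk : ℕ → Euc n → Euc n} {w u : Euc n → ℝ} {W U : Euc n → Euc n}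

lemma SeqD.lam (S : St n R v vmax η 𝔗 Λ c₀ κ τ₀ τ h) (D : SeqD R v vmax η 𝔗 τ₀ τ h δ ε Ω wk uk Wk Uk w u W U) (k : ℕ) : lam1 (Ω k) ≤ Λ :=
  (S.P.hNM _ (D.hΩ k) (by linarith [D.hE k, S.h1, D.hδ])).1

lemma SeqD.w_nonneg (S : St n R v vmax η 𝔗 Λ c₀ κ τ₀ τ h) (D : SeqD R v vmax η 𝔗 τ₀ τ h δ ε Ω wk uk Wk Uk w u W U) : ∀ᵐ x ∂volume, 0 ≤ w x :=
  l2_le_lim (f := fun _ _ => 0) (fun k => MemLp.zero) MemLp.zero (fun k => (D.hw k).1.1) D.w0.1 (by simp) D.w1 fun k =>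
    sol_nonneg S.P.hn S.P.hR (D.hΩ k).2.2.1 (D.hw k) (eof (oneB_nonneg R))

lemma SeqD.u_nonneg (D : SeqD R v vmax η 𝔗 τ₀ τ h δ ε Ω wk uk Wk Uk w u W U) : ∀ᵐ x ∂volume, 0 ≤ u x :=
  l2_le_lim (f := fun _ _ => 0) (fun k => MemLp.zero) MemLp.zero (fun k => (D.hu k).2.1.1) D.u0.1 (by simp) D.u1 fun k => (D.hu k).1

lemma SeqD.u_le_w (S : St n R v vmax η 𝔗 Λ c₀ κ τ₀ τ h) (D : SeqD R v vmax η 𝔗 τ₀ τ h δ ε Ω wk uk Wk Uk w u W U) :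
    ∀ᵐ x ∂volume, u x ≤ Λ * Linf n Λ 0 1 * w x := by
  refine l2_le_lim (fun k => (D.hu k).2.1.1) D.u0.1 (fun k => (D.hw k).1.1.const_mul _) (D.w0.1.const_mul _) D.u1 ?_ fun k =>
    _root_.u_le_w S.P.hn S.P.hR (D.hΩ k).1 (D.hΩ k).2.1 (D.hΩ k).2.2.1 (D.hu k) (D.hw k) (D.lam S k)
  have := D.w1.const_mul ((Λ * Linf n Λ 0 1) ^ 2)
  rw [mul_zero] at this
  refine this.congr fun k => ?_
  rw [← integral_const_mul]
  exact integral_congr_ae (eof fun x => by simp only []; ring)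

lemma SeqD.u_norm (D : SeqD R v vmax η 𝔗 τ₀ τ h δ ε Ω wk uk Wk Uk w u W U) : ∫ x, u x ^ 2 = 1 := by
  have h1 := l2_rsq_tendsto (fun k => (D.hu k).2.1.1) D.u0.1 D.u1
  refine tendsto_nhds_unique h1 ?_
  simp only [fun k => (D.hu k).2.2.1]
  exact tendsto_const_nhds

lemma SeqD.w_int (D : SeqD R v vmax η 𝔗 τ₀ τ h δ ε Ω wk uk Wk Uk w u W U) : Tendsto (fun k => ∫ x, wk k x) atTop (𝓝 (∫ x, w x)) := by
  have h1 := l2_mul_tendsto (fun k => (D.hw k).1.1) D.w0.1 (oneBm (n := n) R) D.w1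
  have e : ∀ z Z, MemH10 (ball 0 R) z Z → ∫ x, z x * oneB n R x = ∫ x, z x := fun z Z hz => by
    rw [← oneB_mul Subset.rfl hz]; simp only [mul_comm]
  rw [e w W D.w0] at h1
  exact h1.congr fun k => e _ _ ((D.hw k).1.mono (D.hΩ k).2.2.1)

/-- outward limit inequality -/
lemma SeqD.out (S : St n R v vmax η 𝔗 Λ c₀ κ τ₀ τ h) (D : SeqD R v vmax η 𝔗 τ₀ τ h δ ε Ω wk uk Wk Uk w u W U) {B : Set (Euc n)} (hB : IsOpen B) (hBb : B ⊆ ball 0 R)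
    (hm1 : (volume B).toReal ≤ (vmax - v) / 2) (hm2 : (volume B).toReal ≤ η * (τ₀ - δ)) (hψ : IsTestFun B ψ) (h0 : ∀ x, 0 ≤ ψ x) :
    (∫ x, inner ℝ (W x) (gradient ψ x)) ≤ (∫ x, ψ x) ∧
    (∫ x, ψ x) - (∫ x, inner ℝ (W x) (gradient ψ x)) ≤ 1 / 2 * (∫ x, ‖gradient ψ x‖ ^ 2) + 2 / 𝔗 * (1 / η + η / 2) * (volume B).toReal := by
  obtain ⟨hn, hR, hv, hvv, hη, hη1, hT, hκ, -, hΛ, -, -, hNM⟩ := S.P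
  have hG := hψ.memLp_gradient 2
  have hψm := hψ.memH10
  have lim := D.w2 _ hG
  constructor
  · refine le_of_tendsto' lim fun k => ?_
    have := subsol (D.hΩ k).1 (oneBm (n := n) R) (eof (oneB_nonneg R)) (D.hw k) (hψ.mono (subset_univ _)) h0
    rwa [oneB_mul Subset.rfl (hψm.mono hBb)] at this
  have key : ∀ k, (∫ x, ψ x) - (∫ x, inner ℝ (Wk k x) (gradient ψ x)) ≤ 1 / 2 * (∫ x, ‖gradient ψ x‖ ^ 2) + 2 / 𝔗 * (1 / η + η / 2) * (volume B).toReal + 2 / 𝔗 * ε k := by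
    intro k
    have hΩb := (D.hΩ k).2.2.1
    have hVb : Ω k ∪ B ⊆ ball 0 R := union_subset hΩb hBb
    have hvol : (volume (Ω k ∪ B)).toReal - (volume (Ω k)).toReal ≤ (volume B).toReal := by
      have := ENNReal.toReal_mono (ENNReal.add_ne_top.2 ⟨vol_fin hΩb, vol_fin hBb⟩) (measure_union_le (μ := volume) (Ω k) B)
      rw [ENNReal.toReal_add (vol_fin hΩb) (vol_fin hBb)] at this
      linarith
    obtain ⟨hV, hVE⟩ := S.add (D.hΩ k) ((D.hΩ k).1.union hB) hVb subset_union_left (D.hE k) D.hδ.le hvol hm1 hm2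
    have ho := S.outward (D.hΩ k) hV subset_union_left (by linarith [D.hE k, D.hδ]) hVE (D.hF k _ hV)
    have hmem := ((D.hw k).1.mono (subset_union_left (t := B))).lin (hψm.mono (subset_union_right (s := Ω k))) 1
    have ht := tor_le hn hR hVb hmem
    rw [l2_expand (D.hw k).1.2.1 hG 1] at ht
    have hi : ∫ x, (wk k x + 1 * ψ x) = (∫ x, wk k x) + ∫ x, ψ x := by
      simp only [one_mul]
      exact integral_add ((D.hw k).1.integrable hΩb) (hψm.integrable hBb)
    rw [hi] at ht
    have he := tor_eq hΩb (D.hw k)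
    have h1 : 𝔗 / 2 * (tor (Ω k) - tor (Ω k ∪ B)) ≤ (1 / η + η / 2) * (volume B).toReal + ε k := by
      refine ho.trans ?_
      gcongr
    have h2 : tor (Ω k) - tor (Ω k ∪ B) ≤ 2 / 𝔗 * (1 / η + η / 2) * (volume B).toReal + 2 / 𝔗 * ε k := by
      have := mlL h1 (by positivity : 0 ≤ 2 / 𝔗)
      have e1 : 2 / 𝔗 * (𝔗 / 2 * (tor (Ω k) - tor (Ω k ∪ B))) = tor (Ω k) - tor (Ω k ∪ B) := by field_simp
      rw [e1] at this
      linarith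
    linarith
  have l2 := ((D.hε.const_mul (2 / 𝔗)).const_add (1 / 2 * (∫ x, ‖gradient ψ x‖ ^ 2) + 2 / 𝔗 * (1 / η + η / 2) * (volume B).toReal))
  rw [mul_zero, add_zero] at l2
  exact le_of_tendsto_of_tendsto' (lim.const_sub _) l2 key

end


lemma rep {r₀ : ℝ} (hC : 0 ≤ C) (hr₀ : 0 < r₀) (hw : MemH10 univ w W) (hi : Integrable w volume)
    (hb : ∀ x r, 0 < r → r ≤ r₀ → ball x (2 * r) ⊆ ball (0 : Euc n) R → |mvD W x r| ≤ C) :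
    ∃ L : Euc n → ℝ, ContinuousOn L (ball 0 R) ∧ ∀ᵐ x ∂volume, x ∈ ball (0 : Euc n) R → L x = w x := by
  have lip : ∀ x s t, 0 < s → s ≤ t → t ≤ r₀ → ball x (2 * t) ⊆ ball (0 : Euc n) R → |mv w x s - mv w x t| ≤ C * t := by
    intro x s t hs hst ht hB
    have h1 := Convex.norm_image_sub_le_of_norm_hasDerivWithin_le (f := mv w x) (f' := mvD W x) (s := Icc s t) (x := t) (y := s) (C := C)
      (fun r hr => (mv_hasDeriv hw x (hs.trans_le hr.1)).hasDerivWithinAt)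
      (fun r hr => hb x r (hs.trans_le hr.1) (hr.2.trans ht) ((ball_subset_ball (by linarith [hr.2])).trans hB)) (convex_Icc _ _) (right_mem_Icc.2 hst) (left_mem_Icc.2 hst)
    rw [Real.norm_eq_abs, Real.norm_eq_abs, abs_sub_comm s t, abs_of_nonneg (by linarith : 0 ≤ t - s)] at h1
    exact h1.trans (mlL (by linarith) hC)
  set σ : ℕ → ℝ := fun k => 1 / ((k : ℝ) + 1)
  have hσ0 : ∀ k, 0 < σ k := fun k => Nat.one_div_pos_of_nat
  have hσt : Tendsto σ atTop (𝓝 0) := tendsto_one_div_add_atTop_nhds_zero_nat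
  have hσm : ∀ k l, k ≤ l → σ l ≤ σ k := fun k l h => Nat.one_div_le_one_div h
  set L : Euc n → ℝ := fun x => limUnder atTop (fun k => mv w x (σ k))
  have key : ∀ x k, σ k ≤ r₀ → ball x (2 * σ k) ⊆ ball (0 : Euc n) R → Tendsto (fun k => mv w x (σ k)) atTop (𝓝 (L x)) ∧ |mv w x (σ k) - L x| ≤ C * σ k := by
    intro x k hk hB
    have hc : CauchySeq fun l => mv w x (σ (l + k)) := by
      refine cauchySeq_of_le_tendsto_0' (fun l => C * σ (l + k)) (fun i j hij => ?_) ?_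
      · rw [dist_comm, Real.dist_eq]
        have hi := hσm k (i + k) (by omega)
        exact lip x _ _ (hσ0 _) (hσm _ _ (by omega)) (hi.trans hk) ((ball_subset_ball (by linarith)).trans hB)
      · simpa using ((tendsto_add_atTop_iff_nat k).2 hσt).const_mul C
    obtain ⟨l, hl⟩ := cauchySeq_tendsto_of_complete hc
    have hl' := (tendsto_add_atTop_iff_nat (f := fun k => mv w x (σ k)) k).1 hl
    have hL : L x = l := hl'.limUnder_eq
    rw [hL]
    refine ⟨hl', ?_⟩
    refine le_of_tendsto ((hl'.const_sub (mv w x (σ k))).abs) (eventually_atTop.2 ⟨k, fun j hj => ?_⟩)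
    rw [abs_sub_comm]
    exact lip x _ _ (hσ0 _) (hσm _ _ hj) hk hB
  have hsub : ∀ x y : Euc n, ∀ ρ s, ρ = R - ‖x‖ → dist y x < ρ / 2 → s ≤ ρ / 4 → ball y (2 * s) ⊆ ball (0 : Euc n) R := by
    intro x y ρ s hρ hy hs z hz
    rw [mem_ball] at hz ⊢
    have := dist_triangle4 z y x 0
    rw [dist_zero_right x] at this
    linarith
  have hev : ∀ c : ℝ, 0 < c → ∀ᶠ k in atTop, σ k < c := fun c hc => hσt.eventually (gt_mem_nhds hc)
  have hlu : TendstoLocallyUniformlyOn (fun k x => mv w x (σ k)) L atTop (ball (0 : Euc n) R) := by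
    rw [Metric.tendstoLocallyUniformlyOn_iff]
    intro ε hε x hx
    rw [mem_ball, dist_zero_right] at hx
    have hρ : 0 < R - ‖x‖ := by linarith
    refine ⟨ball x ((R - ‖x‖) / 2), mem_nhdsWithin_of_mem_nhds (ball_mem_nhds _ (by linarith)), ?_⟩
    filter_upwards [hev _ hr₀, hev ((R - ‖x‖) / 4) (by linarith), hev (ε / (C + 1)) (by positivity)] with k k1 k2 k3 y hy
    have h1 := (key y k k1.le (hsub x y _ _ rfl hy k2.le)).2
    rw [dist_comm, Real.dist_eq]
    rw [lt_div_iff₀ (by linarith)] at k3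
    nlinarith [hσ0 k]
  refine ⟨fun x => L x / cphi n, ?_, ?_⟩
  · exact (hlu.continuousOn (Frequently.of_forall fun k => (mv_cont hi (hσ0 k)).continuousOn)).div_const _
  · filter_upwards [mv_lebesgue hi] with x hx hxR
    rw [mem_ball, dist_zero_right] at hxR
    have h1 : Tendsto (fun k => mv w x (σ k)) atTop (𝓝 (cphi n * w x)) :=
      hx.comp (tendsto_nhdsWithin_iff.2 ⟨hσt, eof hσ0⟩)
    obtain ⟨k, k1, k2⟩ := ((hev _ hr₀).and (hev ((R - ‖x‖) / 4) (by linarith))).exists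
    have h2 := (key x k k1.le (hsub x x _ _ rfl (by rw [dist_self]; linarith) k2.le)).1
    rw [tendsto_nhds_unique h2 h1]
    field_simp [(cphi_pos (n := n)).ne']

section
variable {R v vmax η 𝔗 Λ c₀ κ τ₀ τ : ℝ} {h : Set (Euc n) → ℝ}
variable {δ : ℝ} {ε : ℕ → ℝ} {Ω : ℕ → Set (Euc n)} {wk uk : ℕ → Euc n → ℝ} {Wk Uk : ℕ → Euc n → Euc n} {w u : Euc n → ℝ} {W U : Euc n → Euc n}

lemma vol_ball (hn : 0 < n) (x : Euc n) (hr : 0 < r) : (volume (ball x r)).toReal = r ^ n * VB n 1 := by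
  haveI : Nonempty (Fin n) := ⟨⟨0, hn⟩⟩
  rw [Measure.addHaar_ball volume x hr.le, ENNReal.toReal_mul, ENNReal.toReal_ofReal (by positivity), finrank_euclideanSpace, Fintype.card_fin]
  rfl

lemma SeqD.deriv_bound (S : St n R v vmax η 𝔗 Λ c₀ κ τ₀ τ h) (D : SeqD R v vmax η 𝔗 τ₀ τ h δ ε Ω wk uk Wk Uk w u W U) :
    ∃ C r₀, 0 ≤ C ∧ 0 < r₀ ∧ ∀ x r, 0 < r → r ≤ r₀ → ball x (2 * r) ⊆ ball (0 : Euc n) R → |mvD W x r| ≤ C := by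
  obtain ⟨hn, hR, hv, hvv, hη, hη1, hT, hκ, -, hΛ, -, -, hNM⟩ := S.P
  have hV1 := VB_nonneg n 1
  set Z := ∫ p : Euc n, zet p
  have hZ : 0 ≤ Z := integral_nonneg zet_nonneg
  set P := ∫ p : Euc n, ‖phv p‖ ^ 2
  have hP : 0 ≤ P := integral_nonneg fun p => by positivity
  set K := 2 / 𝔗 * (1 / η + η / 2)
  have hK : 0 ≤ K := by positivity
  have hδ := D.hδ
  have hm : 0 < min ((vmax - v) / 2) (η * (τ₀ - δ)) := lt_min (by linarith) (mul_pos hη (by linarith))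
  set m := min ((vmax - v) / 2) (η * (τ₀ - δ)) with hmd
  refine ⟨Z + P + K * (2 ^ n * VB n 1), min (1 / 2) (m / (2 * (VB n 1 + 1))), by positivity, lt_min (by norm_num) (div_pos hm (by linarith)), fun x r hr hr' hB => ?_⟩
  have r1 := hr'.trans (min_le_left _ _)
  have r2 := hr'.trans (min_le_right _ _)
  rw [le_div_iff₀ (by linarith)] at r2
  have hvB : (volume (ball x (2 * r))).toReal ≤ m := by
    rw [vol_ball hn x (by linarith)]
    have : (2 * r) ^ n ≤ 2 * r := pow_le_of_le_one (by linarith) (by linarith) hn.ne'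
    calc (2 * r) ^ n * VB n 1 ≤ 2 * r * VB n 1 := mlR this hV1
      _ ≤ m := by linarith
  have ht : IsTestFun (ball x (2 * r)) (fun q => r * zets x r q) := (zets_test x hr (by linarith)).const_mul r
  obtain ⟨o1, o2⟩ := D.out S isOpen_ball hB (hvB.trans (min_le_left _ _)) (hvB.trans (min_le_right _ _)) ht (fun q => mul_nonneg hr.le (zet_nonneg _))
  rw [gradient_const_mul'] at o1 o2
  have e1 : ∫ q, zets x r q = r ^ n * Z := by
    have := cv' x hr (fun _ p => zet p)
    rw [show (∫ q, zets x r q) = ∫ q, zet (r⁻¹ • (q - x)) from rfl]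
    have hrn : r ^ n ≠ 0 := by positivity
    rw [show Z = _ from this]
    field_simp
  have e2 : ∫ q, ‖r • gradient (zets x r) q‖ ^ 2 = r ^ n * P := by
    have := cv' x hr (fun _ p => ‖phv p‖ ^ 2)
    have hrn : r ^ n ≠ 0 := by positivity
    rw [show P = _ from this, ← mul_assoc, mul_inv_cancel₀ hrn, one_mul]
    refine integral_congr_ae (eof fun q => ?_)
    simp only []
    rw [(zets_grad x r q).gradient, smul_smul, mul_neg, mul_inv_cancel₀ hr.ne', neg_one_smul, norm_neg]
  simp only [inner_smul_right, integral_const_mul, e1] at o1 o2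
  rw [e2, vol_ball hn x (by linarith), mul_pow] at o2
  rw [mvD_eq W x hr]
  set I := ∫ q, inner ℝ (W q) (gradient (zets x r) q)
  have hrn : 0 < r ^ n := by positivity
  have o1' : (r * (r ^ n)⁻¹) * I ≤ Z := by
    have : r * I ≤ r ^ n * Z := o1.trans (by nlinarith [mul_nonneg hrn.le hZ])
    calc (r * (r ^ n)⁻¹) * I = (r ^ n)⁻¹ * (r * I) := by ring
      _ ≤ (r ^ n)⁻¹ * (r ^ n * Z) := mlL this (by positivity)
      _ = Z := by field_simp
  have o2' : - (r * (r ^ n)⁻¹ * I) ≤ P + K * (2 ^ n * VB n 1) := by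
    have h3 : 0 ≤ r * (r ^ n * Z) := by positivity
    have h4 : 0 ≤ r ^ n * P := by positivity
    change _ ≤ 1 / 2 * (r ^ n * P) + K * (2 ^ n * r ^ n * VB n 1) at o2
    have : - (r * I) ≤ r ^ n * (P + K * (2 ^ n * VB n 1)) := by linarith
    calc - ((r * (r ^ n)⁻¹) * I) = (r ^ n)⁻¹ * (- (r * I)) := by ring
      _ ≤ (r ^ n)⁻¹ * (r ^ n * (P + K * (2 ^ n * VB n 1))) := mlL this (by positivity)
      _ = _ := by field_simp
  have h5 : 0 ≤ K * (2 ^ n * VB n 1) := by positivity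
  rw [abs_le]
  constructor <;> linarith

/-- membership of a function with a continuous representative in its positivity set -/
lemma mem_pos (hw : MemH10 (ball 0 R) w W) (h0 : ∀ᵐ x ∂volume, 0 ≤ w x) (hL : ContinuousOn L (ball 0 R))
    (hLw : ∀ᵐ x ∂volume, x ∈ ball (0 : Euc n) R → L x = w x) :
    IsOpen {x ∈ ball (0 : Euc n) R | 0 < L x} ∧ MemH10 {x ∈ ball (0 : Euc n) R | 0 < L x} w W := by
  have hO : IsOpen {x ∈ ball (0 : Euc n) R | 0 < L x} := hL.isOpen_inter_preimage isOpen_ball isOpen_Ioi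
  refine ⟨hO, ?_⟩
  obtain ⟨φ, hφ, c1, c2⟩ := hw.2.2
  have cb : ∀ k : ℕ, 0 ≤ 1 / ((k : ℝ) + 1) := fun k => (Nat.one_div_pos_of_nat).le
  have hm := fun k => posPart_mem (min_mem hw (hφ k).memH10) (cb k)
  have hG2 := l2_sq_tendsto (fun k => (hφ k).memLp_gradient 2) hw.2.1 c2
  obtain ⟨M, hM⟩ := hG2.bddAbove_range
  refine weak_cl' (M := M + ∫ x, ‖W x‖ ^ 2) (fun k => cpt_mem (K := tsupport (φ k) ∩ L ⁻¹' (Ici (1 / ((k : ℝ) + 1)))) ?_ hO ?_ ((hm k).mono (subset_univ _)) ?_) (fun k => ?_) (hw.mono (subset_univ _)) ?_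
  · exact (hφ k).2.1.isCompact.of_isClosed_subset ((hL.mono (hφ k).2.2).preimage_isClosed_of_isClosed (isClosed_tsupport _) isClosed_Ici) inter_subset_left
  · rintro x ⟨hx, hx'⟩
    exact ⟨(hφ k).2.2 hx, (Nat.one_div_pos_of_nat (n := k)).trans_le hx'⟩
  · filter_upwards [hLw] with x hx hxK
    apply max_eq_right
    by_cases ht : x ∈ tsupport (φ k)
    · have h1 : ¬ (1 / ((k : ℝ) + 1) ≤ L x) := fun h => hxK ⟨ht, h⟩
      rw [hx ((hφ k).2.2 ht)] at h1
      linarith [min_le_left (w x) (φ k x)]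
    · have := image_eq_zero_of_notMem_tsupport ht
      linarith [min_le_right (w x) (φ k x), cb k]
  · refine (trunc_le _ (min_mem hw (hφ k).memH10).2.1).trans ?_
    have i1 := lsi ((hφ k).memLp_gradient 2)
    have i2 := lsi hw.2.1
    have h1 : ∫ x, ‖if φ k x < w x then gradient (φ k) x else W x‖ ^ 2 ≤ ∫ x, (‖gradient (φ k) x‖ ^ 2 + ‖W x‖ ^ 2) := by
      refine integral_mono_of_nonneg (eof fun x => by positivity) (i1.add i2) (eof fun x => ?_)
      simp only []
      split_ifs <;> nlinarith [sq_nonneg ‖gradient (φ k) x‖, sq_nonneg ‖W x‖]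
    rw [integral_add i1 i2] at h1
    have h2 := hM ⟨k, rfl⟩
    simp only [] at h2
    linarith
  · have hlim : Tendsto (fun k : ℕ => 2 * (∫ x, (φ k x - w x) ^ 2) + 2 * ((1 / ((k : ℝ) + 1)) ^ 2 * VB n R)) atTop (𝓝 0) := by
      have h1 : Tendsto (fun k : ℕ => 1 / ((k : ℝ) + 1)) atTop (𝓝 0) := tendsto_one_div_add_atTop_nhds_zero_nat
      simpa using (c1.const_mul 2).add (((h1.pow 2).mul_const (VB n R)).const_mul 2)
    refine squeeze_zero (fun k => integral_nonneg fun x => sq_nonneg _) (fun k => ?_) hlim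
    have i1 : Integrable (fun x => 2 * (φ k x - w x) ^ 2) volume := (lri (((hφ k).memLp 2).sub hw.1)).const_mul 2
    have i2 : Integrable (fun x => 2 * ((1 / ((k : ℝ) + 1)) ^ 2 * oneB n R x ^ 2)) volume := ((lri (oneBm R)).const_mul _).const_mul 2
    rw [← oneB_sq, ← integral_const_mul, ← integral_const_mul, ← integral_const_mul, ← integral_add i1 i2]
    refine integral_mono_of_nonneg (eof fun x => sq_nonneg _) (i1.add i2) ?_
    filter_upwards [h0, hw.ae_zero] with x hx hx0
    have hc := cb k
    by_cases hxb : x ∈ ball (0 : Euc n) R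
    · have : oneB n R x = 1 := by simp [oneB, indicator_of_mem hxb]
      rw [this]
      have habs : |max (min (w x) (φ k x) - 1 / ((k : ℝ) + 1)) 0 - w x| ≤ |φ k x - w x| + 1 / ((k : ℝ) + 1) := by
        rcases max_cases (min (w x) (φ k x) - 1 / ((k : ℝ) + 1)) 0 with ⟨a, b⟩ | ⟨a, b⟩ <;>
        rcases min_cases (w x) (φ k x) with ⟨d, e⟩ | ⟨d, e⟩ <;> rw [a] <;> (try rw [d]) <;> rw [d] at b <;>
        rcases abs_cases (φ k x - w x) with ⟨f, g⟩ | ⟨f, g⟩ <;> rw [f, abs_le] <;> constructor <;> linarith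
      have := pow_le_pow_left₀ (abs_nonneg _) habs 2
      rw [sq_abs] at this
      nlinarith [sq_nonneg (|φ k x - w x| - 1 / ((k : ℝ) + 1)), sq_abs (φ k x - w x)]
    · have hw0 := hx0 hxb
      have hφ0 : φ k x = 0 := image_eq_zero_of_notMem_tsupport fun h => hxb ((hφ k).2.2 h)
      rw [hw0, hφ0, min_self, max_eq_right (by linarith)]
      simp only [sub_zero]
      have := sq_nonneg (oneB n R x)
      have := sq_nonneg (1 / ((k : ℝ) + 1))
      nlinarith

end


lemma inset (hn : 0 < n) (hR : 0 < R) (hb : Ω ⊆ ball 0 R)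
    (hw : IsSol Ω (oneB n R) w W) (hu : EF Ω u U) (hΛ : lam1 Ω ≤ Λ) (ht : 0 < t) (ht1 : t ≤ 1) (ht2 : t * (2 + 8 * VB n R) ≤ 1 / 2) :
    ∃ O₁ O₂ φ₁ φ₂, IsOpen (O₁ ∪ O₂) ∧ (O₁ ∪ O₂).Nonempty ∧ O₁ ∪ O₂ ⊆ Ω ∧
      lam1 (O₁ ∪ O₂) ≤ lam1 Ω + t * (1 + 2 * (2 + 8 * VB n R) * (Λ + 1)) ∧ tor (O₁ ∪ O₂) ≤ tor Ω + t * (2 + VB n R * (1 + 8 * VB n R)) ∧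
      MemLp φ₁ 2 volume ∧ MemLp φ₂ 2 volume ∧ (∫ x, (φ₁ x - w x) ^ 2 ≤ t ^ 3) ∧ (∫ x, (φ₂ x - u x) ^ 2 ≤ t ^ 3) ∧ (∀ x ∈ O₁, t < φ₁ x) ∧ ∀ x ∈ O₂, t < φ₂ x := by
  have hV := VB_nonneg n R
  have t3 : t ^ 3 ≤ t ^ 2 := pow_le_pow_of_le_one ht.le ht1 (by norm_num)
  have t2 : t ^ 2 ≤ t := by nlinarith
  have t0 : 0 < t ^ 3 := by positivity
  have w0 := sol_nonneg hn hR hb hw (eof (oneB_nonneg R))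
  obtain ⟨O₁, o1, s1, a, A, φ₁, ha, ha1, ha2, hφ₁, p1, q1⟩ := inner_approx hb hw.1 w0 ht t0
  obtain ⟨O₂, o2, s2, b, B, φ₂, hb', hb1, hb2, hφ₂, p2, q2⟩ := inner_approx hb hu.2.1 hu.1 ht t0
  change _ ≤ t ^ 3 + 8 * t ^ 2 * VB n R at ha2 hb2
  have hs := union_subset s1 s2
  have l1 := l2_close hb'.1 hu.2.1.1 ht (δ := t ^ 2 * (1 + 8 * VB n R)) (hb2.trans (by linarith))
  have e1 : t ^ 2 * (1 + 8 * VB n R) / t = t * (1 + 8 * VB n R) := by field_simp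
  rw [hu.2.2.1, e1] at l1
  have l2 : 1 - t * (2 + 8 * VB n R) ≤ ∫ x, b x ^ 2 := by linarith
  have hne : (O₁ ∪ O₂).Nonempty := (nonempty_of_mem hb' (by linarith)).mono subset_union_right
  refine ⟨O₁, O₂, φ₁, φ₂, o1.union o2, hne, hs, ?_, ?_, hφ₁, hφ₂, p1, p2, q1, q2⟩
  · have h1 := lam1_le (hb'.mono (subset_union_right (s := O₁)))
    rw [hu.2.2.2] at hb1
    have h2 := lam1_pos hn hR (o1.union o2) hne (hs.trans hb)
    set l := lam1 (O₁ ∪ O₂)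
    have h3 := mlL l2 h2.le
    have h4 : l ≤ 2 * (Λ + 1) := by
      have := mlL ht2 h2.le
      linarith
    have h5 := mlR h4 (by positivity : 0 ≤ t * (2 + 8 * VB n R))
    linarith
  · have h1 := tor_le hn hR (hs.trans hb) (ha.mono (subset_union_left (t := O₂)))
    have h2 := tor_eq hb hw
    have ia := ha.integrable (s1.trans hb)
    have iw := hw.1.integrable hb
    have hm : MemLp (fun x => a x - w x) 2 volume := ha.1.sub hw.1.1
    have h3 := l1_bound measurableSet_ball measure_ball_lt_top.ne hm (by
      filter_upwards [(ha.mono (s1.trans hb)).ae_zero, (hw.1.mono hb).ae_zero] with x x1 x2 x3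
      rw [x1 x3, x2 x3, sub_zero] : ∀ᵐ x ∂volume, x ∉ ball (0 : Euc n) R → a x - w x = 0)
    change _ ≤ VB n R * _ at h3
    have h4 : ∫ x, |a x - w x| ≤ t * (1 + VB n R * (1 + 8 * VB n R)) := by
      refine abs_le_of_sq_le_sq' ?_ (by positivity) |>.2
      have h5 : VB n R * ∫ x, (a x - w x) ^ 2 ≤ VB n R * (t ^ 2 * (1 + 8 * VB n R)) := mlL (ha2.trans (by linarith)) hV
      have h6 : 0 ≤ VB n R * (1 + 8 * VB n R) := by positivity
      rw [mul_pow]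
      refine h3.trans (h5.trans ?_)
      rw [mul_left_comm]
      exact mlL (by nlinarith) (by positivity)
    have h7 : (∫ x, w x) - (∫ x, a x) ≤ ∫ x, |a x - w x| := by
      rw [← integral_sub iw ia]
      exact integral_mono (iw.sub ia) (ia.sub iw).abs fun x => by
        change w x - a x ≤ |a x - w x|
        rw [abs_sub_comm]; exact le_abs_self _
    linarith

section
variable {R v vmax η 𝔗 Λ c₀ κ τ₀ τ : ℝ} {h : Set (Euc n) → ℝ}
variable {δ : ℝ} {ε : ℕ → ℝ} {Ω : ℕ → Set (Euc n)} {wk uk : ℕ → Euc n → ℝ} {Wk Uk : ℕ → Euc n → Euc n} {w u : Euc n → ℝ} {W U : Euc n → Euc n}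

lemma markov' {q : Euc n → ℝ} (hφ : MemLp φ 2 volume) (hp : MemLp p 2 volume) (hq : MemLp q 2 volume) (hp0 : ∀ᵐ x ∂volume, 0 ≤ p x) (ht : 0 < t)
    (h : ∫ x, (φ x - q x) ^ 2 ≤ t ^ 3) (h' : ∫ x, (q x - p x) ^ 2 ≤ t ^ 3) (hO : ∀ x ∈ O, t < φ x) : volume (O \ {x | 0 < p x}) ≤ ENNReal.ofReal (4 * t) := by
  have h1 := l2_triangle (hφ.sub hq) (hq.sub hp)
  simp only [Pi.sub_apply, sub_add_sub_cancel, Real.norm_eq_abs, sq_abs] at h1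
  have h2 := markov hφ hp hp0 ht (δ := 4 * t ^ 3) (by linarith) hO
  rwa [show 4 * t ^ 3 / t ^ 2 = 4 * t by field_simp] at h2

lemma SeqD.inner (S : St n R v vmax η 𝔗 Λ c₀ κ τ₀ τ h) (D : SeqD R v vmax η 𝔗 τ₀ τ h δ ε Ω wk uk Wk Uk w u W U) (hρ : 0 < ρ) :
    ∀ᶠ k in atTop, (volume (Ω k \ {x | 0 < w x})).toReal ≤ ρ := by
  obtain ⟨hn, hR, hv, hvv, hη, hη1, hT, hκ, -, hΛ, -, -, hNM⟩ := S.P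
  have hV := VB_nonneg n R
  set C₁ := 1 + 2 * (2 + 8 * VB n R) * (Λ + 1)
  set C₂ := 2 + VB n R * (1 + 8 * VB n R)
  have hC₁ : 0 ≤ C₁ := by positivity
  have hC₂ : 0 ≤ C₂ := by positivity
  have hδ := D.hδ
  set G := C₁ + 2 * 𝔗 * C₂ + 1
  have hG : 0 < G := by positivity
  obtain ⟨t, ht, ht1, ht2, ht3, ht4⟩ : ∃ t : ℝ, 0 < t ∧ t ≤ 1 ∧ t * (2 + 8 * VB n R) ≤ 1 / 2 ∧ t * G ≤ τ₀ - δ ∧ t * (2 / η * G + 8) ≤ ρ := by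
    have hpos : 0 < 2 / η * G + 8 := by positivity
    refine ⟨min (min 1 ((1 / 2) / (2 + 8 * VB n R))) (min ((τ₀ - δ) / G) (ρ / (2 / η * G + 8))), ?_, ?_, ?_, ?_, ?_⟩
    · refine lt_min (lt_min one_pos (by positivity)) (lt_min (div_pos (by linarith) hG) (by positivity))
    · exact (min_le_left _ _).trans (min_le_left _ _)
    · rw [← le_div_iff₀ (by positivity)]; exact (min_le_left _ _).trans (min_le_right _ _)
    · rw [← le_div_iff₀ hG]; exact (min_le_right _ _).trans (min_le_left _ _)
    · rw [← le_div_iff₀ hpos]; exact (min_le_right _ _).trans (min_le_right _ _)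
  have t0 : 0 < t ^ 3 := by positivity
  have hw0 := D.w_nonneg S
  filter_upwards [D.w1.eventually (gt_mem_nhds t0), D.u1.eventually (gt_mem_nhds t0), D.hε.eventually (gt_mem_nhds ht)] with k k1 k2 k3
  have hΩb := (D.hΩ k).2.2.1
  obtain ⟨O₁, O₂, φ₁, φ₂, hO, hne, hs, hl, htor, hφ₁, hφ₂, p1, p2, q1, q2⟩ := inset hn hR hΩb (D.hw k) (D.hu k) (D.lam S k) ht ht1 ht2
  set O := O₁ ∪ O₂ with hOd
  have hvol := vol_le hs hΩb
  have hOH : O ∈ Hclass n R vmax := ⟨hO, hne, hs.trans hΩb, hvol.trans (D.hΩ k).2.2.2⟩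
  have hT1 : 𝔗 * tor O ≤ 𝔗 * tor (Ω k) + 𝔗 * (t * C₂) := by rw [← mul_add]; exact mlL htor hT.le
  have hOE : baseE v η 𝔗 O ≤ Emin n R vmax v η 𝔗 + τ₀ := by
    have h1 := (fpen_diff (v := v) hη hη1 hvol).1
    have h2 : 0 ≤ η * ((volume (Ω k)).toReal - (volume O).toReal) := mul_nonneg hη.le (by linarith)
    have h3 := D.hE k
    have h4 : 0 ≤ 𝔗 * (t * C₂) := by positivity
    unfold baseE at h3 ⊢
    linarith
  have hin := S.inward (D.hΩ k) hOH hs (by linarith [D.hE k]) hOE (D.hF k O hOH)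
  have hd : (volume (Ω k)).toReal - (volume O).toReal ≤ t * (2 / η * G) := by
    have h1 : η / 2 * ((volume (Ω k)).toReal - (volume O).toReal) ≤ t * G := by linarith
    have := mlL h1 (by positivity : 0 ≤ 2 / η)
    have e1 : 2 / η * (η / 2 * ((volume (Ω k)).toReal - (volume O).toReal)) = (volume (Ω k)).toReal - (volume O).toReal := by field_simp
    rw [e1] at this
    linarith
  have m1 := markov' hφ₁ D.w0.1 (D.hw k).1.1 hw0 ht p1 k1.le q1
  have m2 := markov' hφ₂ D.u0.1 (D.hu k).2.1.1 D.u_nonneg ht p2 k2.le q2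
  have m3 : volume (O₂ \ {x | 0 < w x}) ≤ ENNReal.ofReal (4 * t) := by
    refine (measure_mono_ae ?_).trans m2
    filter_upwards [D.u_le_w S, hw0] with x x1 x2 x3
    refine ⟨x3.1, fun hx => x3.2 ?_⟩
    change 0 < w x
    refine lt_of_le_of_ne x2 fun he => ?_
    rw [← he, mul_zero] at x1
    exact absurd hx (not_lt.2 x1)
  have m4 : volume (Ω k \ {x | 0 < w x}) ≤ volume (Ω k \ O) + (ENNReal.ofReal (4 * t) + ENNReal.ofReal (4 * t)) := by
    refine (measure_mono (?_ : _ ⊆ (Ω k \ O) ∪ ((O₁ \ {x | 0 < w x}) ∪ (O₂ \ {x | 0 < w x})))).trans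
      ((measure_union_le _ _).trans (add_le_add le_rfl ((measure_union_le _ _).trans (add_le_add m1 m3))))
    rintro x ⟨hx, hx'⟩
    by_cases h1 : x ∈ O₁
    · exact Or.inr (Or.inl ⟨h1, hx'⟩)
    by_cases h2 : x ∈ O₂
    · exact Or.inr (Or.inr ⟨h2, hx'⟩)
    exact Or.inl ⟨hx, fun h => h.elim h1 h2⟩
  rw [measure_diff hs hO.measurableSet.nullMeasurableSet (vol_fin (hs.trans hΩb)), ← ENNReal.ofReal_add (by positivity) (by positivity)] at m4
  have m5 := ENNReal.toReal_mono (ENNReal.add_ne_top.2 ⟨ENNReal.sub_ne_top (vol_fin hΩb), ENNReal.ofReal_ne_top⟩) m4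
  rw [ENNReal.toReal_add (ENNReal.sub_ne_top (vol_fin hΩb)) ENNReal.ofReal_ne_top, ENNReal.toReal_sub_of_le (measure_mono hs) (vol_fin hΩb), ENNReal.toReal_ofReal (by positivity)] at m5
  linarith

end


section
variable {R v vmax η 𝔗 Λ c₀ κ τ₀ τ : ℝ} {h : Set (Euc n) → ℝ}
variable {δ : ℝ} {ε : ℕ → ℝ} {Ω : ℕ → Set (Euc n)} {wk uk : ℕ → Euc n → ℝ} {Wk Uk : ℕ → Euc n → Euc n} {w u : Euc n → ℝ} {W U : Euc n → Euc n}

lemma SeqD.outer (S : St n R v vmax η 𝔗 Λ c₀ κ τ₀ τ h) (D : SeqD R v vmax η 𝔗 τ₀ τ h δ ε Ω wk uk Wk Uk w u W U)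
    (hL : ContinuousOn L (ball 0 R)) (hLw : ∀ᵐ x ∂volume, x ∈ ball (0 : Euc n) R → L x = w x) (hρ : 0 < ρ) :
    ∀ᶠ k in atTop, (volume ({x ∈ ball (0 : Euc n) R | 0 < L x} \ Ω k)).toReal ≤ ρ := by
  obtain ⟨hn, hR, hv, hvv, hη, hη1, hT, hκ, -, hΛ, -, -, hNM⟩ := S.P
  set O := {x ∈ ball (0 : Euc n) R | 0 < L x} with hO
  have hOb : O ⊆ ball 0 R := fun x hx => hx.1
  let A : ℕ → Set (Euc n) := fun j => {x ∈ ball (0 : Euc n) R | 1 / ((j : ℝ) + 1) < L x}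
  have hA : Monotone A := by
    intro i j hij x hx
    refine ⟨hx.1, lt_of_le_of_lt ?_ hx.2⟩
    exact one_div_le_one_div_of_le (by positivity) (by exact_mod_cast Nat.succ_le_succ hij)
  have hAO : ⋃ j, A j = O := by
    ext x
    simp only [mem_iUnion]
    constructor
    · rintro ⟨j, hj⟩
      exact ⟨hj.1, lt_trans (by positivity) hj.2⟩
    · rintro ⟨h1, h2⟩
      obtain ⟨j, hj⟩ := exists_nat_one_div_lt h2
      exact ⟨j, h1, hj⟩
  have ht := tendsto_measure_iUnion_atTop (μ := volume) hA
  rw [hAO] at ht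
  have ht' := (ENNReal.tendsto_toReal (vol_fin hOb)).comp ht
  obtain ⟨j, hj⟩ := (ht'.eventually (lt_mem_nhds (show (volume O).toReal - ρ / 2 < (volume O).toReal by linarith))).exists
  simp only [Function.comp] at hj
  set s : ℝ := 1 / ((j : ℝ) + 1)
  have hs : 0 < s := by positivity
  have hAjO : A j ⊆ O := hAO ▸ subset_iUnion A j
  have hAo : IsOpen (A j) := hL.isOpen_inter_preimage isOpen_ball (isOpen_Ioi (a := s))
  have hε' : 0 < ρ / 2 * s ^ 2 := by positivity
  filter_upwards [D.w1.eventually (gt_mem_nhds hε')] with k k1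
  have hΩb := (D.hΩ k).2.2.1
  have wk0 := sol_nonneg hn hR hΩb (D.hw k) (eof (oneB_nonneg R))
  have m1 := markov (O := {x | s < w x}) D.w0.1 (D.hw k).1.1 wk0 hs (δ := ρ / 2 * s ^ 2) (by
    refine le_trans (le_of_eq ?_) k1.le
    refine integral_congr_ae (eof fun x => ?_)
    change (w x - wk k x) ^ 2 = (wk k x - w x) ^ 2
    ring) (fun x hx => hx)
  rw [show ρ / 2 * s ^ 2 / s ^ 2 = ρ / 2 by field_simp] at m1
  have m2 : volume (A j \ Ω k) ≤ ENNReal.ofReal (ρ / 2) := by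
    refine (measure_mono_ae ?_).trans m1
    filter_upwards [hLw, (D.hw k).1.ae_zero] with x x1 x2 x3
    refine ⟨?_, ?_⟩
    · change s < w x
      rw [← x1 x3.1.1]; exact x3.1.2
    · intro hx
      have hx : 0 < wk k x := hx
      rw [x2 x3.2] at hx
      exact lt_irrefl _ hx
  have m3 : volume (O \ Ω k) ≤ volume (O \ A j) + ENNReal.ofReal (ρ / 2) := by
    refine (measure_mono (?_ : _ ⊆ (O \ A j) ∪ (A j \ Ω k))).trans ((measure_union_le _ _).trans (add_le_add le_rfl m2))
    rintro x ⟨hx, hx'⟩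
    by_cases h1 : x ∈ A j
    · exact Or.inr ⟨h1, hx'⟩
    · exact Or.inl ⟨hx, h1⟩
  rw [measure_diff hAjO hAo.measurableSet.nullMeasurableSet (vol_fin (hAjO.trans hOb))] at m3
  have m5 := ENNReal.toReal_mono (ENNReal.add_ne_top.2 ⟨ENNReal.sub_ne_top (vol_fin hOb), ENNReal.ofReal_ne_top⟩) m3
  rw [ENNReal.toReal_add (ENNReal.sub_ne_top (vol_fin hOb)) ENNReal.ofReal_ne_top, ENNReal.toReal_sub_of_le (measure_mono hAjO) (vol_fin hOb), ENNReal.toReal_ofReal (by positivity)] at m5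
  linarith

lemma vol_union {A B : Set (Euc n)} (hA : A ⊆ ball 0 R) (hB : B ⊆ ball 0 R) (hm : MeasurableSet A) :
    (volume (A ∪ B)).toReal = (volume A).toReal + (volume (B \ A)).toReal := by
  rw [← union_diff_self, measure_union' disjoint_sdiff_right hm, ENNReal.toReal_add (vol_fin hA) (vol_fin (diff_subset.trans hB))]

lemma SeqD.final (S : St n R v vmax η 𝔗 Λ c₀ κ τ₀ τ h) (D : SeqD R v vmax η 𝔗 τ₀ τ h δ ε Ω wk uk Wk Uk w u W U) :
    ∃ O ∈ Hclass n R vmax, ∀ V ∈ Hclass n R vmax, mainE v η 𝔗 τ h O ≤ mainE v η 𝔗 τ h V := by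
  obtain ⟨hn, hR, hv, hvv, hη, hη1, hT, hκ, -, hΛ, -, -, hNM⟩ := S.P
  have hδ := D.hδ
  have hτκ := S.h1
  have hτ := S.hτ
  have hw0 := D.w_nonneg S
  obtain ⟨C, r₀, hC, hr₀, hb⟩ := D.deriv_bound S
  obtain ⟨L, hL, hLw⟩ := rep hC hr₀ (D.w0.mono (subset_univ _)) (D.w0.integrable Subset.rfl) hb
  obtain ⟨hO, hwO⟩ := mem_pos D.w0 hw0 hL hLw
  have hout := fun {ρ : ℝ} (hρ : 0 < ρ) => D.outer S hL hLw hρ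
  have hin' := fun {ρ : ℝ} (hρ : 0 < ρ) => D.inner S hρ
  set O := {x ∈ ball (0 : Euc n) R | 0 < L x} with hOd
  have hOb : O ⊆ ball 0 R := fun x hx => hx.1
  have hin : ∀ ρ : ℝ, 0 < ρ → ∀ᶠ k in atTop, (volume (Ω k \ O)).toReal ≤ ρ := by
    intro ρ hρ
    filter_upwards [hin' hρ] with k hk
    refine le_trans (ENNReal.toReal_mono (vol_fin (diff_subset.trans (D.hΩ k).2.2.1)) (measure_mono_ae ?_)) hk
    filter_upwards [hLw] with x x1 x2
    have hxb := (D.hΩ k).2.2.1 x2.1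
    refine ⟨x2.1, fun hx => x2.2 ⟨hxb, ?_⟩⟩
    rw [x1 hxb]; exact hx
  have huO : MemH10 O u U := dom2_mem hO (D.u0.mono (subset_univ _)) (hwO.smul (Λ * Linf n Λ 0 1)) D.u_nonneg (D.u_le_w S)
  have hOne : O.Nonempty := nonempty_of_mem huO (by rw [D.u_norm]; exact one_pos)
  have hlO : lam1 O ≤ ∫ x, ‖U x‖ ^ 2 := by
    have := lam1_le huO
    rwa [D.u_norm, mul_one] at this
  have htO := tor_le hn hR hOb hwO
  have key : ∀ θ : ℝ, 0 < θ → ∀ᶠ k in atTop, lam1 O ≤ lam1 (Ω k) + θ ∧ tor O ≤ tor (Ω k) + θ ∧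
      (volume (O \ Ω k)).toReal ≤ θ ∧ (volume (Ω k \ O)).toReal ≤ θ ∧ ε k ≤ θ := by
    intro θ hθ
    have i := D.w_int.eventually (gt_mem_nhds (show (∫ x, w x) < (∫ x, w x) + θ / 2 by linarith))
    filter_upwards [weak_lsc (fun k => (D.hu k).2.1.2.1) D.u0.2.1 (D.u2 U D.u0.2.1) hθ,
      weak_lsc (fun k => (D.hw k).1.2.1) D.w0.2.1 (D.w2 W D.w0.2.1) hθ, i, hout hθ, hin θ hθ, D.hε.eventually (gt_mem_nhds hθ)] with k k1 k2 k3 k4 k5 k6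
    refine ⟨?_, ?_, k4, k5, k6.le⟩
    · rw [(D.hu k).2.2.2] at k1; linarith
    · rw [tor_eq (D.hΩ k).2.2.1 (D.hw k)]; linarith
  have hη' : 0 < 1 / η := by positivity
  have hmeas := fun k => (D.hΩ k).1.measurableSet
  have volO : ∀ k θ, (volume (O \ Ω k)).toReal ≤ θ → (volume O).toReal ≤ (volume (Ω k)).toReal + θ := by
    intro k θ hk
    have h1 := vol_union (D.hΩ k).2.2.1 hOb (hmeas k)
    have h2 := vol_le (subset_union_right (s := Ω k) (t := O)) (union_subset (D.hΩ k).2.2.1 hOb)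
    linarith
  have fpO : ∀ k θ, 0 < θ → (volume (O \ Ω k)).toReal ≤ θ → fpen v η (volume O).toReal ≤ fpen v η (volume (Ω k)).toReal + θ * (1 / η) := by
    intro k θ hθ hk
    have h0 := volO k θ hk
    have hp : 0 < θ * (1 / η) := by positivity
    rcases le_total (volume O).toReal (volume (Ω k)).toReal with hc | hc
    · have h1 := (fpen_diff (v := v) hη hη1 hc).1
      have h2 : 0 ≤ η * ((volume (Ω k)).toReal - (volume O).toReal) := mul_nonneg hη.le (by linarith)
      linarith
    · have h1 := (fpen_diff (v := v) hη hη1 hc).2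
      rw [div_eq_mul_one_div] at h1
      have h2 := mlR (show (volume O).toReal - (volume (Ω k)).toReal ≤ θ by linarith) hη'.le
      linarith
  have bO : ∀ k θ, 0 < θ → lam1 O ≤ lam1 (Ω k) + θ → tor O ≤ tor (Ω k) + θ → (volume (O \ Ω k)).toReal ≤ θ →
      baseE v η 𝔗 O ≤ baseE v η 𝔗 (Ω k) + θ * (1 + 𝔗 + 1 / η) := by
    intro k θ hθ h1 h2 h3
    have h4 := fpO k θ hθ h3
    have h5 := mlL h2 hT.le
    unfold baseE
    linarith
  have hG : 0 < 1 + 𝔗 + 1 / η := by positivity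
  obtain ⟨hOH, hOE⟩ : O ∈ Hclass n R vmax ∧ baseE v η 𝔗 O ≤ Emin n R vmax v η 𝔗 + τ₀ := by
    set θ := min ((vmax - v) / 2) ((τ₀ - δ) / (1 + 𝔗 + 1 / η))
    have hθ : 0 < θ := lt_min (by linarith) (div_pos (by linarith) hG)
    have hθ1 : θ ≤ (vmax - v) / 2 := min_le_left _ _
    have hθ2 : θ * (1 + 𝔗 + 1 / η) ≤ τ₀ - δ := by rw [← le_div_iff₀ hG]; exact min_le_right _ _
    obtain ⟨k, k1, k2, k3, -, -⟩ := (key θ hθ).exists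
    have h1 := volO k θ k3
    have h2 := (hNM _ (D.hΩ k) (by linarith [D.hE k])).2
    have h3 := bO k θ hθ k1 k2 k3
    exact ⟨⟨hO, hOne, hOb, by linarith⟩, by linarith [D.hE k]⟩
  refine ⟨O, hOH, fun V hV => le_of_forall_pos_le_add fun γ hγ => ?_⟩
  set K := (1 + 𝔗 + 1 / η) + (η / 2 + η / 2 + 𝔗 / 2 + 2 * ((1 / η + η / 2) + 1)) + 1 with hK
  have hKp : 0 < K := by positivity
  obtain ⟨θ, hθ, hθ1, hθ2, hθ3⟩ : ∃ θ : ℝ, 0 < θ ∧ θ ≤ (vmax - v) / 2 ∧ θ ≤ η * (τ₀ - δ) ∧ θ * K ≤ γ := by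
    refine ⟨min ((vmax - v) / 2) (min (η * (τ₀ - δ)) (γ / K)), ?_, min_le_left _ _, (min_le_right _ _).trans (min_le_left _ _), ?_⟩
    · exact lt_min (by linarith) (lt_min (mul_pos hη (by linarith)) (by positivity))
    · rw [← le_div_iff₀ hKp]; exact (min_le_right _ _).trans (min_le_right _ _)
  obtain ⟨k, k1, k2, k3, k4, k5⟩ := (key θ hθ).exists
  have hΩb := (D.hΩ k).2.2.1
  have hVo : IsOpen (Ω k ∪ O) := (D.hΩ k).1.union hO
  have hVb : Ω k ∪ O ⊆ ball 0 R := union_subset hΩb hOb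
  have e1 := vol_union hΩb hOb (hmeas k)
  have e2 := vol_union hOb hΩb hO.measurableSet
  rw [union_comm] at e2
  obtain ⟨hVH, hVE⟩ := S.add (D.hΩ k) hVo hVb subset_union_left (D.hE k) hδ.le (m := θ) (by linarith) hθ1 hθ2
  have hΩE : baseE v η 𝔗 (Ω k) ≤ Emin n R vmax v η 𝔗 + τ₀ := by linarith [D.hE k]
  have o1 := S.outward (D.hΩ k) hVH subset_union_left hΩE hVE (D.hF k _ hVH)
  have n1 := S.nest (D.hΩ k) hVH subset_union_left hΩE hVE
  have n2 := S.nest hOH hVH subset_union_right hOE hVE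
  have b1 := bO k θ hθ k1 k2 k3
  have f1 := D.hF k V hV
  have a1 : τ * (h O - h (Ω k)) ≤ τ * |h (Ω k) - h (Ω k ∪ O)| + τ * |h O - h (Ω k ∪ O)| := by
    rw [← mul_add]
    refine mlL ?_ hτ.le
    have := neg_abs_le (h (Ω k) - h (Ω k ∪ O))
    have := le_abs_self (h O - h (Ω k ∪ O))
    linarith
  set V' := Ω k ∪ O
  have g1 : η / 2 * ((volume V').toReal - (volume (Ω k)).toReal) ≤ η / 2 * θ := mlL (by linarith) (by positivity)
  have g2 : η / 2 * ((volume V').toReal - (volume O).toReal) ≤ η / 2 * θ := mlL (by linarith) (by positivity)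
  have g3 : (1 / η + η / 2) * ((volume V').toReal - (volume (Ω k)).toReal) ≤ (1 / η + η / 2) * θ := mlL (by linarith) (by positivity)
  have g4 : 𝔗 / 2 * tor O ≤ 𝔗 / 2 * (tor (Ω k) + θ) := mlL k2 (by positivity)
  unfold mainE at f1 ⊢
  rw [hK] at hθ3
  nlinarith

end

lemma Hclass_ne (hn : 0 < n) (hR : 0 < R) (hv : 0 < v) : (Hclass n R v).Nonempty := by
  haveI : Nonempty (Fin n) := ⟨⟨0, hn⟩⟩
  obtain ⟨U, hU0, hU, hUv⟩ := Set.exists_isOpen_lt_of_lt ({0} : Set (Euc n)) (ENNReal.ofReal v) (μ := volume) (by simpa using hv)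
  exact ⟨U ∩ ball 0 R, hU.inter isOpen_ball, ⟨0, hU0 rfl, mem_ball_self hR⟩, inter_subset_right,
    ENNReal.toReal_le_of_le_ofReal hv.le ((measure_mono inter_subset_left).trans hUv.le)⟩

lemma main_aux (hn : 0 < n) (hR : 0 < R) (hv : 0 < v) (hvv : v < vmax) :
    ∃ η₀ : ℝ, 0 < η₀ ∧ ∀ η : ℝ, 0 < η → η ≤ η₀ →
      ∃ 𝔗₀ : ℝ, 0 < 𝔗₀ ∧ ∀ 𝔗 : ℝ, 0 < 𝔗 → 𝔗 < 𝔗₀ →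
        ∃ τ₀ : ℝ, 0 < τ₀ ∧
          ∀ hfun : Set (Euc n) → ℝ, Admissible n R vmax v η 𝔗 τ₀ hfun →
          ∀ τ : ℝ, 0 < τ → τ < τ₀ →
            ∃ Ω ∈ Hclass n R vmax, ∀ Ω' ∈ Hclass n R vmax,
              mainE v η 𝔗 τ hfun Ω ≤ mainE v η 𝔗 τ hfun Ω' := by
  obtain ⟨η₀, hη₀, H⟩ := par_exists hn hR hv hvv
  refine ⟨η₀, hη₀, fun η hη hη1 => ?_⟩
  obtain ⟨𝔗₀, hT₀, H⟩ := H η hη hη1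
  refine ⟨𝔗₀, hT₀, fun 𝔗 hT hT1 => ?_⟩
  obtain ⟨Λ, c₀, κ, P⟩ := H 𝔗 hT hT1
  have hC : 0 ≤ Cnest n R Λ κ := Cnest_nonneg P.hΛ.le
  have hκ := P.hκ
  refine ⟨min κ (min (η / 2) (𝔗 / 2 / (Cnest n R Λ κ + 1))), lt_min hκ (lt_min (by positivity) (by positivity)), fun hf ha τ hτ hττ => ?_⟩
  have S : St n R v vmax η 𝔗 Λ c₀ κ _ τ hf := ⟨P, min_le_left _ _, (min_le_right _ _).trans (min_le_left _ _), by
    have h1 : min κ (min (η / 2) (𝔗 / 2 / (Cnest n R Λ κ + 1))) ≤ 𝔗 / 2 / (Cnest n R Λ κ + 1) := (min_le_right _ _).trans (min_le_right _ _)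
    rw [le_div_iff₀ (by positivity)] at h1
    linarith, hτ, hττ, ha⟩
  obtain ⟨δ, ε, Ω, wk, uk, Wk, Uk, w, u, W, U, D⟩ := seq_exists S (Hclass_ne hn hR (hv.trans hvv))
  exact D.final S


end

/-- **Existence of minimizers of the main energy.** For `η` small, then `𝔗` small,
there is `τ₀ > 0` such that for every admissible nonlinearity `𝔥` and every `τ < τ₀`,
the main energy `ℱ_τ = ℰ + τ·𝔥` attains its infimum over `𝓗`. -/
theorem main_energy_minimizer_exists (n : ℕ) (hn : 2 ≤ n) (R v vmax : ℝ)
    (hR : 0 < R) (hv : 0 < v) (hvv : v < vmax)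
    (hvmax : vmax < (volume (ball (0 : Euc n) R)).toReal) :
    ∃ η₀ : ℝ, 0 < η₀ ∧ ∀ η : ℝ, 0 < η → η ≤ η₀ →
      ∃ 𝔗₀ : ℝ, 0 < 𝔗₀ ∧ ∀ 𝔗 : ℝ, 0 < 𝔗 → 𝔗 < 𝔗₀ →
        ∃ τ₀ : ℝ, 0 < τ₀ ∧
          ∀ hfun : Set (Euc n) → ℝ, Admissible n R vmax v η 𝔗 τ₀ hfun →
          ∀ τ : ℝ, 0 < τ → τ < τ₀ →
            ∃ Ω ∈ Hclass n R vmax, ∀ Ω' ∈ Hclass n R vmax,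
              mainE v η 𝔗 τ hfun Ω ≤ mainE v η 𝔗 τ hfun Ω' := by
  exact main_aux (by omega) hR hv hvv
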